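/- For every natural number r ≥ 1 and every Liouville number α, there exists a μ-preserving C^∞ diffeomorphism T of the torus T² such that: (1) T lies in the space A_α(T²), i.e., there is a sequence (H_n) of μ-preserving C^∞ diffeomorphisms of T² such that H_n ∘ S_α ∘ H_n⁻¹ converges to T in the C^∞ topology (the lifts of the maps and of their inverses, together with all their partial derivatives, converge uniformly); (2) T is minimal; (3) the Lebesgue measure μ is a generic measure for T; and (4) there exist r pairwise distinct T-invariant Borel probability measures μ_0, …, μ_{r−1}, each absolutely continuous with respect to μ, such that T is weakly mixing with respect to each μ_t. -/

import Mathlib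

open MeasureTheory Filter Topology
open scoped ENNReal
noncomputable section

abbrev Torus2 := UnitAddCircle × UnitAddCircle

/-- Canonical projection `ℝ² → 𝕋²`. -/
def torusProj : ℝ × ℝ → Torus2 := fun p => ((p.1 : UnitAddCircle), (p.2 : UnitAddCircle))

/-- `F : ℝ² → ℝ²` is a lift of `f : 𝕋² → 𝕋²`. -/
def IsLift (F : ℝ × ℝ → ℝ × ℝ) (f : Torus2 → Torus2) : Prop :=
  ∀ p : ℝ × ℝ, torusProj (F p) = f (torusProj p)

/-- `F` commutes with integer translations. -/
def IntEquivariant (F : ℝ × ℝ → ℝ × ℝ) : Prop :=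
  ∀ p : ℝ × ℝ, ∀ m : ℤ × ℤ, F (p + ((m.1 : ℝ), (m.2 : ℝ))) = F p + ((m.1 : ℝ), (m.2 : ℝ))

/-- A C^∞ measure-preserving diffeomorphism of the torus 𝕋². -/
structure SmoothMPTorusDiffeo where
  toEquiv : Torus2 ≃ Torus2
  lift : ℝ × ℝ → ℝ × ℝ
  liftInv : ℝ × ℝ → ℝ × ℝ
  lift_contDiff : ContDiff ℝ (⊤ : ℕ∞) lift
  liftInv_contDiff : ContDiff ℝ (⊤ : ℕ∞) liftInv
  lift_equivariant : IntEquivariant lift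
  liftInv_equivariant : IntEquivariant liftInv
  lift_isLift : IsLift lift toEquiv
  liftInv_isLift : IsLift liftInv toEquiv.symm
  measurePreserving : MeasurePreserving toEquiv volume volume

/-- generic point -/
def IsGenericPt (T : Torus2 → Torus2) (ν : Measure Torus2) (x : Torus2) : Prop :=
  ∀ f : C(Torus2, ℝ),
    Tendsto (fun N : ℕ => (N : ℝ)⁻¹ * ∑ i ∈ Finset.range N, f (T^[i] x)) atTop
      (𝓝 (∫ y, f y ∂ν))

def IsMinimalMap (T : Torus2 → Torus2) : Prop :=
  ∀ x : Torus2, Dense (Set.range fun n : ℕ => T^[n] x)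

def IsWeakMixingWrt (T : Torus2 → Torus2) (ν : Measure Torus2) : Prop :=
  ∃ m : ℕ → ℕ, StrictMono m ∧ ∀ A B : Set Torus2, MeasurableSet A → MeasurableSet B →
    Tendsto (fun n => |(ν (B ∩ (T^[m n]) ⁻¹' A)).toReal - (ν A).toReal * (ν B).toReal|)
      atTop (𝓝 0)

/-- Lift of the translation `S_t`. -/
def Slift (t : ℝ) : ℝ × ℝ → ℝ × ℝ := fun p => (p.1 + t, p.2)

namespace AK

abbrev Ci := UnitAddCircle

def rep (y : Ci) : ℝ := (AddCircle.equivIco 1 0 y : ℝ)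

lemma rep_coe (x : ℝ) : rep (x : Ci) = Int.fract x := by
  unfold rep
  rw [AddCircle.coe_equivIco_mk_apply]; simp

lemma coe_rep (y : Ci) : ((rep y : ℝ) : Ci) = y := AddCircle.coe_equivIco

lemma rep_nonneg (y : Ci) : 0 ≤ rep y := by
  have := (AddCircle.equivIco 1 0 y).2.1; exact this
lemma rep_lt (y : Ci) : rep y < 1 := by
  have h := (AddCircle.equivIco 1 0 y).2.2
  exact h.trans_eq (zero_add 1)

lemma coe_int (n : ℤ) : ((n : ℝ) : Ci) = 0 := by
  have := AddCircle.coe_eq_zero_iff (p := (1:ℝ)) (x := (n:ℝ))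
  rw [this]; exact ⟨n, by simp⟩

lemma rep_coe' (x : ℝ) : rep (x : Ci) = x + ((-⌊x⌋ : ℤ) : ℝ) := by
  rw [rep_coe, Int.fract]; push_cast; ring

lemma measurable_rep : Measurable rep := by
  exact measurable_subtype_coe.comp (AddCircle.measurableEquivIco 1 0).measurable

lemma torusProj_add (p q : ℝ × ℝ) : torusProj (p + q) = torusProj p + torusProj q := by
  simp [torusProj]

lemma torusProj_int (m : ℤ × ℤ) : torusProj ((m.1 : ℝ), (m.2 : ℝ)) = 0 := by
  simp only [torusProj, coe_int]; rfl

lemma torusProj_cont : Continuous torusProj := by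
  unfold torusProj
  exact ((AddCircle.continuous_mk' 1).comp continuous_fst).prodMk
    ((AddCircle.continuous_mk' 1).comp continuous_snd)

lemma torusProj_open : IsOpenMap torusProj := by
  have h : IsOpenMap (fun x : ℝ => (x : Ci)) := QuotientAddGroup.isOpenMap_coe
  exact h.prodMap h

def repp (z : Torus2) : ℝ × ℝ := (rep z.1, rep z.2)

lemma proj_repp (z : Torus2) : torusProj (repp z) = z := by
  simp [torusProj, repp, coe_rep]

lemma torusProj_surj : Function.Surjective torusProj := fun z => ⟨_, proj_repp z⟩

lemma torusProj_quot : IsQuotientMap torusProj :=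
  torusProj_open.isQuotientMap torusProj_cont torusProj_surj

lemma repp_proj (p : ℝ × ℝ) : ∃ m : ℤ × ℤ, repp (torusProj p) = p + ((m.1 : ℝ), (m.2 : ℝ)) :=
  ⟨(-⌊p.1⌋, -⌊p.2⌋), by simp only [repp, torusProj, rep_coe']; rfl⟩

def tor (F : ℝ × ℝ → ℝ × ℝ) (z : Torus2) : Torus2 := torusProj (F (repp z))

lemma tor_proj {F : ℝ × ℝ → ℝ × ℝ} (h : IntEquivariant F) (p : ℝ × ℝ) :
    tor F (torusProj p) = torusProj (F p) := by
  obtain ⟨m, hm⟩ := repp_proj p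
  rw [tor, hm, h, torusProj_add, torusProj_int, add_zero]

lemma tor_cont {F : ℝ × ℝ → ℝ × ℝ} (h : IntEquivariant F) (hc : Continuous F) :
    Continuous (tor F) := by
  rw [torusProj_quot.continuous_iff]
  have : tor F ∘ torusProj = torusProj ∘ F := by ext1 p; exact tor_proj h p
  rw [this]; exact torusProj_cont.comp hc

structure PD where
  f : ℝ × ℝ → ℝ × ℝ
  g : ℝ × ℝ → ℝ × ℝ
  cf : ContDiff ℝ (⊤ : ℕ∞) f
  cg : ContDiff ℝ (⊤ : ℕ∞) g
  ef : IntEquivariant f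
  eg : IntEquivariant g
  fg : ∀ p, f (g p) = p
  gf : ∀ p, g (f p) = p
  mp : MeasurePreserving (tor f) volume volume

namespace PD

lemma ext' {H K : PD} (h : H.f = K.f) : H = K := by
  have hg : H.g = K.g := by
    ext1 p
    rw [← H.gf (K.g p), h, K.fg]
  cases H; cases K; simp_all

def t (H : PD) : Torus2 → Torus2 := tor H.f

lemma t_proj (H : PD) (p : ℝ × ℝ) : H.t (torusProj p) = torusProj (H.f p) := tor_proj H.ef p
lemma t_cont (H : PD) : Continuous H.t := tor_cont H.ef H.cf.continuous
lemma t_mp (H : PD) : MeasurePreserving H.t volume volume := H.mp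

lemma tor_g_f (H : PD) (z : Torus2) : tor H.g (tor H.f z) = z := by
  obtain ⟨p, rfl⟩ := torusProj_surj z
  rw [tor_proj H.ef, tor_proj H.eg, H.gf]
lemma tor_f_g (H : PD) (z : Torus2) : tor H.f (tor H.g z) = z := by
  obtain ⟨p, rfl⟩ := torusProj_surj z
  rw [tor_proj H.eg, tor_proj H.ef, H.fg]

def inv (H : PD) : PD where
  f := H.g
  g := H.f
  cf := H.cg
  cg := H.cf
  ef := H.eg
  eg := H.ef
  fg := H.gf
  gf := H.fg
  mp := by
    refine ⟨(tor_cont H.eg H.cg.continuous).measurable, ?_⟩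
    conv_lhs => rw [← H.mp.map_eq]
    rw [Measure.map_map (tor_cont H.eg H.cg.continuous).measurable H.mp.measurable]
    have : tor H.g ∘ tor H.f = id := by ext1 z; exact H.tor_g_f z
    rw [this, Measure.map_id]

lemma comp_equiv {F G : ℝ × ℝ → ℝ × ℝ} (hF : IntEquivariant F) (hG : IntEquivariant G) :
    IntEquivariant (F ∘ G) := by
  intro p m
  simp only [Function.comp]
  rw [hG, hF]

lemma tor_comp {F G : ℝ × ℝ → ℝ × ℝ} (hF : IntEquivariant F) (hG : IntEquivariant G) :
    tor (F ∘ G) = tor F ∘ tor G := by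
  ext1 z
  obtain ⟨p, rfl⟩ := torusProj_surj z
  rw [tor_proj (comp_equiv hF hG)]
  simp only [Function.comp]
  rw [tor_proj hG, tor_proj hF]

lemma tor_id : tor id = id := by
  ext1 z; simp [tor, proj_repp]

def mul (H K : PD) : PD where
  f := H.f ∘ K.f
  g := K.g ∘ H.g
  cf := H.cf.comp K.cf
  cg := K.cg.comp H.cg
  ef := comp_equiv H.ef K.ef
  eg := comp_equiv K.eg H.eg
  fg := fun p => by simp [K.fg, H.fg]
  gf := fun p => by simp [K.gf, H.gf]
  mp := by
    rw [tor_comp H.ef K.ef]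
    exact H.mp.comp K.mp

def one : PD where
  f := id
  g := id
  cf := contDiff_id
  cg := contDiff_id
  ef := fun _ _ => rfl
  eg := fun _ _ => rfl
  fg := fun _ => rfl
  gf := fun _ => rfl
  mp := by rw [tor_id]; exact MeasurePreserving.id _

instance : Mul PD := ⟨mul⟩
instance : One PD := ⟨one⟩
instance : Inv PD := ⟨inv⟩

lemma mul_f (H K : PD) : (H * K).f = H.f ∘ K.f := rfl
lemma mul_g (H K : PD) : (H * K).g = K.g ∘ H.g := rfl
lemma one_f : (1 : PD).f = id := rfl
lemma inv_f (H : PD) : (H⁻¹).f = H.g := rfl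
lemma inv_g (H : PD) : (H⁻¹).g = H.f := rfl

instance : Group PD := Group.ofLeftAxioms
  (fun a b c => ext' (by simp only [mul_f]; rfl))
  (fun a => ext' (by simp only [mul_f, one_f]; rfl))
  (fun a => ext' (by rw [mul_f, inv_f, one_f]; ext1 p; exact a.gf p))

lemma mul_t (H K : PD) : (H * K).t = H.t ∘ K.t := tor_comp H.ef K.ef
lemma mul_t_apply (H K : PD) (z : Torus2) : (H * K).t z = H.t (K.t z) := by rw [mul_t]; rfl
lemma one_t : (1 : PD).t = id := tor_id
lemma inv_t_t (H : PD) (z : Torus2) : (H⁻¹).t (H.t z) = z := H.tor_g_f z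
lemma t_inv_t (H : PD) (z : Torus2) : H.t ((H⁻¹).t z) = z := H.tor_f_g z
lemma pow_t (H : PD) (n : ℕ) : (H ^ n).t = H.t^[n] := by
  induction n with
  | zero => rw [pow_zero, one_t]; rfl
  | succ k ih => rw [pow_succ, mul_t, ih, Function.iterate_succ]

def toEquiv (H : PD) : Torus2 ≃ Torus2 := ⟨H.t, (H⁻¹).t, H.inv_t_t, H.t_inv_t⟩

def toS (H : PD) : SmoothMPTorusDiffeo where
  toEquiv := H.toEquiv
  lift := H.f
  liftInv := H.g
  lift_contDiff := H.cf
  liftInv_contDiff := H.cg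
  lift_equivariant := H.ef
  liftInv_equivariant := H.eg
  lift_isLift := fun p => (H.t_proj p).symm
  liftInv_isLift := fun p => ((H⁻¹).t_proj p).symm
  measurePreserving := H.mp

end PD

/- characters and density -/
def ch (a b : ℤ) : C(Torus2, ℂ) := ⟨fun z => fourier a z.1 * fourier b z.2, by fun_prop⟩

lemma ch_apply (a b : ℤ) (z : Torus2) : ch a b z = fourier a z.1 * fourier b z.2 := rfl

lemma ch_dense (F : C(Torus2, ℂ)) (ε : ℝ) (hε : 0 < ε) :
    ∃ G ∈ Submodule.span ℂ (Set.range fun n : ℤ × ℤ => ch n.1 n.2), ∀ z, ‖F z - G z‖ < ε := by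
  let e : (Fin 2 → Ci) ≃ₜ Ci × Ci := Homeomorph.finTwoArrow
  let F' : C(UnitAddTorus (Fin 2), ℂ) := F.comp ⟨e, e.continuous⟩
  have h : F' ∈ (Submodule.span ℂ (Set.range (UnitAddTorus.mFourier (d := Fin 2)))).topologicalClosure := by
    rw [UnitAddTorus.span_mFourier_closure_eq_top]; trivial
  rw [← SetLike.mem_coe, Submodule.topologicalClosure_coe, Metric.mem_closure_iff] at h
  obtain ⟨G', hG', hd⟩ := h ε hε
  let L : C(UnitAddTorus (Fin 2), ℂ) →ₗ[ℂ] C(Torus2, ℂ) :=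
    { toFun := fun G => G.comp ⟨e.symm, e.symm.continuous⟩
      map_add' := fun _ _ => rfl
      map_smul' := fun _ _ => rfl }
  refine ⟨L G', ?_, ?_⟩
  · have : L G' ∈ (Submodule.span ℂ (Set.range (UnitAddTorus.mFourier (d := Fin 2)))).map L :=
      Submodule.mem_map_of_mem hG'
    rw [Submodule.map_span] at this
    refine Submodule.span_mono ?_ this
    rintro _ ⟨_, ⟨n, rfl⟩, rfl⟩
    refine ⟨(n 0, n 1), ?_⟩
    ext z
    simp only [ch_apply, L]
    change _ = UnitAddTorus.mFourier n (e.symm z)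
    simp only [UnitAddTorus.mFourier, ContinuousMap.coe_mk, Fin.prod_univ_two]
    rfl
  · intro z
    have := ContinuousMap.dist_apply_le_dist (f := F') (g := G') (e.symm z)
    have h2 : F' (e.symm z) = F z := by
      change F (e (e.symm z)) = F z
      simp
    rw [h2, dist_eq_norm] at this
    exact this.trans_lt hd

theorem torus_induction (P : C(Torus2, ℂ) → Prop)
    (hch : ∀ a b, P (ch a b)) (hadd : ∀ F G, P F → P G → P (F + G))
    (hsmul : ∀ (c : ℂ) F, P F → P (c • F))
    (hlim : ∀ F, (∀ ε > 0, ∃ G, P G ∧ ∀ z, ‖F z - G z‖ < ε) → P F) (F : C(Torus2, ℂ)) : P F := by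
  apply hlim
  intro ε hε
  obtain ⟨G, hG, h⟩ := ch_dense F ε hε
  refine ⟨G, ?_, h⟩
  clear h
  induction hG using Submodule.span_induction with
  | mem x hx => obtain ⟨n, rfl⟩ := hx; exact hch _ _
  | zero =>
    have h := hsmul 0 (ch 0 0) (hch _ _)
    have h0 : (0 : ℂ) • ch 0 0 = 0 := by ext z; simp
    rwa [h0] at h
  | add x y _ _ hx hy => exact hadd _ _ hx hy
  | smul c x _ hx => exact hsmul _ _ hx

end AK

namespace AK

lemma mp_int {X Y E : Type*} [MeasurableSpace X] [MeasurableSpace Y] [NormedAddCommGroup E]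
    [NormedSpace ℝ E] {μ : Measure X} {ν : Measure Y} {T : X → Y} (hT : MeasurePreserving T μ ν)
    {F : Y → E} (hF : AEStronglyMeasurable F ν) : ∫ x, F (T x) ∂μ = ∫ y, F y ∂ν := by
  rw [← hT.map_eq] at hF
  rw [← integral_map hT.measurable.aemeasurable hF, hT.map_eq]

instance instProbC : IsProbabilityMeasure (volume : Measure Ci) :=
  ⟨UnitAddCircle.measure_univ⟩

instance instProbT : IsProbabilityMeasure (volume : Measure Torus2) :=
  Measure.prod.instIsProbabilityMeasure (μ := (volume : Measure Ci)) (ν := (volume : Measure Ci))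

lemma int_close {X E : Type*} [MeasurableSpace X] [NormedAddCommGroup E] [NormedSpace ℝ E]
    {μ : Measure X} [IsProbabilityMeasure μ] {F G : X → E} (hF : Integrable F μ)
    (hG : Integrable G μ) {ε : ℝ} (h : ∀ x, ‖F x - G x‖ ≤ ε) :
    ‖(∫ x, F x ∂μ) - ∫ x, G x ∂μ‖ ≤ ε := by
  rw [← integral_sub hF hG]
  refine (norm_integral_le_of_norm_le_const (ae_of_all _ h)).trans ?_
  simp

lemma cint {F : Torus2 → ℂ} (h : Continuous F) : Integrable F volume :=
  h.integrable_of_hasCompactSupport (HasCompactSupport.of_compactSpace F)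

lemma fou_add (a : ℤ) (x y : Ci) : fourier a (x + y) = fourier a x * fourier a y := by
  rw [fourier_apply, fourier_apply, fourier_apply, smul_add, AddCircle.toCircle_add]
  simp

lemma fou_nsmul (a : ℤ) (q : ℕ) (x : Ci) : fourier a (q • x) = fourier (a * q) x := by
  rw [fourier_apply, fourier_apply, mul_smul, natCast_zsmul]

lemma fou_norm (a : ℤ) (x : Ci) : ‖fourier a x‖ = 1 := by
  rw [fourier_apply]; exact Circle.norm_coe _

lemma fou_eq_one (a : ℤ) (x : Ci) : fourier a x = 1 ↔ a • x = 0 := by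
  rw [fourier_apply]
  constructor
  · intro h
    have h2 : AddCircle.toCircle (a • x) = AddCircle.toCircle (0 : Ci) := by
      rw [AddCircle.toCircle_zero]
      exact Circle.ext h
    exact AddCircle.injective_toCircle one_ne_zero h2
  · intro h; rw [h]; simp

instance instHaarT : (volume : Measure Torus2).IsAddHaarMeasure :=
  Measure.prod.instIsAddHaarMeasure volume volume

lemma int_zero_of_translate {F : Torus2 → ℂ} (w : Torus2) (c : ℂ) (hc : c ≠ 1)
    (h : ∀ z, F (z + w) = c * F z) : ∫ z, F z = 0 := by
  have h1 : ∫ z, F (z + w) = ∫ z, F z := integral_add_right_eq_self F w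
  simp_rw [h] at h1
  rw [integral_const_mul] at h1
  have : (c - 1) * ∫ z, F z = 0 := by linear_combination h1
  exact (mul_eq_zero.1 this).resolve_left (sub_ne_zero.2 hc)

lemma inv_smul_ne (q : ℕ) (hq : 1 ≤ q) (a : ℤ) (h : ¬ (q : ℤ) ∣ a) :
    a • (((1 : ℝ) / q : ℝ) : Ci) ≠ 0 := by
  rw [← AddCircle.coe_zsmul]
  intro h0
  rw [AddCircle.coe_eq_zero_iff] at h0
  obtain ⟨n, hn⟩ := h0
  apply h
  refine ⟨n, ?_⟩
  have hq' : (q : ℝ) ≠ 0 := by positivity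
  simp only [zsmul_eq_mul] at hn
  field_simp at hn
  have : (n : ℝ) * q = a := by linarith
  have : n * (q : ℤ) = a := by exact_mod_cast this
  linarith

lemma q_inv_smul (q : ℕ) (hq : 1 ≤ q) : q • (((1 : ℝ) / q : ℝ) : Ci) = 0 := by
  have hq' : (q : ℝ) ≠ 0 := by positivity
  rw [← AddCircle.coe_nsmul, nsmul_eq_mul, mul_one_div_cancel hq']
  exact_mod_cast coe_int 1

lemma mp_of_char {T : Torus2 → Torus2} (hT : Continuous T)
    (h : ∀ a b, ∫ z, ch a b (T z) = ∫ z, ch a b z) : MeasurePreserving T volume volume := by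
  have key : ∀ F : C(Torus2, ℂ), ∫ z, F (T z) = ∫ z, F z := by
    apply torus_induction (fun F => ∫ z, F (T z) = ∫ z, F z) h
    · intro F G hF hG
      have e1 : ∫ z, (F + G) (T z) = (∫ z, F (T z)) + ∫ z, G (T z) :=
        integral_add (cint (F.continuous.comp hT)) (cint (G.continuous.comp hT))
      have e2 : ∫ z, (F + G) z = (∫ z, F z) + ∫ z, G z :=
        integral_add (cint F.continuous) (cint G.continuous)
      rw [e1, e2, hF, hG]
    · intro c F hF
      have e1 : ∫ z, (c • F) (T z) = c • (∫ z, F (T z)) := integral_smul c _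
      have e2 : ∫ z, (c • F) z = c • (∫ z, F z) := integral_smul c _
      rw [e1, e2, hF]
    · intro F hF
      rw [← sub_eq_zero, ← norm_le_zero_iff]
      apply le_of_forall_pos_le_add
      intro ε hε
      obtain ⟨G, hG, hd⟩ := hF (ε / 2) (by positivity)
      have e1 : ‖(∫ z, F (T z)) - ∫ z, G (T z)‖ ≤ ε / 2 := by
        exact int_close (cint (F.continuous.comp hT)) (cint (G.continuous.comp hT)) fun z => (hd (T z)).le
      have e2 : ‖(∫ z, F z) - ∫ z, G z‖ ≤ ε / 2 :=
        int_close (cint F.continuous) (cint G.continuous) fun z => (hd z).le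
      have : (∫ z, F (T z)) - ∫ z, F z = ((∫ z, F (T z)) - ∫ z, G (T z))
        - ((∫ z, F z) - ∫ z, G z) := by rw [hG]; ring
      rw [this]
      refine (norm_sub_le _ _).trans ?_
      linarith
  refine ⟨hT.measurable, ?_⟩
  have : IsFiniteMeasure (Measure.map T volume) := inferInstance
  apply ext_of_forall_integral_eq_of_IsFiniteMeasure
  intro f
  rw [integral_map hT.measurable.aemeasurable f.continuous.aestronglyMeasurable]
  have := key ⟨fun z => (f z : ℂ), by fun_prop⟩
  simp only [ContinuousMap.coe_mk] at this
  have e1 : ∫ z, ((f (T z) : ℝ) : ℂ) = ((∫ z, f (T z) : ℝ) : ℂ) := integral_ofReal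
  have e2 : ∫ z, ((f z : ℝ) : ℂ) = ((∫ z, f z : ℝ) : ℂ) := integral_ofReal
  rw [e1, e2] at this
  exact_mod_cast this

def Mq (q : ℕ) (z : Torus2) : Torus2 := (q • z.1, z.2)

lemma Mq_cont (q : ℕ) : Continuous (Mq q) := by unfold Mq; fun_prop

lemma mp_nsmul (q : ℕ) (hq : 1 ≤ q) : MeasurePreserving (fun y : Ci => q • y) volume volume := by
  rcases hq.eq_or_lt with h | h
  · subst h; simp only [one_smul]; exact MeasurePreserving.id _
  · exact (AddCircle.ergodic_nsmul h).toMeasurePreserving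

lemma Mq_mp (q : ℕ) (hq : 1 ≤ q) : MeasurePreserving (Mq q) volume volume :=
  (mp_nsmul q hq).prod (MeasurePreserving.id _)

/- smooth periodic functions and shears -/
structure SP where
  F : ℝ → ℝ
  sm : ContDiff ℝ (⊤ : ℕ∞) F
  per : ∀ x, F (x + 1) = F x

namespace SP
lemma periodic (a : SP) : Function.Periodic a.F 1 := a.per
lemma int_per (a : SP) (x : ℝ) (n : ℤ) : a.F (x + n) = a.F x := by
  have := (a.periodic.int_mul n) x
  simpa using this
def c (a : SP) (y : Ci) : ℝ := a.periodic.lift y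
lemma c_coe (a : SP) (x : ℝ) : a.c (x : Ci) = a.F x := Function.Periodic.lift_coe _ _
lemma c_cont (a : SP) : Continuous a.c := by
  have : IsQuotientMap (fun x : ℝ => (x : Ci)) := isQuotientMap_quotient_mk'
  rw [this.continuous_iff]
  have h : a.c ∘ (fun x : ℝ => (x : Ci)) = a.F := by ext x; exact a.c_coe x
  rw [h]; exact a.sm.continuous
lemma c_eq (a : SP) (y : Ci) : a.c y = a.F (rep y) := by
  rw [← a.c_coe, coe_rep]
end SP

def shY (b : SP) : PD where
  f := fun p => (p.1, p.2 + b.F p.1)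
  g := fun p => (p.1, p.2 - b.F p.1)
  cf := by have := b.sm; fun_prop
  cg := by have := b.sm; fun_prop
  ef := fun p m => by
    ext <;> simp [b.int_per]; ring
  eg := fun p m => by
    ext <;> simp [b.int_per]; ring
  fg := fun p => by simp
  gf := fun p => by simp
  mp := by
    have h : tor (fun p => (p.1, p.2 + b.F p.1)) =
        fun z : Torus2 => (z.1, z.2 + ((b.c z.1 : ℝ) : Ci)) := by
      ext1 z
      simp [tor, torusProj, repp, coe_rep, b.c_eq]
    rw [h]
    refine MeasurePreserving.skew_product (f := id)
      (g := fun x y => y + ((b.c x : ℝ) : Ci)) (MeasurePreserving.id _) ?_ ?_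
    · apply Continuous.measurable
      have := b.c_cont
      exact continuous_snd.add ((AddCircle.continuous_mk' 1).comp (this.comp continuous_fst))
    · exact ae_of_all _ fun x => map_add_right_eq_self _ _

lemma shY_t (b : SP) (z : Torus2) : (shY b).t z = (z.1, z.2 + ((b.c z.1 : ℝ) : Ci)) := by
  simp [PD.t, shY, tor, torusProj, repp, coe_rep, b.c_eq]

def shX (b : SP) : PD where
  f := fun p => (p.1 + b.F p.2, p.2)
  g := fun p => (p.1 - b.F p.2, p.2)
  cf := by have := b.sm; fun_prop
  cg := by have := b.sm; fun_prop
  ef := fun p m => by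
    ext <;> simp [b.int_per]; ring
  eg := fun p m => by
    ext <;> simp [b.int_per]; ring
  fg := fun p => by simp
  gf := fun p => by simp
  mp := by
    have h : tor (fun p => (p.1 + b.F p.2, p.2)) =
        Prod.swap ∘ (shY b).t ∘ Prod.swap := by
      ext1 z
      simp [shY_t, tor, torusProj, repp, coe_rep, b.c_eq]
    rw [h]
    have hs : MeasurePreserving (Prod.swap : Torus2 → Torus2) volume volume :=
      Measure.measurePreserving_swap
    exact hs.comp ((shY b).t_mp.comp hs)

lemma shX_t (b : SP) (z : Torus2) : (shX b).t z = (z.1 + ((b.c z.2 : ℝ) : Ci), z.2) := by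
  simp [PD.t, shX, tor, torusProj, repp, coe_rep, b.c_eq]

def cst (s : ℝ) : SP := ⟨fun _ => s, contDiff_const, fun _ => rfl⟩

def rot (s : ℝ) : PD := shX (cst s)

lemma rot_f (s : ℝ) : (rot s).f = Slift s := rfl
lemma rot_t (s : ℝ) (z : Torus2) : (rot s).t z = (z.1 + (s : Ci), z.2) := by
  rw [rot, shX_t, SP.c_eq]; rfl
lemma rot_inv (s : ℝ) : (rot s)⁻¹ = rot (-s) := by
  apply PD.ext'; ext1 p; simp [PD.inv_f, rot, shX, cst, sub_eq_add_neg]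
lemma rot_mul (s u : ℝ) : rot s * rot u = rot (s + u) := by
  apply PD.ext'; ext1 p; simp [PD.mul_f, rot, shX, cst]; ring
lemma rot_pow (s : ℝ) (n : ℕ) : rot s ^ n = rot (n * s) := by
  induction n with
  | zero => apply PD.ext'; ext1 p; simp [PD.one_f, rot, shX, cst]
  | succ k ih => rw [pow_succ, ih, rot_mul]; congr 1; push_cast; ring
lemma rot_shX (s : ℝ) (a : SP) : rot s * shX a = shX a * rot s := by
  apply PD.ext'; ext1 p; simp [PD.mul_f, rot, shX, cst]; ring

/- the q-lift -/
def qf (F : ℝ × ℝ → ℝ × ℝ) (q : ℕ) (p : ℝ × ℝ) : ℝ × ℝ :=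
  ((F (q * p.1, p.2)).1 / q, (F (q * p.1, p.2)).2)

lemma qf_smooth {F : ℝ × ℝ → ℝ × ℝ} (hF : ContDiff ℝ (⊤ : ℕ∞) F) (q : ℕ) :
    ContDiff ℝ (⊤ : ℕ∞) (qf F q) := by
  unfold qf
  have h : ContDiff ℝ (⊤ : ℕ∞) fun p : ℝ × ℝ => F (q * p.1, p.2) := hF.comp (by fun_prop)
  exact (h.fst.div_const _).prodMk h.snd

lemma qf_equiv {F : ℝ × ℝ → ℝ × ℝ} (hF : IntEquivariant F) (q : ℕ) (hq : 1 ≤ q) :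
    IntEquivariant (qf F q) := by
  intro p m
  have hq' : (q : ℝ) ≠ 0 := by positivity
  have h := hF (q * p.1, p.2) (q * m.1, m.2)
  have e : ((q * (p + ((m.1 : ℝ), (m.2 : ℝ))).1, (p + ((m.1 : ℝ), (m.2 : ℝ))).2) : ℝ × ℝ)
    = ((q * p.1, p.2) : ℝ × ℝ) + (((q * m.1 : ℤ) : ℝ), (m.2 : ℝ)) := by
    ext <;> simp; ring
  simp only [qf]
  rw [e, h]
  ext
  · simp; field_simp
  · simp

lemma qf_comp {F G : ℝ × ℝ → ℝ × ℝ} (q : ℕ) (hq : 1 ≤ q) (p : ℝ × ℝ) :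
    qf F q (qf G q p) = qf (F ∘ G) q p := by
  have hq' : (q : ℝ) ≠ 0 := by positivity
  simp [qf, mul_div_cancel₀ _ hq']

lemma qf_id (q : ℕ) (hq : 1 ≤ q) (p : ℝ × ℝ) : qf id q p = p := by
  have hq' : (q : ℝ) ≠ 0 := by positivity
  simp [qf, mul_div_cancel_left₀ _ hq']

lemma Mq_proj (q : ℕ) (p : ℝ × ℝ) : Mq q (torusProj p) = torusProj (q * p.1, p.2) := by
  simp only [Mq, torusProj, ← AddCircle.coe_nsmul, nsmul_eq_mul]

lemma Mq_qf {F : ℝ × ℝ → ℝ × ℝ} (hF : IntEquivariant F) (q : ℕ) (hq : 1 ≤ q) (z : Torus2) :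
    Mq q (tor (qf F q) z) = tor F (Mq q z) := by
  obtain ⟨p, rfl⟩ := torusProj_surj z
  have hq' : (q : ℝ) ≠ 0 := by positivity
  rw [tor_proj (qf_equiv hF q hq), Mq_proj, Mq_proj, tor_proj hF]
  simp [qf, mul_div_cancel₀ _ hq']

lemma qf_rot {F : ℝ × ℝ → ℝ × ℝ} (hF : IntEquivariant F) (q : ℕ) (hq : 1 ≤ q) (k : ℤ) (p : ℝ × ℝ) :
    qf F q (p.1 + k / q, p.2) = ((qf F q p).1 + k / q, (qf F q p).2) := by
  have hq' : (q : ℝ) ≠ 0 := by positivity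
  have h := hF (q * p.1, p.2) (k, 0)
  have e : ((q * (p.1 + k / q), p.2) : ℝ × ℝ) = ((q * p.1, p.2) : ℝ × ℝ) + ((k : ℝ), ((0 : ℤ) : ℝ)) := by
    ext
    · simp; field_simp
    · simp
  simp only [qf]
  rw [e, h]
  ext
  · simp; field_simp
  · simp

lemma tor_qf_rot {F : ℝ × ℝ → ℝ × ℝ} (hF : IntEquivariant F) (q : ℕ) (hq : 1 ≤ q) (z : Torus2) :
    tor (qf F q) (z + ((((1 : ℝ) / q : ℝ) : Ci), 0)) =
      tor (qf F q) z + ((((1 : ℝ) / q : ℝ) : Ci), 0) := by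
  obtain ⟨p, rfl⟩ := torusProj_surj z
  have e : torusProj p + ((((1 : ℝ) / q : ℝ) : Ci), 0) = torusProj (p.1 + (1 : ℤ) / q, p.2) := by
    simp [torusProj]
  rw [e, tor_proj (qf_equiv hF q hq), tor_proj (qf_equiv hF q hq), qf_rot hF q hq]
  simp [torusProj]

lemma qf_mp (A : PD) (q : ℕ) (hq : 1 ≤ q) : MeasurePreserving (tor (qf A.f q)) volume volume := by
  have hc : Continuous (tor (qf A.f q)) :=
    tor_cont (qf_equiv A.ef q hq) (qf_smooth A.cf q).continuous
  apply mp_of_char hc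
  intro a b
  by_cases ha : (q : ℤ) ∣ a
  · obtain ⟨a', rfl⟩ := ha
    have e : ∀ z, ch (q * a') b z = ch a' b (Mq q z) := by
      intro z
      simp only [ch_apply, Mq, fou_nsmul, mul_comm]
    simp_rw [e, Mq_qf A.ef q hq]
    rw [mp_int (F := fun z => ch a' b (tor A.f z)) (Mq_mp q hq)
      ((ch a' b).continuous.comp A.t_cont).aestronglyMeasurable,
      mp_int (F := fun z => ch a' b z) (Mq_mp q hq) (ch a' b).continuous.aestronglyMeasurable,
      mp_int (F := fun z => ch a' b z) A.mp (ch a' b).continuous.aestronglyMeasurable]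
  · have hne : fourier a (((1 : ℝ) / q : ℝ) : Ci) ≠ 1 := by
      rw [Ne, fou_eq_one]; exact inv_smul_ne q hq a ha
    have key : ∀ z : Torus2, ch a b (z + ((((1 : ℝ) / q : ℝ) : Ci), 0)) =
        fourier a (((1 : ℝ) / q : ℝ) : Ci) * ch a b z := by
      intro z
      simp only [ch_apply, Prod.fst_add, Prod.snd_add, fou_add, add_zero]; ring
    rw [int_zero_of_translate _ _ hne key]
    apply int_zero_of_translate ((((1 : ℝ) / q : ℝ) : Ci), 0) _ hne
    intro z
    rw [tor_qf_rot A.ef q hq, key]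

def ql (A : PD) (q : ℕ) : PD :=
  if hq : 1 ≤ q then
    { f := qf A.f q
      g := qf A.g q
      cf := qf_smooth A.cf q
      cg := qf_smooth A.cg q
      ef := qf_equiv A.ef q hq
      eg := qf_equiv A.eg q hq
      fg := fun p => by
        rw [qf_comp q hq]
        have : A.f ∘ A.g = id := by ext1 p; exact A.fg p
        rw [this, qf_id q hq]
      gf := fun p => by
        rw [qf_comp q hq]
        have : A.g ∘ A.f = id := by ext1 p; exact A.gf p
        rw [this, qf_id q hq]
      mp := qf_mp A q hq }
  else 1

lemma ql_f (A : PD) (q : ℕ) (hq : 1 ≤ q) : (ql A q).f = qf A.f q := by simp [ql, hq]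
lemma ql_g (A : PD) (q : ℕ) (hq : 1 ≤ q) : (ql A q).g = qf A.g q := by simp [ql, hq]
lemma ql_inv (A : PD) (q : ℕ) : (ql A q)⁻¹ = ql (A⁻¹) q := by
  apply PD.ext'
  by_cases hq : 1 ≤ q
  · rw [PD.inv_f, ql_g _ _ hq, ql_f _ _ hq]; rfl
  · simp [ql, hq]
lemma Mq_ql (A : PD) (q : ℕ) (hq : 1 ≤ q) (z : Torus2) : Mq q ((ql A q).t z) = A.t (Mq q z) := by
  rw [PD.t, ql_f _ _ hq, Mq_qf A.ef q hq]; rfl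
lemma ql_rot (A : PD) (q : ℕ) (hq : 1 ≤ q) (k : ℤ) :
    ql A q * rot (k / q) = rot (k / q) * ql A q := by
  apply PD.ext'
  ext1 p
  simp only [PD.mul_f, ql_f _ _ hq, rot_f, Function.comp, Slift]
  exact qf_rot A.ef q hq k p

end AK

namespace AK

abbrev E2 := ℝ × ℝ

lemma le_top' (k : ℕ) : ((k : ℕ) : WithTop ℕ∞) ≤ ((⊤ : ℕ∞) : WithTop ℕ∞) := by
  exact_mod_cast le_top

lemma per_bdd {G : Type*} [NormedAddCommGroup G] {F : E2 → G} (hc : Continuous F)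
    (hp : ∀ (p : E2) (m : ℤ × ℤ), F (p + ((m.1 : ℝ), (m.2 : ℝ))) = F p) : ∃ C, 0 ≤ C ∧ ∀ p, ‖F p‖ ≤ C := by
  have hK : IsCompact (Set.Icc (0 : ℝ) 1 ×ˢ Set.Icc (0 : ℝ) 1) := isCompact_Icc.prod isCompact_Icc
  obtain ⟨C, hC⟩ := hK.exists_bound_of_continuousOn hc.continuousOn
  have key : ∀ p, ‖F p‖ ≤ C := by
    intro p
    obtain ⟨m, hm⟩ := repp_proj p
    rw [← hp p m, ← hm]
    apply hC
    simp only [repp, Set.mem_prod, Set.mem_Icc]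
    exact ⟨⟨rep_nonneg _, (rep_lt _).le⟩, ⟨rep_nonneg _, (rep_lt _).le⟩⟩
  exact ⟨C, (norm_nonneg _).trans (key 0), key⟩

lemma iter_add_const {F : E2 → E2} (hF : ContDiff ℝ (⊤ : ℕ∞) F) (c : E2) (k : ℕ) (hk : 1 ≤ k)
    (x : E2) : iteratedFDeriv ℝ k (fun p => F p + c) x = iteratedFDeriv ℝ k F x := by
  have h := iteratedFDeriv_add_apply (𝕜 := ℝ) (i := k) (f := F) (g := fun _ => c) (x := x)
    (hF.of_le (le_top' k)).contDiffAt contDiff_const.contDiffAt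
  rw [iteratedFDeriv_const_of_ne (by omega)] at h
  rw [Pi.zero_apply, add_zero] at h
  exact h

lemma equiv_bdd {F : E2 → E2} (hF : ContDiff ℝ (⊤ : ℕ∞) F) (he : IntEquivariant F) (k : ℕ)
    (hk : 1 ≤ k) : ∃ C, 0 ≤ C ∧ ∀ x, ‖iteratedFDeriv ℝ k F x‖ ≤ C := by
  apply per_bdd (hF.continuous_iteratedFDeriv (le_top' k))
  intro p m
  rw [← iteratedFDeriv_comp_add_right]
  have : (fun z => F (z + ((m.1 : ℝ), (m.2 : ℝ)))) = fun z => F z + ((m.1 : ℝ), (m.2 : ℝ)) := by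
    ext1 z; exact he z m
  rw [this, iter_add_const hF _ k hk]

lemma diff_bdd {F G : E2 → E2} (hF : ContDiff ℝ (⊤ : ℕ∞) F) (he : IntEquivariant F)
    (hG : ContDiff ℝ (⊤ : ℕ∞) G) (hg : IntEquivariant G) (k : ℕ) :
    ∃ C, 0 ≤ C ∧ ∀ x, ‖iteratedFDeriv ℝ k (fun p => F p - G p) x‖ ≤ C := by
  apply per_bdd ((hF.sub hG).continuous_iteratedFDeriv (le_top' k))
  intro p m
  rw [← iteratedFDeriv_comp_add_right]
  congr 1
  ext1 z
  rw [he, hg]; abel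

structure PB (F : ℕ → E2 → E2) : Prop where
  sm : ∀ q, 1 ≤ q → ContDiff ℝ (⊤ : ℕ∞) (F q)
  bd : ∀ k, 1 ≤ k → ∃ C : ℝ, ∃ d : ℕ, 0 ≤ C ∧ ∀ q : ℕ, 1 ≤ q → ∀ x, ‖iteratedFDeriv ℝ k (F q) x‖ ≤ C * (q : ℝ) ^ d

lemma PB.unif {F : ℕ → E2 → E2} (h : PB F) (n : ℕ) : ∃ C : ℝ, ∃ d : ℕ, 1 ≤ C ∧ ∀ q : ℕ, 1 ≤ q →
    ∀ k, 1 ≤ k → k ≤ n → ∀ x, ‖iteratedFDeriv ℝ k (F q) x‖ ≤ C * (q : ℝ) ^ d := by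
  induction n with
  | zero => exact ⟨1, 0, le_rfl, fun q _ k h1 h2 => by omega⟩
  | succ n ih =>
    obtain ⟨C, d, hC, h1⟩ := ih
    obtain ⟨C', d', hC', h2⟩ := h.bd (n + 1) (by omega)
    refine ⟨max C C', max d d', le_max_of_le_left hC, fun q hq k hk hk2 x => ?_⟩
    have hq1 : (1 : ℝ) ≤ q := by exact_mod_cast hq
    rcases Nat.lt_or_ge n k with hh | hh
    · obtain rfl : k = n + 1 := by omega
      refine (h2 q hq x).trans ?_
      gcongr
      · exact le_max_right _ _
      · exact le_max_right _ _
    · refine (h1 q hq k hk hh x).trans ?_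
      gcongr
      · exact le_max_left _ _
      · exact le_max_left _ _

lemma PB.const {F : E2 → E2} (hF : ContDiff ℝ (⊤ : ℕ∞) F) (he : IntEquivariant F) :
    PB (fun _ => F) :=
  ⟨fun _ _ => hF, fun k hk => by
    obtain ⟨C, h0, hC⟩ := equiv_bdd hF he k hk
    exact ⟨C, 0, h0, fun q _ x => by simpa using hC x⟩⟩

def lin (a : ℝ) : E2 →L[ℝ] E2 :=
  (a • ContinuousLinearMap.fst ℝ ℝ ℝ).prod (ContinuousLinearMap.snd ℝ ℝ ℝ)

lemma lin_apply (a : ℝ) (p : E2) : lin a p = (a * p.1, p.2) := by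
  simp [lin]

lemma lin_norm (a : ℝ) : ‖lin a‖ ≤ max |a| 1 := by
  apply ContinuousLinearMap.opNorm_le_bound _ (by positivity)
  intro p
  rw [lin_apply, Prod.norm_def]
  apply max_le
  · simp only [norm_mul, Real.norm_eq_abs]
    gcongr
    · exact le_max_left _ _
    · exact norm_fst_le p
  · simp only
    calc ‖p.2‖ ≤ 1 * ‖p‖ := by rw [one_mul]; exact norm_snd_le p
      _ ≤ _ := by gcongr; exact le_max_right _ _

lemma qf_eq (F : E2 → E2) (q : ℕ) : qf F q = lin ((q : ℝ)⁻¹) ∘ (F ∘ lin q) := by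
  ext1 p; simp [qf, lin_apply]; ring

lemma PB.qf {F : E2 → E2} (hF : ContDiff ℝ (⊤ : ℕ∞) F) (he : IntEquivariant F) :
    PB (fun q => qf F q) := by
  refine ⟨fun q _ => qf_smooth hF q, fun k hk => ?_⟩
  obtain ⟨C, h0, hC⟩ := equiv_bdd hF he k hk
  refine ⟨C, k, h0, fun q hq x => ?_⟩
  have hq1 : (1 : ℝ) ≤ q := by exact_mod_cast hq
  rw [qf_eq]
  have hs : ContDiff ℝ (⊤ : ℕ∞) (F ∘ lin q) := hF.comp (lin q).contDiff
  refine ((lin _).norm_iteratedFDeriv_comp_left hs.contDiffAt (le_top' k)).trans ?_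
  rw [(lin q).iteratedFDeriv_comp_right hF x (le_top' k)]
  have h1 : ‖lin ((q : ℝ)⁻¹)‖ ≤ 1 := (lin_norm _).trans (by
    rw [abs_of_nonneg (by positivity)]
    exact max_le (inv_le_one_of_one_le₀ hq1) le_rfl)
  have h2 : ‖lin (q : ℝ)‖ ≤ q := (lin_norm _).trans (by
    rw [abs_of_nonneg (by positivity)]
    exact max_le le_rfl hq1)
  calc _ ≤ 1 * (‖iteratedFDeriv ℝ k F (lin q x)‖ * ∏ i : Fin k, ‖lin (q : ℝ)‖) := by
        gcongr
        exact ContinuousMultilinearMap.norm_compContinuousLinearMap_le _ _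
    _ ≤ C * (q : ℝ) ^ k := by
        rw [one_mul, Finset.prod_const, Finset.card_univ, Fintype.card_fin]
        gcongr
        exact hC _

lemma PB.comp {F G : ℕ → E2 → E2} (hF : PB F) (hG : PB G) : PB (fun q => F q ∘ G q) := by
  refine ⟨fun q hq => (hF.sm q hq).comp (hG.sm q hq), fun k hk => ?_⟩
  obtain ⟨C, d, hC, h1⟩ := hF.unif k
  obtain ⟨C', d', hC', h2⟩ := hG.unif k
  refine ⟨k.factorial * C * C' ^ k, d + d' * k, by positivity, fun q hq x => ?_⟩
  have hq1 : (1 : ℝ) ≤ q := by exact_mod_cast hq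
  set c := F q (G q x) with hc
  have e : iteratedFDeriv ℝ k (F q ∘ G q) x = iteratedFDeriv ℝ k ((fun p => F q p + (-c)) ∘ G q) x := by
    rw [← iter_add_const ((hF.sm q hq).comp (hG.sm q hq)) (-c) k hk]; rfl
  rw [e]
  have h3 := norm_iteratedFDeriv_comp_le (𝕜 := ℝ) (g := fun p => F q p + (-c)) (f := G q) (n := k)
    ((hF.sm q hq).add contDiff_const) (hG.sm q hq) (le_top' k) x (C := C * (q : ℝ) ^ d)
    (D := C' * (q : ℝ) ^ d') ?_ ?_
  · refine h3.trans (le_of_eq ?_)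
    rw [mul_pow, pow_add, pow_mul]; ring
  · intro i hi
    rcases Nat.eq_zero_or_pos i with rfl | hi0
    · rw [norm_iteratedFDeriv_zero, ← hc, add_neg_cancel, norm_zero]; positivity
    · rw [iter_add_const (hF.sm q hq) _ i hi0]
      exact h1 q hq i hi0 hi _
  · intro i hi hi2
    refine (h2 q hq i hi hi2 x).trans ?_
    apply le_self_pow₀ _ (by omega)
    calc (1 : ℝ) = 1 * 1 := by ring
      _ ≤ _ := by gcongr; exact one_le_pow₀ hq1

lemma close1 {F G : ℕ → E2 → E2} (hF : PB F) (hG : PB G) (n : ℕ) :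
    ∃ C : ℝ, ∃ d : ℕ, 0 ≤ C ∧ ∀ q : ℕ, 1 ≤ q → ∀ v w : E2, ∀ k ≤ n, ∀ x,
      ‖iteratedFDeriv ℝ k (fun p => F q (G q p + v) - F q (G q p + w)) x‖ ≤ ‖v - w‖ * (C * (q : ℝ) ^ d) := by
  obtain ⟨C, d, hC, h1⟩ := hF.unif (n + 1)
  obtain ⟨C', d', hC', h2⟩ := hG.unif n
  refine ⟨n.factorial * C * C' ^ n, d + d' * n, by positivity, fun q hq v w k hk x => ?_⟩
  have hq1 : (1 : ℝ) ≤ q := by exact_mod_cast hq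
  have hD1 : 1 ≤ C' * (q : ℝ) ^ d' := by
    calc (1 : ℝ) = 1 * 1 := by ring
      _ ≤ _ := by gcongr; exact one_le_pow₀ hq1
  have sm := hF.sm q hq
  have smv : ∀ v, ContDiff ℝ (⊤ : ℕ∞) fun p => F q (p + v) := fun v => sm.comp (by fun_prop)
  have h3 := norm_iteratedFDeriv_comp_le (𝕜 := ℝ) (g := (fun p => F q (p + v)) - fun p => F q (p + w))
    (f := G q) (n := k)
    ((smv v).sub (smv w)) (hG.sm q hq) (le_top' k) x (C := ‖v - w‖ * (C * (q : ℝ) ^ d))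
    (D := C' * (q : ℝ) ^ d') ?_ ?_
  · refine (le_trans (le_of_eq ?_) h3).trans ?_
    · rfl
    calc (k.factorial : ℝ) * (‖v - w‖ * (C * (q : ℝ) ^ d)) * (C' * (q : ℝ) ^ d') ^ k
      ≤ n.factorial * (‖v - w‖ * (C * (q : ℝ) ^ d)) * (C' * (q : ℝ) ^ d') ^ n := by
          gcongr
      _ = _ := by rw [mul_pow, pow_add, pow_mul]; ring
  · intro i hi
    rw [iteratedFDeriv_sub_apply ((smv v).of_le (le_top' i)).contDiffAt
      ((smv w).of_le (le_top' i)).contDiffAt, iteratedFDeriv_comp_add_right,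
      iteratedFDeriv_comp_add_right]
    have hd : ContDiff ℝ 1 (iteratedFDeriv ℝ i (F q)) :=
      sm.iteratedFDeriv_right (by exact_mod_cast le_top)
    have := Convex.norm_image_sub_le_of_norm_fderiv_le (𝕜 := ℝ) (f := iteratedFDeriv ℝ i (F q))
      (C := C * (q : ℝ) ^ d) (s := Set.univ) (x := G q x + w) (y := G q x + v)
      (fun x _ => (hd.differentiable one_ne_zero) x) (fun x _ => by
        rw [norm_fderiv_iteratedFDeriv]
        exact h1 q hq (i + 1) (by omega) (by omega) x) convex_univ trivial trivial
    refine this.trans (le_of_eq ?_)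
    rw [add_sub_add_left_eq_sub]; ring
  · intro i hi hi2
    refine (h2 q hq i hi (hi2.trans hk) x).trans ?_
    exact le_self_pow₀ hD1 (by omega)

def Tc (H : PD) (s : ℝ) : PD := H * rot s * H⁻¹

lemma Tc_inv (H : PD) (s : ℝ) : (Tc H s)⁻¹ = Tc H (-s) := by
  simp only [Tc, mul_inv_rev, inv_inv, rot_inv, mul_assoc]

lemma Tc_f (H : PD) (s : ℝ) (p : E2) : (Tc H s).f p = H.f (H.g p + (s, 0)) := by
  simp only [Tc, PD.mul_f, Function.comp, PD.inv_f, rot_f, Slift]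
  congr 1
  ext <;> simp

lemma close2 (H A : PD) (n : ℕ) : ∃ C : ℝ, ∃ d : ℕ, 0 ≤ C ∧ ∀ q : ℕ, 1 ≤ q → ∀ (s : ℝ) (m : ℤ),
    ∀ k ≤ n, ∀ x, ‖iteratedFDeriv ℝ k (fun p => (Tc (H * ql A q) s).f p - (Tc H s).f p) x‖ ≤
      |s - m / q| * (C * (q : ℝ) ^ d) := by
  obtain ⟨C, d, hC, h1⟩ := close1 ((PB.const H.cf H.ef).comp (PB.qf A.cf A.ef))
    ((PB.qf A.cg A.eg).comp (PB.const H.cg H.eg)) n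
  obtain ⟨C', d', hC', h2⟩ := close1 (PB.const H.cf H.ef) (PB.const H.cg H.eg) n
  refine ⟨C + C', max d d', by positivity, fun q hq s m k hk x => ?_⟩
  have hq1 : (1 : ℝ) ≤ q := by exact_mod_cast hq
  have a1 := h1 q hq (s, 0) (m / q, 0) k hk x
  have a2 := h2 q hq (m / q, 0) (s, 0) k hk x
  have n1 : ‖((s, 0) : E2) - ((m / q : ℝ), 0)‖ = |s - m / q| := by
    rw [Prod.mk_sub_mk, sub_zero, Prod.norm_mk]; simp
  have n2 : ‖(((m / q : ℝ), 0) : E2) - (s, 0)‖ = |s - m / q| := by rw [norm_sub_rev, n1]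
  rw [n1] at a1
  rw [n2] at a2
  have e0 : ∀ p, (Tc (H * ql A q) (m / q)).f p = (Tc H (m / q)).f p := by
    intro p
    have : Tc (H * ql A q) (m / q) = Tc H (m / q) := by
      simp only [Tc, mul_assoc, mul_inv_rev]
      rw [← mul_assoc (ql A q) (rot _), ql_rot A q hq]
      group
    rw [this]
  have e : (fun p => (Tc (H * ql A q) s).f p - (Tc H s).f p) =
      (fun p => (H.f ∘ qf A.f q) ((qf A.g q ∘ H.g) p + (s, 0)) -
        (H.f ∘ qf A.f q) ((qf A.g q ∘ H.g) p + ((m / q : ℝ), 0))) +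
      (fun p => H.f (H.g p + ((m / q : ℝ), 0)) - H.f (H.g p + (s, 0))) := by
    ext1 p
    simp only [Pi.add_apply]
    rw [← Tc_f, ← Tc_f, ← e0, Tc_f, Tc_f (H * ql A q)]
    simp only [PD.mul_f, PD.mul_g, ql_f _ _ hq, ql_g _ _ hq]
    simp only [Function.comp]
    abel
  rw [e, iteratedFDeriv_add_apply]
  · refine (norm_add_le _ _).trans ((add_le_add a1 a2).trans ?_)
    rw [← mul_add, add_mul]
    gcongr
    · exact le_max_left _ _
    · exact le_max_right _ _
  · apply ContDiff.contDiffAt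
    apply ContDiff.of_le _ (le_top' k)
    have c1 := H.cf.comp (qf_smooth A.cf q)
    have c2 := (qf_smooth A.cg q).comp H.cg
    exact (c1.comp (c2.add contDiff_const)).sub (c1.comp (c2.add contDiff_const))
  · apply ContDiff.contDiffAt
    apply ContDiff.of_le _ (le_top' k)
    exact (H.cf.comp (H.cg.add contDiff_const)).sub (H.cf.comp (H.cg.add contDiff_const))

/- the Liouville filter -/
def th (α : ℝ) (q : ℕ) : ℝ := q * α - round (q * α)

def LF (α : ℝ) : Filter ℕ := ⨅ d : ℕ, 𝓟 {q : ℕ | d ≤ q ∧ |th α q| * (q : ℝ) ^ d < 1}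

lemma LF_ev (α : ℝ) (d : ℕ) : ∀ᶠ q in LF α, d ≤ q ∧ |th α q| * (q : ℝ) ^ d < 1 :=
  mem_iInf_of_mem d (mem_principal_self _)

lemma LF_atTop (α : ℝ) : LF α ≤ atTop := by
  rw [atTop]
  refine le_iInf fun d => ?_
  rw [le_principal_iff]
  exact (LF_ev α d).mono fun q h => h.1

lemma LF_neBot {α : ℝ} (hα : Liouville α) : (LF α).NeBot := by
  have hd : Directed (· ≥ ·) fun d : ℕ => 𝓟 {q : ℕ | d ≤ q ∧ |th α q| * (q : ℝ) ^ d < 1} := by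
    intro d e
    refine ⟨max (max d e) 1, ?_, ?_⟩ <;>
    · refine principal_mono.2 ?_
      rintro q ⟨h1, h2⟩
      have h3 : 1 ≤ q := le_trans (le_max_right _ _) h1
      have hq1 : (1 : ℝ) ≤ q := by exact_mod_cast h3
      refine ⟨by omega, lt_of_le_of_lt ?_ h2⟩
      gcongr
      omega
  refine iInf_neBot_of_directed' hd fun d => ?_
  rw [principal_neBot_iff]
  have h := (hα.frequently_exists_num (d + 1)).and_eventually (eventually_ge_atTop (d + 1))
  obtain ⟨q, ⟨a, _, h1⟩, h2⟩ := h.exists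
  have hq0 : (0 : ℝ) < q := by exact_mod_cast (by omega : 0 < q)
  refine ⟨q, by omega, ?_⟩
  have h3 : |th α q| ≤ |q * α - a| := round_le _ _
  have h4 : |q * α - a| = q * |α - a / q| := by
    rw [← abs_of_pos hq0, ← abs_mul, abs_of_pos hq0]; congr 1; field_simp
  calc |th α q| * (q : ℝ) ^ d ≤ (q * |α - a / q|) * (q : ℝ) ^ d := by rw [← h4]; gcongr
    _ = |α - a / q| * (q : ℝ) ^ (d + 1) := by ring
    _ < (1 / (q : ℝ) ^ (d + 1)) * (q : ℝ) ^ (d + 1) := by gcongr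
    _ = 1 := by field_simp

lemma LF_small (α : ℝ) (C : ℝ) (d : ℕ) (ε : ℝ) (hε : 0 < ε) :
    ∀ᶠ q in LF α, |th α q| * (C * (q : ℝ) ^ d) < ε := by
  obtain ⟨N, hN⟩ := exists_nat_gt (C / ε)
  filter_upwards [LF_ev α (d + 1), LF_atTop α (eventually_ge_atTop (N + 1))] with q h1 h2
  have hq : (C / ε) < q := hN.trans (by exact_mod_cast h2)
  have hq0 : (0 : ℝ) < q := by exact_mod_cast (by omega : 0 < q)
  rw [div_lt_iff₀ hε] at hq
  calc |th α q| * (C * (q : ℝ) ^ d) ≤ |th α q| * ((q * ε) * (q : ℝ) ^ d) := by gcongr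
    _ = ε * (|th α q| * (q : ℝ) ^ (d + 1)) := by ring
    _ < ε * 1 := by gcongr; exact h1.2
    _ = ε := mul_one _

lemma close3 (α : ℝ) (H A : PD) (n : ℕ) (ε : ℝ) (hε : 0 < ε) : ∀ᶠ q in LF α,
    (∀ k ≤ n, ∀ x, ‖iteratedFDeriv ℝ k (fun p => (Tc (H * ql A q) α).f p - (Tc H α).f p) x‖ ≤ ε) ∧
    (∀ k ≤ n, ∀ x, ‖iteratedFDeriv ℝ k (fun p => (Tc (H * ql A q) α).g p - (Tc H α).g p) x‖ ≤ ε) := by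
  obtain ⟨C, d, hC, h⟩ := close2 H A n
  filter_upwards [LF_small α C d ε hε, LF_atTop α (eventually_ge_atTop 1)] with q h1 h2
  have hq1 : (1 : ℝ) ≤ q := by exact_mod_cast h2
  have e : |α - round (q * α) / q| ≤ |th α q| := by
    have : α - round (q * α) / q = th α q / q := by rw [th]; field_simp
    rw [this, abs_div, abs_of_pos (by positivity : (0 : ℝ) < q)]
    exact div_le_self (abs_nonneg _) hq1
  have e2 : |α - round (q * α) / q| * (C * (q : ℝ) ^ d) ≤ ε :=
    (mul_le_mul_of_nonneg_right e (by positivity)).trans h1.le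
  refine ⟨fun k hk x => (h q h2 α (round (q * α)) k hk x).trans e2, fun k hk x => ?_⟩
  have h3 := h q h2 (-α) (-round (q * α)) k hk x
  rw [← Tc_inv, ← Tc_inv] at h3
  simp only [PD.inv_f] at h3
  refine h3.trans (le_trans (le_of_eq ?_) e2)
  congr 1
  rw [← abs_neg]; congr 1; push_cast; ring

end AK

namespace AK

def ex (x : ℝ) : ℂ := (Real.fourierChar x : ℂ)

lemma ex_norm (x : ℝ) : ‖ex x‖ = 1 := Circle.norm_coe _
lemma ex_cont : Continuous ex := by
  unfold ex
  exact continuous_subtype_val.comp Real.continuous_fourierChar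
lemma ex_add (x y : ℝ) : ex (x + y) = ex x * ex y := by
  simp [ex, AddChar.map_add_eq_mul]
lemma fou_coe (n : ℤ) (x : ℝ) : fourier n (x : Ci) = ex (n * x) := by
  rw [fourier_coe_apply, ex, Real.fourierChar_apply]; congr 1; push_cast; simp; ring

lemma null_preimage {f : ℝ → ℝ} (hf : ContDiff ℝ 1 f) {N : Set ℝ} (hN : MeasurableSet N)
    (h0 : volume N = 0) : volume ({x | deriv f x ≠ 0} ∩ f ⁻¹' N) = 0 := by
  have hdc : Continuous (deriv f) := hf.continuous_deriv_one
  apply measure_null_of_locally_null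
  rintro x ⟨hx, -⟩
  have hs : HasStrictDerivAt f (deriv f x) x := hf.contDiffAt.hasStrictDerivAt one_ne_zero
  have hs2 := hs.hasStrictFDerivAt_equiv hx
  let e := hs2.toOpenPartialHomeomorph f
  have hec : (e : ℝ → ℝ) = f := hs2.toOpenPartialHomeomorph_coe
  have hxe : x ∈ e.source := hs2.mem_toOpenPartialHomeomorph_source
  have hinj : Set.InjOn f e.source := by rw [← hec]; exact e.injOn
  refine ⟨({x | deriv f x ≠ 0} ∩ f ⁻¹' N) ∩ e.source, ?_, ?_⟩
  · exact inter_mem self_mem_nhdsWithin (mem_nhdsWithin_of_mem_nhds (e.open_source.mem_nhds hxe))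
  · set S := ({x | deriv f x ≠ 0} ∩ f ⁻¹' N) ∩ e.source with hS
    have hSm : MeasurableSet S := by
      refine ((MeasurableSet.inter ?_ (hf.continuous.measurable hN))).inter e.open_source.measurableSet
      exact (isOpen_ne.preimage hdc).measurableSet
    have h1 := lintegral_image_eq_lintegral_abs_deriv_mul hSm (f := f) (f' := deriv f)
      (fun y _ => ((hf.differentiable one_ne_zero) y).hasDerivAt.hasDerivWithinAt)
      (hinj.mono Set.inter_subset_right) (fun _ => 1)
    have h2 : volume (f '' S) = 0 := by
      refine measure_mono_null ?_ h0
      rintro _ ⟨y, hy, rfl⟩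
      exact hy.1.2
    simp only [mul_one, lintegral_one, Measure.restrict_apply_univ, h2] at h1
    have h3 := (setLIntegral_eq_zero_iff hSm (by fun_prop)).1 h1.symm
    rw [ae_iff] at h3
    refine measure_mono_null ?_ h3
    intro y hy
    simp only [Set.mem_ofPred_eq, Classical.not_imp]
    refine ⟨hy, ?_⟩
    have := hy.1.1
    simpa using this

lemma RL0 {f : ℝ → ℝ} (hf : ContDiff ℝ 1 f) (μ : Measure ℝ) [IsFiniteMeasure μ]
    (hμ : μ ≪ volume.restrict {x | deriv f x ≠ 0}) :
    Tendsto (fun l : ℝ => ∫ x, ex (l * f x) ∂μ) (cocompact ℝ) (𝓝 0) := by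
  have hfm := hf.continuous.measurable
  have hac : μ.map f ≪ volume := by
    refine Measure.AbsolutelyContinuous.mk fun N hN h0 => ?_
    rw [Measure.map_apply hfm hN]
    apply hμ
    rw [Measure.restrict_apply (hfm hN), Set.inter_comm]
    exact null_preimage hf hN h0
  have h1 := Real.tendsto_integral_exp_smul_cocompact
    (fun y => (((μ.map f).rnDeriv volume y).toReal : ℂ))
  have h2 := h1.comp (Homeomorph.neg ℝ).isClosedEmbedding.tendsto_cocompact
  refine h2.congr fun l => ?_
  have h3 : ∫ x, ex (l * f x) ∂μ = ∫ y, ex (l * y) ∂(μ.map f) := by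
    rw [integral_map hfm.aemeasurable]
    exact (ex_cont.comp (by fun_prop)).aestronglyMeasurable
  rw [h3, ← integral_rnDeriv_smul hac]
  simp only [Function.comp]
  apply integral_congr_ae
  refine ae_of_all _ fun y => ?_
  have : -(y * (Homeomorph.neg ℝ) l) = l * y := by simp; ring
  simp only [this]
  rw [Circle.smul_def, smul_eq_mul, mul_comm]; rfl

lemma RL {f : ℝ → ℝ} (hf : ContDiff ℝ 1 f) {g : ℝ → ℂ} (hg : Integrable g volume)
    (hs : ∀ᵐ x, g x ≠ 0 → deriv f x ≠ 0) :
    Tendsto (fun l : ℝ => ∫ x, g x * ex (l * f x)) (cocompact ℝ) (𝓝 0) := by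
  set μ := volume.restrict {x | deriv f x ≠ 0} with hμ
  have hec : ∀ l : ℝ, Continuous fun x => ex (l * f x) := fun l =>
    ex_cont.comp (by have := hf.continuous; fun_prop)
  have hinteg : ∀ (g : ℝ → ℂ) (l : ℝ), Integrable g μ → Integrable (fun x => g x * ex (l * f x)) μ := by
    intro g l hg
    refine hg.mul_bdd (c := 1) (hec l).aestronglyMeasurable (ae_of_all _ fun x => (ex_norm _).le)
  have key : ∀ ⦃g : ℝ → ℂ⦄, Integrable g μ →
      Tendsto (fun l : ℝ => ∫ x, g x * ex (l * f x) ∂μ) (cocompact ℝ) (𝓝 0) := by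
    apply Integrable.induction
    · intro c s hs hs2
      have : IsFiniteMeasure (μ.restrict s) := ⟨by rwa [Measure.restrict_apply_univ]⟩
      have h := (RL0 hf (μ.restrict s) Measure.restrict_le_self.absolutelyContinuous).const_mul c
      rw [mul_zero] at h
      refine h.congr fun l => ?_
      rw [← integral_indicator hs, ← integral_const_mul]
      congr 1
      ext1 x
      by_cases hx : x ∈ s <;> simp [hx]
    · intro f1 g1 _ h1 h2 h3 h4
      have := h3.add h4
      rw [add_zero] at this
      refine this.congr fun l => ?_
      rw [← integral_add (hinteg _ _ h1) (hinteg _ _ h2)]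
      congr 1
      ext1 x
      simp only [Pi.add_apply]; ring
    · rw [← isSeqClosed_iff_isClosed]
      intro u v hu huv
      simp only [Set.mem_ofPred_eq] at hu ⊢
      rw [Metric.tendsto_nhds]
      intro ε hε
      have h1 := (Metric.tendsto_nhds.1 huv (ε / 2) (by positivity)).exists
      obtain ⟨n, hn⟩ := h1
      filter_upwards [Metric.tendsto_nhds.1 (hu n) (ε / 2) (by positivity)] with l hl
      rw [dist_zero_right] at hl ⊢
      have e : ∫ x, v x * ex (l * f x) ∂μ = (∫ x, u n x * ex (l * f x) ∂μ)
          + ∫ x, (v x - u n x) * ex (l * f x) ∂μ := by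
        rw [← integral_add (hinteg _ _ (L1.integrable_coeFn _)) (hinteg (fun x => v x - u n x) l
          ((L1.integrable_coeFn v).sub (L1.integrable_coeFn (u n))))]
        congr 1
        ext1 x
        ring
      have e2 : ‖∫ x, (v x - u n x) * ex (l * f x) ∂μ‖ < ε / 2 := by
        refine (norm_integral_le_integral_norm _).trans_lt ?_
        rw [dist_comm, dist_eq_norm, L1.norm_eq_integral_norm] at hn
        refine lt_of_eq_of_lt ?_ hn
        apply integral_congr_ae
        filter_upwards [Lp.coeFn_sub v (u n)] with x hx
        rw [norm_mul, ex_norm, mul_one, hx]; rfl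
      rw [e]
      refine (norm_add_le _ _).trans_lt ?_
      linarith
    · intro f1 g1 h _ h1
      refine h1.congr fun l => ?_
      apply integral_congr_ae
      filter_upwards [h] with x hx
      rw [hx]
  refine (key hg.restrict).congr fun l => ?_
  rw [hμ]
  apply setIntegral_eq_integral_of_ae_compl_eq_zero
  filter_upwards [hs] with x hx hx2
  have : g x = 0 := by
    by_contra h
    exact hx2 (hx h)
  rw [this, zero_mul]

end AK

namespace AK

lemma mp_rep : MeasurePreserving rep volume (volume.restrict (Set.Ico (0:ℝ) 1)) := by
  refine ⟨measurable_rep, ?_⟩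
  have h := UnitAddCircle.measurePreserving_mk 0
  rw [← h.map_eq, Measure.map_map measurable_rep h.measurable]
  rw [zero_add, ← Measure.restrict_congr_set (Ioo_ae_eq_Ico (a := (0:ℝ)) (b := 1) (μ := volume)),
    ← Measure.restrict_congr_set (Ioo_ae_eq_Ioc (a := (0:ℝ)) (b := 1) (μ := volume))]
  have : Measure.map (rep ∘ fun x : ℝ => (x : Ci)) (volume.restrict (Set.Ioo (0:ℝ) 1)) =
      Measure.map id (volume.restrict (Set.Ioo (0:ℝ) 1)) := by
    apply Measure.map_congr
    filter_upwards [ae_restrict_mem measurableSet_Ioo] with x hx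
    simp only [Function.comp, rep_coe, id]
    exact Int.fract_eq_self.2 ⟨hx.1.le, hx.2⟩
  rw [this, Measure.map_id]

def BB : Set Ci := {z | rep z < 1/2}

lemma BB_meas : MeasurableSet BB := measurable_rep measurableSet_Iio

lemma mem_BB_coe (x : ℝ) : (x : Ci) ∈ BB ↔ Int.fract x < 1/2 := by
  rw [← rep_coe]; rfl

lemma nsmul_coe (n : ℕ) (x : ℝ) : n • (x : Ci) = ((n * x : ℝ) : Ci) := by
  rw [← AddCircle.coe_nsmul, nsmul_eq_mul]

lemma two_half : (2:ℕ) • ((1/2 : ℝ) : Ci) = 0 := by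
  rw [nsmul_coe]; norm_num

lemma half_neg : -((1/2 : ℝ) : Ci) = ((1/2 : ℝ) : Ci) := by
  have := two_half
  rw [two_nsmul] at this
  exact neg_eq_of_add_eq_zero_left this

lemma BB_half (z : Ci) : z + ((1/2 : ℝ) : Ci) ∈ BB ↔ z ∉ BB := by
  obtain ⟨x, hx, rfl⟩ : ∃ x : ℝ, (0 ≤ x ∧ x < 1) ∧ (x : Ci) = z :=
    ⟨rep z, ⟨rep_nonneg z, rep_lt z⟩, coe_rep z⟩
  rw [← AddCircle.coe_add, mem_BB_coe, mem_BB_coe, Int.fract_eq_self.2 hx]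
  rcases lt_or_ge x (1/2) with h | h
  · rw [Int.fract_eq_self.2 ⟨by linarith, by linarith⟩]
    constructor <;> intro h1 <;> linarith
  · have : Int.fract (x + 1/2) = x - 1/2 := by
      rw [Int.fract_eq_iff]; exact ⟨by linarith, by linarith, 1, by push_cast; ring⟩
    rw [this]; constructor <;> intro h1 <;> linarith

/-- generic swap -/
def swp (S : Set Ci) (h : Ci) (y : Ci) : Ci :=
  open Classical in if y ∈ S then y + h else y - h

lemma swp_meas {S : Set Ci} (hS : MeasurableSet S) (h : Ci) : Measurable (swp S h) := by
  unfold swp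
  exact Measurable.ite hS (measurable_id.add_const h) (measurable_id.sub_const h)

lemma swp_mp {S : Set Ci} (hS : MeasurableSet S) (h : Ci) (hh : ∀ y, y + h ∈ S ↔ y ∉ S) :
    MeasurePreserving (swp S h) volume volume := by
  refine ⟨swp_meas hS h, ?_⟩
  ext E hE
  rw [Measure.map_apply (swp_meas hS h) hE]
  have e1 : swp S h ⁻¹' E ∩ S = (fun y => y + h) ⁻¹' (E \ S) := by
    ext y; simp only [Set.mem_inter_iff, Set.mem_preimage, Set.mem_sdiff, swp, hh, not_not]
    constructor
    · rintro ⟨a, b⟩; rw [if_pos b] at a; exact ⟨a, b⟩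
    · rintro ⟨a, b⟩; rw [if_pos b]; exact ⟨a, b⟩
  have e2 : swp S h ⁻¹' E \ S = (fun y => y - h) ⁻¹' (E ∩ S) := by
    ext y
    have := hh (y - h)
    rw [sub_add_cancel] at this
    simp only [Set.mem_inter_iff, Set.mem_preimage, Set.mem_sdiff, swp]
    by_cases hy : y ∈ S
    · simp only [hy, not_true, and_false, false_iff]; tauto
    · rw [if_neg hy]; tauto
  rw [← measure_inter_add_sdiff _ hS, e1, e2, measure_preimage_add_right,
    (measurePreserving_sub_right volume h).measure_preimage (hE.inter hS).nullMeasurableSet,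
    add_comm, measure_inter_add_sdiff _ hS]

def dig (m : ℕ) (y : Ci) : ℕ := ⌊2 ^ m * rep y⌋₊

lemma dig_meas (m : ℕ) : Measurable (dig m) :=
  Nat.measurable_floor.comp (measurable_rep.const_mul _)

def bitS (l : ℕ) : Set Ci := {y | 2 ^ l • y ∈ BB}

lemma bitS_meas (l : ℕ) : MeasurableSet (bitS l) := by
  have : Continuous (fun y : Ci => 2 ^ l • y) := by fun_prop
  exact this.measurable BB_meas

def sg (l : ℕ) : Ci → Ci := swp (bitS l) ((1/2^(l+1) : ℝ) : Ci)

lemma bitS_h (l : ℕ) (y : Ci) : y + ((1/2^(l+1) : ℝ) : Ci) ∈ bitS l ↔ y ∉ bitS l := by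
  unfold bitS
  simp only [Set.mem_ofPred_eq, smul_add, nsmul_coe]
  rw [← BB_half]
  have : (((2^l : ℕ) : ℝ) * (1/2^(l+1)) : ℝ) = 1/2 := by push_cast; rw [pow_succ]; field_simp
  rw [this]

lemma sg_mp (l : ℕ) : MeasurePreserving (sg l) volume volume := swp_mp (bitS_meas l) _ (bitS_h l)

lemma dig_coe {m : ℕ} {x : ℝ} {n : ℕ} (h0 : (n : ℝ) ≤ 2^m * x) (h1 : 2^m * x < n + 1)
    (hn : n < 2^m) : dig m (x : Ci) = n := by
  have hp : (0:ℝ) < 2^m := by positivity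
  have a0 : 0 ≤ x := by
    by_contra h
    have : 2^m * x < 0 := mul_neg_of_pos_of_neg hp (not_le.1 h)
    have : (0:ℝ) ≤ n := n.cast_nonneg
    linarith
  have a1 : x < 1 := by
    have : (n:ℝ) + 1 ≤ 2^m := by exact_mod_cast hn
    by_contra h
    have : 2^m * 1 ≤ 2^m * x := mul_le_mul_of_nonneg_left (not_lt.1 h) hp.le
    linarith
  rw [dig, rep_coe, Int.fract_eq_self.2 ⟨a0, a1⟩]
  exact (Nat.floor_eq_iff (by positivity)).2 ⟨h0, h1⟩

lemma dig_spec (m : ℕ) (y : Ci) : ∃ x : ℝ, (x : Ci) = y ∧ (dig m y : ℝ) ≤ 2^m * x ∧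
    2^m * x < dig m y + 1 ∧ dig m y < 2^m := by
  have hp : (0:ℝ) < 2^m := by positivity
  have h0 : 0 ≤ 2^m * rep y := mul_nonneg hp.le (rep_nonneg y)
  refine ⟨rep y, coe_rep y, Nat.floor_le h0, Nat.lt_floor_add_one _, ?_⟩
  have := Nat.floor_le h0
  have h2 : 2^m * rep y < 2^m := by nlinarith [rep_lt y]
  have h3 : (dig m y : ℝ) < 2^m := lt_of_le_of_lt this h2
  exact_mod_cast h3

lemma dig_half (l : ℕ) (y : Ci) : dig l y = dig (l+1) y / 2 := by
  obtain ⟨x, hx, h0, h1, hn⟩ := dig_spec (l+1) y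
  set n := dig (l+1) y
  rw [← hx]
  have e := Nat.div_add_mod n 2
  have h2 := Nat.mod_lt n (show 2 > 0 by norm_num)
  have e' : (2:ℝ) * (n/2 : ℕ) + (n % 2 : ℕ) = n := by exact_mod_cast e
  have h2' : ((n % 2 : ℕ) : ℝ) ≤ 1 := by exact_mod_cast (by omega)
  have h2'' : (0:ℝ) ≤ ((n % 2 : ℕ) : ℝ) := Nat.cast_nonneg _
  rw [pow_succ] at h0 h1 hn
  exact dig_coe (by linarith) (by linarith) (by omega)

lemma bit_iff (l : ℕ) (y : Ci) : y ∈ bitS l ↔ dig (l+1) y % 2 = 0 := by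
  obtain ⟨x, hx, h0, h1, hn⟩ := dig_spec (l+1) y
  set n := dig (l+1) y
  rw [← hx]
  have e := Nat.div_add_mod n 2
  have h2 := Nat.mod_lt n (show 2 > 0 by norm_num)
  have e' : (2:ℝ) * (n/2 : ℕ) + (n % 2 : ℕ) = n := by exact_mod_cast e
  rw [pow_succ] at h0 h1
  show 2 ^ l • (x : Ci) ∈ BB ↔ _
  rw [nsmul_coe, mem_BB_coe]
  push_cast
  have hf : Int.fract (2^l * x) = 2^l * x - (n/2 : ℕ) := by
    rw [Int.fract_eq_iff]
    have h2' : ((n % 2 : ℕ) : ℝ) ≤ 1 := by exact_mod_cast (by omega)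
    have h2'' : (0:ℝ) ≤ ((n % 2 : ℕ) : ℝ) := Nat.cast_nonneg _
    refine ⟨by linarith, by linarith, ((n/2 : ℕ) : ℤ), by rw [Int.cast_natCast]; ring⟩
  rw [hf]
  rcases (by omega : n % 2 = 0 ∨ n % 2 = 1) with h | h <;> rw [h] at e' ⊢ <;> push_cast at e'
  · simp; linarith
  · simp; linarith

def flp (n : ℕ) : ℕ := if n % 2 = 0 then n + 1 else n - 1

lemma dig_sg (l : ℕ) (y : Ci) : dig (l+1) (sg l y) = flp (dig (l+1) y) := by
  have hb := bit_iff l y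
  obtain ⟨x, hx, h0, h1, hn⟩ := dig_spec (l+1) y
  set n := dig (l+1) y
  have hp : (2:ℝ)^(l+1) * (1/2^(l+1)) = 1 := by field_simp
  have hev : 2^(l+1) % 2 = 0 := by rw [pow_succ]; omega
  unfold sg swp flp
  by_cases h : n % 2 = 0
  · rw [if_pos (hb.2 h), if_pos h, ← hx, ← AddCircle.coe_add]
    apply dig_coe
    · rw [mul_add, hp]; push_cast; linarith
    · rw [mul_add, hp]; push_cast; linarith
    · omega
  · rw [if_neg (fun h' => h (hb.1 h')), if_neg h, ← hx, ← AddCircle.coe_sub]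
    have h3 : 1 ≤ n := by omega
    apply dig_coe
    · rw [mul_sub, hp]; push_cast [h3]; linarith
    · rw [mul_sub, hp]; push_cast [h3]; linarith
    · omega

lemma dig_sg' (l : ℕ) (y : Ci) : dig l (sg l y) = dig l y := by
  rw [dig_half, dig_sg, dig_half l y, flp]; split_ifs <;> omega

lemma dig_div (l m : ℕ) (y : Ci) : dig l y = dig (l+m) y / 2^m := by
  induction m with
  | zero => simp
  | succ m ih => rw [ih, dig_half, Nat.div_div_eq_div_mul, pow_succ, ← add_assoc, mul_comm]

lemma dig_sg_le (l m : ℕ) (h : l ≤ m) (y : Ci) : dig l (sg m y) = dig l y := by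
  obtain ⟨k, rfl⟩ := Nat.exists_eq_add_of_le h
  rw [dig_div l k, dig_sg', ← dig_div]

def JJ (ρ t : ℕ) : Set Ci := {y | dig ρ y = t}

lemma JJ_meas (ρ t : ℕ) : MeasurableSet (JJ ρ t) := dig_meas ρ (measurableSet_singleton t)

lemma JJ_vol (ρ t : ℕ) (ht : t < 2^ρ) : volume (JJ ρ t) = ENNReal.ofReal (1/2^ρ) := by
  have hp : (0:ℝ) < 2^ρ := by positivity
  have e : JJ ρ t = rep ⁻¹' (Set.Ico (t/2^ρ : ℝ) ((t+1)/2^ρ)) := by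
    ext y
    simp only [JJ, Set.mem_ofPred_eq, dig, Set.mem_preimage, Set.mem_Ico]
    rw [Nat.floor_eq_iff (mul_nonneg hp.le (rep_nonneg y)), div_le_iff₀ hp, lt_div_iff₀ hp,
      mul_comm]
  rw [e, mp_rep.measure_preimage measurableSet_Ico.nullMeasurableSet,
    Measure.restrict_apply measurableSet_Ico, Set.inter_eq_left.2, Real.volume_Ico]
  · congr 1; ring
  · apply Set.Ico_subset_Ico
    · positivity
    · rw [div_le_one hp]; exact_mod_cast ht

/-- halves -/
lemma int_bit {f g : Ci → ℂ} (hf : Integrable f volume) (hg : Integrable g volume) :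
    (∫ v, (open Classical in if v ∈ BB then f (2 • v) else g (2 • v))) =
      (∫ v, (f v + g v)) / 2 := by
  classical
  have m2 := mp_nsmul 2 (by norm_num)
  have key : ∀ k : Ci → ℂ, Integrable k volume →
      (∫ v in BB, k (2 • v)) = (∫ v, k v) / 2 ∧ (∫ v in BBᶜ, k (2 • v)) = (∫ v, k v) / 2 := by
    intro k hk
    have hk2 : Integrable (fun v : Ci => k (2 • v)) volume := m2.integrable_comp_of_integrable hk
    have h1 : (∫ v in BB, k (2 • v)) + (∫ v in BBᶜ, k (2 • v)) = ∫ v, k v := by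
      rw [integral_add_compl BB_meas hk2]
      exact mp_int m2 hk.aestronglyMeasurable
    have h2 : (∫ v in BB, k (2 • v)) = (∫ v in BBᶜ, k (2 • v)) := by
      have tr := measurePreserving_add_right (volume : Measure Ci) ((1/2 : ℝ) : Ci)
      have e : (fun v : Ci => v + ((1/2 : ℝ) : Ci)) ⁻¹' BB = BBᶜ := by
        ext v; exact BB_half v
      have := tr.setIntegral_preimage_emb (MeasurableEquiv.addRight _).measurableEmbedding
        (fun v : Ci => k (2 • v)) BB
      rw [e] at this
      rw [← this]
      congr 1; ext v
      rw [smul_add, two_half, add_zero]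
    constructor
    · rw [← h1, ← h2]; ring
    · rw [← h1, h2]; ring
  rw [← integral_add_compl BB_meas]
  · rw [setIntegral_congr_fun (g := fun v => f (2 • v)) BB_meas,
      setIntegral_congr_fun (g := fun v => g (2 • v)) BB_meas.compl, (key f hf).1, (key g hg).2,
      integral_add hf hg]
    · ring
    · intro v hv; exact if_neg hv
    · intro v hv; exact if_pos hv
  · exact Integrable.piecewise BB_meas (m2.integrable_comp_of_integrable hf).integrableOn
      (m2.integrable_comp_of_integrable hg).integrableOn

def NN (ρ : ℕ) : ℕ → Ci → Ci → Ci
  | 0, _, y => y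
  | m+1, v, y => open Classical in
      if v ∈ BB then sg (ρ + m) (NN ρ m (2 • v) y) else NN ρ m (2 • v) y

lemma NN_meas (ρ m : ℕ) : Measurable (fun z : Ci × Ci => NN ρ m z.1 z.2) := by
  induction m with
  | zero => exact measurable_snd
  | succ m ih =>
    have h2 : Measurable (fun v : Ci × Ci => NN ρ m (2 • v.1) v.2) :=
      ih.comp (show Measurable (fun v : Ci × Ci => (2 • v.1, v.2)) by fun_prop)
    exact Measurable.ite (measurable_fst BB_meas) ((sg_mp _).measurable.comp h2) h2

lemma dig_NN (ρ m : ℕ) (v y : Ci) : dig ρ (NN ρ m v y) = dig ρ y := by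
  induction m generalizing v with
  | zero => rfl
  | succ m ih =>
    unfold NN; split_ifs
    · rw [dig_sg_le _ _ (Nat.le_add_right _ _), ih]
    · exact ih _

lemma NN_avg (ρ m t : ℕ) (ht : t < 2^ρ) (Q : Ci → ℂ) (hQ : Measurable Q) (C ω : ℝ)
    (hC : ∀ y, ‖Q y‖ ≤ C) (hω : ∀ y y', dig (ρ+m) y = dig (ρ+m) y' → ‖Q y - Q y'‖ ≤ ω)
    (y : Ci) (hy : y ∈ JJ ρ t) :
    ‖(∫ v, Q (NN ρ m v y)) - 2^ρ * ∫ y in JJ ρ t, Q y‖ ≤ ω := by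
  have bi : ∀ {k : Ci → ℂ}, Measurable k → (∀ y, ‖k y‖ ≤ C) → Integrable k volume :=
    fun hk hb => Integrable.of_bound hk.aestronglyMeasurable C (ae_of_all _ hb)
  have hJ : (volume : Measure Ci).real (JJ ρ t) = 1/2^ρ := by
    rw [Measure.real, JJ_vol _ _ ht, ENNReal.toReal_ofReal (by positivity)]
  induction m generalizing Q with
  | zero =>
    simp only [NN, integral_const, probReal_univ, one_smul]
    have e : Q y - 2^ρ * ∫ y in JJ ρ t, Q y = 2^ρ * ∫ y' in JJ ρ t, (Q y - Q y') := by
      rw [integral_sub (integrable_const _) (bi hQ hC).integrableOn]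
      simp only [integral_const, measureReal_restrict_apply_univ, hJ]
      rw [mul_sub, Complex.real_smul]; push_cast; field_simp
    rw [e, norm_mul]
    have : ‖∫ y' in JJ ρ t, (Q y - Q y')‖ ≤ ω * (volume : Measure Ci).real (JJ ρ t) := by
      apply norm_setIntegral_le_of_norm_le_const (measure_lt_top _ _)
      intro y' hy'
      exact hω _ _ (hy.trans hy'.symm)
    rw [hJ] at this
    calc _ ≤ ‖(2:ℂ)^ρ‖ * (ω * (1/2^ρ)) := by gcongr
      _ = ω := by simp; field_simp
  | succ m ih =>
    have hs := sg_mp (ρ+m)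
    have mN : Measurable (fun v => NN ρ m v y) := (NN_meas ρ m).comp (by fun_prop : Measurable fun v : Ci => (v, y))
    have hQs : Measurable (fun y => Q (sg (ρ+m) y)) := hQ.comp hs.measurable
    have h := ih (fun y => (Q y + Q (sg (ρ+m) y)) / 2) ((hQ.add hQs).div_const 2) ?_ ?_
    · have e1 : (∫ v, Q (NN ρ (m+1) v y)) = ∫ v, (Q (NN ρ m v y) + Q (sg (ρ+m) (NN ρ m v y))) / 2 := by
        have h9 := int_bit (bi (hQs.comp mN) fun _ => hC _) (bi (hQ.comp mN) fun _ => hC _)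
        rw [integral_div]
        refine Eq.trans ?_ (h9.trans ?_)
        · congr 1; ext v; simp only [NN, Function.comp]; split_ifs <;> rfl
        · congr 2; ext v; exact add_comm _ _
      have e2 : (∫ y in JJ ρ t, (Q y + Q (sg (ρ+m) y)) / 2) = ∫ y in JJ ρ t, Q y := by
        rw [integral_div, integral_add (bi hQ hC).integrableOn (bi hQs fun _ => hC _).integrableOn]
        have e : sg (ρ+m) ⁻¹' JJ ρ t = JJ ρ t := by
          ext y; simp only [JJ, Set.mem_preimage, Set.mem_ofPred_eq, dig_sg_le ρ (ρ+m) (by omega)]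
        have : (∫ y in JJ ρ t, Q (sg (ρ+m) y)) = ∫ y in JJ ρ t, Q y := by
          have h3 := (hs.restrict_preimage (JJ_meas ρ t))
          rw [e] at h3
          exact mp_int h3 hQ.aestronglyMeasurable
        rw [this]; ring
      rw [e1, ← e2]; exact h
    · intro y
      rw [norm_div, show ‖(2:ℂ)‖ = 2 by simp, div_le_iff₀ (by norm_num)]
      linarith [norm_add_le (Q y) (Q (sg (ρ+m) y)), hC y, hC (sg (ρ+m) y)]
    · intro y y' hyy
      have key : ∀ a b : ℂ, ‖a‖ ≤ ω → ‖b‖ ≤ ω → ‖(a + b)/2‖ ≤ ω := by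
        intro a b ha hb
        rw [norm_div, show ‖(2:ℂ)‖ = 2 by simp, div_le_iff₀ (by norm_num)]
        linarith [norm_add_le a b]
      have d1 := dig_sg (ρ+m) y
      have d2 := dig_sg (ρ+m) y'
      have hh : dig (ρ+m+1) y / 2 = dig (ρ+m+1) y' / 2 := by rw [← dig_half, ← dig_half, hyy]
      rw [← add_assoc] at hω
      by_cases h1 : dig (ρ+m+1) y = dig (ρ+m+1) y'
      · have := key _ _ (hω y y' h1) (hω (sg (ρ+m) y) (sg (ρ+m) y') (by rw [d1, d2, h1]))
        convert this using 2; ring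
      · have := key _ _ (hω y (sg (ρ+m) y') (by rw [d2, flp]; split_ifs <;> omega))
          (hω (sg (ρ+m) y) y' (by rw [d1, flp]; split_ifs <;> omega))
        convert this using 2; ring

end AK

namespace AK

/-- periodization -/
def pz (f : ℝ → ℝ) (hf : ContDiff ℝ (⊤ : ℕ∞) f) (d : ℝ) (hd : 0 < d)
    (h : ∀ x, 1 - d < x → x < 1 → f x = f (x - 1)) : SP where
  F := fun x => f (Int.fract x)
  sm := by
    rw [contDiff_iff_contDiffAt]
    intro x0
    set n := ⌊x0⌋ with hn
    have h1 := Int.floor_le x0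
    have h2 := Int.lt_floor_add_one x0
    have hloc : (fun x => f (Int.fract x)) =ᶠ[𝓝 x0] fun x => f (x - n) := by
      have hm : 0 < min d 1 := lt_min hd one_pos
      filter_upwards [Ioo_mem_nhds (show (n:ℝ) - min d 1 < x0 by linarith) h2] with x hx
      rcases le_or_gt (n:ℝ) x with hx1 | hx1
      · congr 1
        rw [Int.fract_eq_iff]; exact ⟨by linarith, by linarith [hx.2], n, by ring⟩
      · have : Int.fract x = x - n + 1 := by
          rw [Int.fract_eq_iff]
          exact ⟨by linarith [hx.1, min_le_right d 1], by linarith, n - 1, by push_cast; ring⟩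
        rw [this, h _ (by linarith [hx.1, min_le_left d 1]) (by linarith)]
        congr 1; ring
    refine ContDiffAt.congr_of_eventuallyEq ?_ hloc
    have : ContDiff ℝ (⊤ : ℕ∞) fun x : ℝ => f (x - n) := hf.comp (contDiff_id.sub contDiff_const)
    exact this.contDiffAt
  per := fun x => by rw [Int.fract_add_one]

namespace SP
def mul (a b : SP) : SP := ⟨fun x => a.F x * b.F x, a.sm.mul b.sm, fun x => by rw [a.per, b.per]⟩
def sc (n : ℕ) (a : SP) : SP := ⟨fun x => a.F (n * x), a.sm.comp (contDiff_const.mul contDiff_id),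
  fun x => by
    have := a.int_per (n * x) n
    rw [mul_add, mul_one]; exact_mod_cast this⟩
def scale (r : ℝ) (a : SP) : SP := ⟨fun x => r * a.F x, contDiff_const.mul a.sm, fun x => by rw [a.per]⟩
def sh (s : ℝ) (a : SP) : SP := ⟨fun x => a.F (x + s), a.sm.comp (contDiff_id.add contDiff_const),
  fun x => by rw [← a.per (x + s)]; congr 1; ring⟩

lemma mul_c (a b : SP) (y : Ci) : (mul a b).c y = a.c y * b.c y := by
  rw [← coe_rep y, c_coe, c_coe, c_coe]; rfl
lemma sc_c (n : ℕ) (a : SP) (y : Ci) : (sc n a).c y = a.c (n • y) := by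
  rw [← coe_rep y, c_coe, nsmul_coe, c_coe]; rfl
lemma scale_c (r : ℝ) (a : SP) (y : Ci) : (scale r a).c y = r * a.c y := by
  rw [← coe_rep y, c_coe, c_coe]; rfl
lemma sh_c (s : ℝ) (a : SP) (y : Ci) : (sh s a).c y = a.c (y + (s : Ci)) := by
  rw [← coe_rep y, c_coe, ← AddCircle.coe_add, c_coe]; rfl
end SP

def ind (S : Set Ci) (y : Ci) : ℝ := open Classical in if y ∈ S then 1 else 0

/-- closeness of smooth functions to step functions -/
def AS (a0 : Ci → ℝ) : Prop := ∀ ε : ℝ≥0∞, 0 < ε → ∃ a : SP, (∀ x, 0 ≤ a.F x ∧ a.F x ≤ 1) ∧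
  ∃ S, MeasurableSet S ∧ volume S ≤ ε ∧ ∀ y ∉ S, a.c y = a0 y

lemma AS.mul {a b : Ci → ℝ} (ha : AS a) (hb : AS b) : AS (fun y => a y * b y) := by
  intro ε hε
  obtain ⟨a1, r1, S1, m1, v1, e1⟩ := ha (ε/2) (ENNReal.half_pos hε.ne')
  obtain ⟨a2, r2, S2, m2, v2, e2⟩ := hb (ε/2) (ENNReal.half_pos hε.ne')
  refine ⟨a1.mul a2, fun x => ⟨mul_nonneg (r1 x).1 (r2 x).1, mul_le_one₀ (r1 x).2 (r2 x).1 (r2 x).2⟩,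
    S1 ∪ S2, m1.union m2, ?_, ?_⟩
  · calc _ ≤ volume S1 + volume S2 := measure_union_le _ _
      _ ≤ ε/2 + ε/2 := by gcongr
      _ = ε := ENNReal.add_halves ε
  · intro y hy
    rw [SP.mul_c, e1 y (fun h => hy (Or.inl h)), e2 y (fun h => hy (Or.inr h))]

lemma AS.sc {a : Ci → ℝ} (ha : AS a) (n : ℕ) (hn : 1 ≤ n) : AS (fun y => a (n • y)) := by
  intro ε hε
  obtain ⟨a1, r1, S1, m1, v1, e1⟩ := ha ε hε
  have mp := mp_nsmul n hn
  refine ⟨a1.sc n, fun x => r1 _, (fun y => n • y) ⁻¹' S1, mp.measurable m1, ?_, ?_⟩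
  · rw [mp.measure_preimage m1.nullMeasurableSet]; exact v1
  · intro y hy
    rw [SP.sc_c, e1 _ hy]

lemma AS.sh {a : Ci → ℝ} (ha : AS a) (s : ℝ) : AS (fun y => a (y + (s : Ci))) := by
  intro ε hε
  obtain ⟨a1, r1, S1, m1, v1, e1⟩ := ha ε hε
  have mp := measurePreserving_add_right (volume : Measure Ci) (s : Ci)
  refine ⟨a1.sh s, fun x => r1 _, (fun y => y + (s : Ci)) ⁻¹' S1, mp.measurable m1, ?_, ?_⟩
  · rw [mp.measure_preimage m1.nullMeasurableSet]; exact v1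
  · intro y hy
    rw [SP.sh_c, e1 _ hy]

lemma chi_exists (ε : ℝ≥0∞) (hε : 0 < ε) : ∃ a : SP, (∀ x, 0 ≤ a.F x ∧ a.F x ≤ 1) ∧
    (∀ x, -(1/2) ≤ x → x ≤ 0 → a.F x = 0) ∧
  ∃ S, MeasurableSet S ∧ volume S ≤ ε ∧ ∀ y ∉ S, a.c y = ind BB y := by
  obtain ⟨δ, hδ0, hδ⟩ : ∃ δ : ℝ, (0 < δ ∧ δ < 1/4) ∧ ENNReal.ofReal (2*δ) ≤ ε := by
    by_cases hT : ε = ⊤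
    · exact ⟨1/8, by norm_num, by simp [hT]⟩
    · have hp := ENNReal.toReal_pos hε.ne' hT
      refine ⟨min (1/8) (ε.toReal/2), ⟨lt_min (by norm_num) (by linarith), ?_⟩, ?_⟩
      · exact (min_le_left _ _).trans_lt (by norm_num)
      · rw [← ENNReal.ofReal_toReal hT]
        apply ENNReal.ofReal_le_ofReal
        rw [ENNReal.ofReal_toReal hT]
        linarith [min_le_right (1/8) (ε.toReal/2)]
  let f : ContDiffBump (1/4 : ℝ) := ⟨1/4 - δ, 1/4 - δ/2, by linarith [hδ0.2], by linarith [hδ0.1]⟩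
  have f0 : ∀ x, x ≤ δ/2 ∨ 1/2 - δ/2 ≤ x → f x = 0 := by
    intro x hx
    apply f.zero_of_le_dist
    show 1/4 - δ/2 ≤ _
    rw [Real.dist_eq]
    rcases hx with h | h
    · rw [abs_sub_comm]; exact le_trans (by linarith) (le_abs_self _)
    · exact le_trans (by linarith) (le_abs_self _)
  have f1 : ∀ x, δ ≤ x → x ≤ 1/2 - δ → f x = 1 := by
    intro x h1 h2
    apply f.one_of_mem_closedBall
    rw [Metric.mem_closedBall, Real.dist_eq, abs_le]
    show -(1/4 - δ) ≤ _ ∧ _ ≤ 1/4 - δ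
    constructor <;> linarith
  have hF : ∀ x, -(1/2) ≤ x → x ≤ 0 → f (Int.fract x) = 0 := by
    intro x h1 h2
    rcases eq_or_lt_of_le h2 with h | h
    · rw [h, Int.fract_zero]; exact f0 _ (Or.inl (by linarith [hδ0.1]))
    · have : Int.fract x = x + 1 := by
        rw [Int.fract_eq_iff]; exact ⟨by linarith, by linarith, -1, by push_cast; ring⟩
      rw [this]; exact f0 _ (Or.inr (by linarith [hδ0.1]))
  refine ⟨pz f f.contDiff (1/4) (by norm_num) ?_, fun x => ⟨f.nonneg, f.le_one⟩, hF,
    rep ⁻¹' (Set.Ico 0 δ ∪ Set.Ioo (1/2 - δ) (1/2)),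
      measurable_rep (measurableSet_Ico.union measurableSet_Ioo), ?_, ?_⟩
  · intro x h1 h2
    rw [f0 x (Or.inr (by linarith [hδ0.1])), f0 _ (Or.inl (by linarith [hδ0.1]))]
  · rw [mp_rep.measure_preimage (measurableSet_Ico.union measurableSet_Ioo).nullMeasurableSet]
    refine (Measure.restrict_apply_le _ _).trans ((measure_union_le _ _).trans (le_trans ?_ hδ))
    rw [Real.volume_Ico, Real.volume_Ioo, ← ENNReal.ofReal_add (by linarith [hδ0.1]) (by linarith [hδ0.1])]
    apply ENNReal.ofReal_le_ofReal; linarith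
  · intro y hy
    rw [SP.c_eq]
    show f (Int.fract (rep y)) = _
    rw [Int.fract_eq_self.2 ⟨rep_nonneg y, rep_lt y⟩, ind, BB]
    simp only [Set.mem_preimage, Set.mem_union, Set.mem_Ico, Set.mem_Ioo, not_or, not_and, not_lt] at hy
    have hy1 := hy.1 (rep_nonneg y)
    simp only [Set.mem_ofPred_eq]
    split_ifs with h
    · refine f1 _ hy1 ?_
      by_contra h'
      exact absurd (hy.2 (not_le.1 h')) (not_le.2 h)
    · exact f0 _ (Or.inr (by linarith [hδ0.1]))

lemma AS_B : AS (ind BB) := fun ε hε => by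
  obtain ⟨a, h1, _, h3⟩ := chi_exists ε hε; exact ⟨a, h1, h3⟩

def Fix0 (H : PD) : Prop := ∀ x, H.f (x, 0) = (x, 0)

lemma Fix0.mul {H K : PD} (h : Fix0 H) (k : Fix0 K) : Fix0 (H * K) := fun x => by
  rw [PD.mul_f]; simp only [Function.comp]; rw [k, h]

def DD (ε : ℝ≥0∞) (H : PD) (g : Torus2 → Torus2) : Prop :=
  ∃ S, MeasurableSet S ∧ volume S ≤ ε ∧ ∀ z ∉ S, H.t z = g z

lemma DD.mul {ε1 ε2 : ℝ≥0∞} {H1 H2 : PD} {g1 g2 : Torus2 → Torus2} (h1 : DD ε1 H1 g1)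
    (h2 : DD ε2 H2 g2) : DD (ε1 + ε2) (H1 * H2) (g1 ∘ g2) := by
  obtain ⟨S1, m1, v1, e1⟩ := h1
  obtain ⟨S2, m2, v2, e2⟩ := h2
  refine ⟨H2.t ⁻¹' S1 ∪ S2, (H2.t_mp.measurable m1).union m2, ?_, ?_⟩
  · refine (measure_union_le _ _).trans ?_
    rw [H2.t_mp.measure_preimage m1.nullMeasurableSet]; gcongr
  · intro z hz
    rw [PD.mul_t_apply, e1 _ (fun h => hz (Or.inl h)), Function.comp, e2 _ (fun h => hz (Or.inr h))]

def stY (b : Ci → ℝ) (z : Torus2) : Torus2 := (z.1, z.2 + ((b z.1 : ℝ) : Ci))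
def stYi (b : Ci → ℝ) (z : Torus2) : Torus2 := (z.1, z.2 - ((b z.1 : ℝ) : Ci))
def stX (b : Ci → ℝ) (z : Torus2) : Torus2 := (z.1 + ((b z.2 : ℝ) : Ci), z.2)

lemma shYi_t (b : SP) (z : Torus2) : ((shY b)⁻¹).t z = (z.1, z.2 - ((b.c z.1 : ℝ) : Ci)) := by
  simp [PD.t, PD.inv_f, shY, tor, torusProj, repp, coe_rep, b.c_eq]

lemma vol_fst (S : Set Ci) : volume (Prod.fst ⁻¹' S : Set Torus2) = volume S := by
  rw [← Set.prod_univ, Measure.volume_eq_prod, Measure.prod_prod, measure_univ, mul_one]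
lemma vol_snd (S : Set Ci) : volume (Prod.snd ⁻¹' S : Set Torus2) = volume S := by
  rw [← Set.univ_prod, Measure.volume_eq_prod, Measure.prod_prod, measure_univ, one_mul]

lemma DD_conj {ε : ℝ≥0∞} {a b : SP} {a0 b0 : Ci → ℝ}
    (ha : ∃ S, MeasurableSet S ∧ volume S ≤ ε ∧ ∀ y ∉ S, a.c y = a0 y)
    (hb : ∃ S, MeasurableSet S ∧ volume S ≤ ε ∧ ∀ y ∉ S, b.c y = b0 y) :
    DD (ε + ε + ε) (shY b * shX a * (shY b)⁻¹) (stY b0 ∘ stX a0 ∘ stYi b0) := by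
  obtain ⟨S1, m1, v1, e1⟩ := ha
  obtain ⟨S2, m2, v2, e2⟩ := hb
  refine DD.mul (g1 := stY b0 ∘ stX a0) (DD.mul ?_ ?_) ?_
  · exact ⟨Prod.fst ⁻¹' S2, measurable_fst m2, by rwa [vol_fst], fun z hz => by rw [shY_t, stY, e2 _ hz]⟩
  · exact ⟨Prod.snd ⁻¹' S1, measurable_snd m1, by rwa [vol_snd], fun z hz => by rw [shX_t, stX, e1 _ hz]⟩
  · exact ⟨Prod.fst ⁻¹' S2, measurable_fst m2, by rwa [vol_fst], fun z hz => by rw [shYi_t, stYi, e2 _ hz]⟩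

def Ap (g : Torus2 → Torus2) : Prop := ∀ ε : ℝ≥0∞, 0 < ε → ∃ H : PD, Fix0 H ∧ DD ε H g

lemma Ap.comp {g1 g2 : Torus2 → Torus2} (h1 : Ap g1) (h2 : Ap g2) : Ap (g1 ∘ g2) := by
  intro ε hε
  obtain ⟨H1, f1, d1⟩ := h1 (ε/2) (ENNReal.half_pos hε.ne')
  obtain ⟨H2, f2, d2⟩ := h2 (ε/2) (ENNReal.half_pos hε.ne')
  refine ⟨H1 * H2, f1.mul f2, ?_⟩
  rw [← ENNReal.add_halves ε]; exact d1.mul d2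

lemma Ap_conj (l : ℕ) {b0 : Ci → ℝ} (hb : AS b0) :
    Ap (stY (fun x => 1/2^(l+1) * b0 x) ∘ stX (fun y => 1/2 * ind (bitS l) y) ∘
      stYi (fun x => 1/2^(l+1) * b0 x)) := by
  intro ε hε
  have hε3 : 0 < ε/3 := ENNReal.div_pos hε.ne' (by simp)
  obtain ⟨b, r1, S1, m1, v1, e1⟩ := hb (ε/3) hε3
  obtain ⟨χ, r2, z2, S2, m2, v2, e2⟩ := chi_exists (ε/3) hε3
  have mp := mp_nsmul (2^l) (Nat.one_le_two_pow)
  have key := DD_conj (ε := ε/3) (a := (χ.sc (2^l)).scale (1/2)) (b := b.scale (1/2^(l+1)))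
    (a0 := fun y => 1/2 * ind (bitS l) y) (b0 := fun x => 1/2^(l+1) * b0 x) ?_ ?_
  · rw [ENNReal.add_thirds] at key
    refine ⟨_, ?_, key⟩
    intro x
    have hx := r1 x
    have hp : (0:ℝ) < 2^(l+1) := by positivity
    have hz : χ.F ((2^l : ℕ) * (0 - 1/2^(l+1) * b.F x)) = 0 := by
      have e : ((2^l : ℕ) : ℝ) * (0 - 1/2^(l+1) * b.F x) = - (b.F x / 2) := by
        push_cast; rw [pow_succ]; field_simp; ring
      rw [e]; exact z2 _ (by linarith) (by linarith)
    simp only [PD.mul_f, PD.inv_f, Function.comp, shY, shX, SP.scale, SP.sc, hz]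
    simp
  · refine ⟨(fun y => 2^l • y) ⁻¹' S2, mp.measurable m2, ?_, ?_⟩
    · rw [mp.measure_preimage m2.nullMeasurableSet]; exact v2
    · intro y hy
      rw [SP.scale_c, SP.sc_c, e2 _ hy]; rfl
  · refine ⟨S1, m1, v1, fun y hy => ?_⟩
    rw [SP.scale_c, e1 _ hy]

/-- step swap -/
def Sw (l i : ℕ) (z : Torus2) : Torus2 :=
  open Classical in if 2 • z.1 ∈ BB ∧ 2^(i+2) • z.1 ∈ BB then (z.1 + ((1/2 : ℝ) : Ci), sg l z.2) else z

lemma pow_half (i : ℕ) (z : Ci) : 2^(i+1) • (z + ((1/2 : ℝ) : Ci)) = 2^(i+1) • z := by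
  rw [smul_add, pow_succ, mul_smul _ _ ((1/2 : ℝ) : Ci), two_half, smul_zero, add_zero]

lemma two_smul_half (z : Ci) : 2 • (z + ((1/2 : ℝ) : Ci)) = 2 • z := by
  have := pow_half 0 z; simpa using this

lemma ind_pos {S : Set Ci} {y : Ci} (h : y ∈ S) : ind S y = 1 := if_pos h
lemma ind_neg {S : Set Ci} {y : Ci} (h : y ∉ S) : ind S y = 0 := if_neg h

def cj (l : ℕ) (b : Ci → ℝ) : Torus2 → Torus2 := stY (fun x => 1/2^(l+1) * b x) ∘
  stX (fun y => 1/2 * ind (bitS l) y) ∘ stYi (fun x => 1/2^(l+1) * b x)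

lemma cj1 (l : ℕ) (b : Ci → ℝ) (x y : Ci) (hb : b x = 0) (hy : y ∉ bitS l) : cj l b (x, y) = (x, y) := by
  simp [cj, stY, stX, stYi, hb, ind_neg hy]
lemma cj2 (l : ℕ) (b : Ci → ℝ) (x y : Ci) (hb : b x = 0) (hy : y ∈ bitS l) :
    cj l b (x, y) = (x + ((1/2 : ℝ) : Ci), y + ((1/2^(l+1) * b (x + ((1/2 : ℝ) : Ci)) : ℝ) : Ci)) := by
  simp only [cj, stY, stX, stYi, Function.comp, hb, mul_zero, AddCircle.coe_zero, sub_zero, ind_pos hy, mul_one]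
lemma cj3 (l : ℕ) (b : Ci → ℝ) (x y : Ci) (hb : b x = 1) (hy : y ∈ bitS l) : cj l b (x, y) = (x, y) := by
  have hy2 := bitS_h l (y - ((1/2^(l+1) : ℝ) : Ci))
  rw [sub_add_cancel] at hy2
  simp only [cj, stY, stX, stYi, Function.comp, hb, mul_one, ind_neg (hy2.1 hy), mul_zero, AddCircle.coe_zero, add_zero, sub_add_cancel]
lemma cj4 (l : ℕ) (b : Ci → ℝ) (x y : Ci) (hb : b x = 1) (hy : y ∉ bitS l) :
    cj l b (x, y) = (x + ((1/2 : ℝ) : Ci), y - ((1/2^(l+1) : ℝ) : Ci) +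
      ((1/2^(l+1) * b (x + ((1/2 : ℝ) : Ci)) : ℝ) : Ci)) := by
  have hy2 := bitS_h l (y - ((1/2^(l+1) : ℝ) : Ci))
  rw [sub_add_cancel] at hy2
  have : y - ((1/2^(l+1) : ℝ) : Ci) ∈ bitS l := by by_contra h; exact hy (hy2.2 h)
  simp only [cj, stY, stX, stYi, Function.comp, hb, mul_one, ind_pos this]

lemma Ap_Sw (l i : ℕ) : Ap (Sw l i) := by
  set cc : Ci → ℝ := fun x => ind BB (2 • x) * ind BB (2^(i+2) • x) with hcc
  have hc : AS cc := AS.mul (AS_B.sc 2 (by norm_num)) (AS_B.sc (2^(i+2)) Nat.one_le_two_pow)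
  have hb : AS (fun x => ind BB x * cc x) := AS_B.mul hc
  have hb' := hb.sh (1/2)
  have := (Ap_conj l hb).comp (Ap_conj l hb')
  convert this using 1
  set b : Ci → ℝ := fun x => ind BB x * cc x with hbb
  set b' : Ci → ℝ := fun y => b (y + ((1/2 : ℝ) : Ci)) with hbb'
  show Sw l i = cj l b ∘ cj l b'
  ext1 ⟨x, y⟩
  set h : Ci := ((1/2^(l+1) : ℝ) : Ci) with hh
  have hcx : cc (x + ((1/2 : ℝ) : Ci)) = cc x := by
    simp only [hcc, two_smul_half, pow_half (i+1)]
  have hdd : x + ((1/2 : ℝ) : Ci) + ((1/2 : ℝ) : Ci) = x := by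
    rw [add_assoc, ← two_nsmul, two_half, add_zero]
  have hxB := BB_half x
  have hy1 := bitS_h l y
  have hy2 := bitS_h l (y - h)
  rw [sub_add_cancel] at hy2
  rw [← hh] at hy1
  have hsg : sg l y = open Classical in if y ∈ bitS l then y + h else y - h := rfl
  have hbx : b' x = b (x + ((1/2 : ℝ) : Ci)) := rfl
  have hbxs : b' (x + ((1/2 : ℝ) : Ci)) = b x := by
    show b _ = b x
    rw [hdd]
  by_cases hC : 2 • x ∈ BB ∧ 2^(i+2) • x ∈ BB
  · have c1 : cc x = 1 := by simp [hcc, ind_pos hC.1, ind_pos hC.2]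
    rw [Sw, if_pos hC, hsg, Function.comp]
    by_cases a1 : x ∈ BB
    · have b1 : b x = 1 := by simp [hbb, ind_pos a1, c1]
      have b2 : b (x + ((1/2 : ℝ) : Ci)) = 0 := by
        simp only [hbb]; rw [ind_neg (fun h => hxB.1 h a1), zero_mul]
      by_cases a2 : y ∈ bitS l
      · rw [cj2 l b' x y (hbx.trans b2) a2, hbxs, b1, mul_one, ← hh, cj1 _ _ _ _ b2 (fun h => hy1.1 h a2), if_pos a2]
      · rw [cj1 l b' x y (hbx.trans b2) a2, cj4 _ _ _ _ b1 a2, b2, mul_zero, AddCircle.coe_zero, add_zero, if_neg a2]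
    · have b1 : b x = 0 := by simp [hbb, ind_neg a1]
      have b2 : b (x + ((1/2 : ℝ) : Ci)) = 1 := by
        simp only [hbb]; rw [ind_pos (hxB.2 a1), hcx, c1, one_mul]
      by_cases a2 : y ∈ bitS l
      · rw [cj3 l b' x y (hbx.trans b2) a2, cj2 _ _ _ _ b1 a2, b2, mul_one, if_pos a2]
      · rw [cj4 l b' x y (hbx.trans b2) a2, hbxs, b1, mul_zero, AddCircle.coe_zero, add_zero, ← hh,
          cj3 _ _ _ _ b2 (by by_contra h; exact a2 (hy2.2 h)), if_neg a2]
  · have c1 : cc x = 0 := by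
      simp only [hcc]
      rw [not_and_or] at hC
      rcases hC with h | h <;> simp [ind_neg h]
    have b1 : b x = 0 := by simp [hbb, c1]
    have b2 : b (x + ((1/2 : ℝ) : Ci)) = 0 := by
      simp only [hbb]; rw [hcx, c1, mul_zero]
    rw [Sw, if_neg hC, Function.comp]
    by_cases a2 : y ∈ bitS l
    · rw [cj2 l b' x y (hbx.trans b2) a2, hbxs, b1, mul_zero, AddCircle.coe_zero, add_zero,
        cj2 _ _ _ _ b2 a2, hdd, b1, mul_zero, AddCircle.coe_zero, add_zero]
    · rw [cj1 l b' x y (hbx.trans b2) a2, cj1 _ _ _ _ b1 a2]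

end AK

namespace AK

def Phi (ρ : ℕ) : ℕ → ℕ → Torus2 → Torus2
  | 0, _ => id
  | m+1, i => Sw (ρ+m) i ∘ Phi ρ m (i+1)

lemma Ap_id : Ap id := fun ε _ => ⟨1, fun _ => rfl, ∅, MeasurableSet.empty, by simp, fun z _ => by
  rw [PD.one_t]⟩

lemma Ap_Phi (ρ m i : ℕ) : Ap (Phi ρ m i) := by
  induction m generalizing i with
  | zero => exact Ap_id
  | succ m ih => exact (Ap_Sw _ _).comp (ih _)

lemma Phi_eq (ρ m i : ℕ) (z : Torus2) : 2 • (Phi ρ m i z).1 = 2 • z.1 ∧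
    (Phi ρ m i z).2 = open Classical in if 2 • z.1 ∈ BB then NN ρ m (2^(i+2) • z.1) z.2 else z.2 := by
  induction m generalizing i with
  | zero => simp [Phi, NN]
  | succ m ih =>
    obtain ⟨h1, h2⟩ := ih (i+1)
    set w := Phi ρ m (i+1) z with hw
    have e : Phi ρ (m+1) i z = Sw (ρ+m) i w := rfl
    have h3 : 2^(i+2) • w.1 = 2^(i+2) • z.1 := by
      rw [pow_succ, mul_smul, h1, ← mul_smul]
    rw [e, Sw, h1, h3]
    by_cases hB : 2 • z.1 ∈ BB
    · rw [if_pos hB] at h2 ⊢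
      have h4 : 2^(i+1+2) • z.1 = 2 • (2^(i+2) • z.1) := by
        rw [← mul_smul]; congr 1; ring
      rw [h4] at h2
      by_cases hC : 2^(i+2) • z.1 ∈ BB
      · rw [if_pos ⟨hB, hC⟩, NN, if_pos hC, h2]
        exact ⟨by rw [← h1]; exact two_smul_half _, rfl⟩
      · rw [if_neg (fun h => hC h.2), NN, if_neg hC]
        exact ⟨h1, h2⟩
    · rw [if_neg hB] at h2 ⊢
      rw [if_neg (fun h => hB h.1)]
      exact ⟨h1, h2⟩

lemma dig_Phi (ρ m i : ℕ) (z : Torus2) : dig ρ (Phi ρ m i z).2 = dig ρ z.2 := by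
  rw [(Phi_eq ρ m i z).2]; split_ifs
  · exact dig_NN _ _ _ _
  · rfl

/-- strip -/
def St (ρ t : ℕ) : Set Torus2 := Prod.snd ⁻¹' JJ ρ t

lemma St_meas (ρ t : ℕ) : MeasurableSet (St ρ t) := measurable_snd (JJ_meas ρ t)

def qq : Torus2 := (((1/4 : ℝ) : Ci), 0)

lemma quarter2 (x : Ci) : 2 • (x + ((1/4 : ℝ) : Ci)) = 2 • x + ((1/2 : ℝ) : Ci) := by
  rw [smul_add, nsmul_coe]; congr 2; norm_num
lemma quarter4 (x : Ci) : 2^(0+2) • (x + ((1/4 : ℝ) : Ci)) = 2 • (2 • x) := by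
  rw [← mul_smul, smul_add, nsmul_coe]; norm_num

lemma Phi_corr (ρ m t : ℕ) (ht : t < 2^ρ) (P Q : Ci → ℂ) (hP : Measurable P) (hQ : Measurable Q)
    (C ω : ℝ) (hCP : ∀ y, ‖P y‖ ≤ C) (hCQ : ∀ y, ‖Q y‖ ≤ C)
    (hωP : ∀ y y', dig (ρ+m) y = dig (ρ+m) y' → ‖P y - P y'‖ ≤ ω)
    (hωQ : ∀ y y', dig (ρ+m) y = dig (ρ+m) y' → ‖Q y - Q y'‖ ≤ ω) :
    ‖(∫ z in St ρ t, P (Phi ρ m 0 (z + qq)).2 * Q (Phi ρ m 0 z).2) -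
      2^ρ * (∫ y in JJ ρ t, P y) * ∫ y in JJ ρ t, Q y‖ ≤ C * ω := by
  classical
  have hC0 : 0 ≤ C := (norm_nonneg _).trans (hCP 0)
  have mN := NN_meas ρ m
  set IP := ∫ y in JJ ρ t, P y
  set IQ := ∫ y in JJ ρ t, Q y
  let g : Torus2 → ℂ := fun z => if 2 • z.1 ∈ BB then P z.2 * Q (NN ρ m (2 • (2 • z.1)) z.2)
    else P (NN ρ m (2 • (2 • z.1)) z.2) * Q z.2
  have eg : ∀ z : Torus2, P (Phi ρ m 0 (z + qq)).2 * Q (Phi ρ m 0 z).2 = g z := by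
    intro z
    have h4 : 2^(0+2) • z.1 = 2 • (2 • z.1) := by rw [← mul_smul]; norm_num
    have h1 : (z + qq).1 = z.1 + ((1/4 : ℝ) : Ci) := rfl
    have h2 : (z + qq).2 = z.2 := add_zero _
    rw [(Phi_eq ρ m 0 _).2, (Phi_eq ρ m 0 _).2, h1, h2, quarter2, quarter4, h4]
    simp only [BB_half, g]
    by_cases hB : 2 • z.1 ∈ BB <;> simp [hB]
  have mg : Measurable g := by
    have m2 : Measurable (fun z : Torus2 => NN ρ m (2 • (2 • z.1)) z.2) :=
      mN.comp (show Measurable (fun z : Torus2 => (2 • (2 • z.1), z.2)) by fun_prop)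
    have m3 : Measurable (fun z : Torus2 => 2 • z.1) := by fun_prop
    exact Measurable.ite (m3 BB_meas) ((hP.comp measurable_snd).mul (hQ.comp m2))
      ((hP.comp m2).mul (hQ.comp measurable_snd))
  have gb : ∀ z, ‖g z‖ ≤ C * C := by
    intro z
    simp only [g]; split_ifs <;> rw [norm_mul] <;> gcongr <;> first | exact hCP _ | exact hCQ _
  have gi : Integrable g volume := Integrable.of_bound mg.aestronglyMeasurable _ (ae_of_all _ gb)
  have bi : ∀ {k : Ci → ℂ} {C : ℝ}, Measurable k → (∀ y, ‖k y‖ ≤ C) → Integrable k volume :=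
    fun hk hb => Integrable.of_bound hk.aestronglyMeasurable _ (ae_of_all _ hb)
  -- inner integral
  have inner : ∀ y ∈ JJ ρ t, ‖(∫ x, g (x, y)) - 2^ρ * (P y * IQ + IP * Q y) / 2‖ ≤ C * ω := by
    intro y hy
    have hN : Measurable (fun v => NN ρ m v y) := mN.comp (by fun_prop : Measurable fun v : Ci => (v, y))
    have i1 : Integrable (fun v => P y * Q (NN ρ m v y)) volume := (bi (hQ.comp hN) fun _ => hCQ _).const_mul _
    have i2 : Integrable (fun v => P (NN ρ m v y) * Q y) volume := (bi (hP.comp hN) fun _ => hCP _).mul_const _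
    have e1 : (∫ x, g (x, y)) = (∫ v, (P y * Q (NN ρ m v y) + P (NN ρ m v y) * Q y)) / 2 := by
      rw [← int_bit i1 i2]
      refine mp_int (F := fun v : Ci => if v ∈ BB then P y * Q (NN ρ m (2 • v) y) else P (NN ρ m (2 • v) y) * Q y)
        (mp_nsmul 2 (by norm_num)) ?_
      have hN2 : Measurable (fun v => NN ρ m (2 • v) y) := hN.comp (by fun_prop : Measurable fun v : Ci => 2 • v)
      exact (Measurable.ite BB_meas ((hQ.comp hN2).const_mul _) ((hP.comp hN2).mul_const _)).aestronglyMeasurable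
    rw [e1, integral_add i1 i2, integral_const_mul, integral_mul_const]
    have a1 := NN_avg ρ m t ht P hP C ω hCP hωP y hy
    have a2 := NN_avg ρ m t ht Q hQ C ω hCQ hωQ y hy
    set NP := ∫ v, P (NN ρ m v y)
    set NQ := ∫ v, Q (NN ρ m v y)
    have : (P y * NQ + NP * Q y) / 2 - 2^ρ * (P y * IQ + IP * Q y) / 2 =
      (P y * (NQ - 2^ρ * IQ) + (NP - 2^ρ * IP) * Q y) / 2 := by ring
    rw [this, norm_div, show ‖(2:ℂ)‖ = 2 by simp, div_le_iff₀ (by norm_num)]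
    have hω0 := (norm_nonneg _).trans a1
    calc _ ≤ ‖P y‖ * ‖NQ - 2^ρ * IQ‖ + ‖NP - 2^ρ * IP‖ * ‖Q y‖ := by
          refine (norm_add_le _ _).trans ?_; rw [norm_mul, norm_mul]
      _ ≤ C * ω + ω * C := by
          gcongr
          · exact hCP y
          · exact hCQ y
      _ = _ := by ring
  have hJ : (volume : Measure Ci).real (JJ ρ t) = 1/2^ρ := by
    rw [Measure.real, JJ_vol _ _ ht, ENNReal.toReal_ofReal (by positivity)]
  have eI : (∫ z in St ρ t, g z) = ∫ y in JJ ρ t, ∫ x, g (x, y) := by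
    have : St ρ t = Set.univ ×ˢ JJ ρ t := by rw [Set.univ_prod]; rfl
    rw [this, Measure.volume_eq_prod, ← Measure.prod_restrict, Measure.restrict_univ, integral_prod_symm]
    have h5 := gi.integrableOn (s := St ρ t)
    rw [IntegrableOn, this, Measure.volume_eq_prod, ← Measure.prod_restrict, Measure.restrict_univ] at h5
    exact h5
  have iP := (bi hP hCP).integrableOn (s := JJ ρ t)
  have iQ := (bi hQ hCQ).integrableOn (s := JJ ρ t)
  have e2 : 2^ρ * IP * IQ = ∫ y in JJ ρ t, 2^ρ * (P y * IQ + IP * Q y) / 2 := by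
    rw [integral_div, integral_const_mul, integral_add (iP.mul_const _) (iQ.const_mul _),
      integral_mul_const, integral_const_mul]
    show _ = 2^ρ * (IP * IQ + IP * IQ) / 2
    ring
  simp only [eg]
  have i3 : IntegrableOn (fun y => ∫ x, g (x, y)) (JJ ρ t) volume :=
    (Integrable.integral_prod_right (by rwa [← Measure.volume_eq_prod])).integrableOn
  rw [eI, e2, ← integral_sub i3]
  · have h6 := norm_setIntegral_le_of_norm_le_const (μ := volume) (s := JJ ρ t) (measure_lt_top _ _) inner
    rw [hJ] at h6
    have h7 : 0 ≤ C * ω := by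
      have : (0:ℝ) ≤ ω := (norm_nonneg _).trans (hωP 0 0 rfl)
      positivity
    refine h6.trans (mul_le_of_le_one_right h7 ?_)
    rw [div_le_one (by positivity)]; exact one_le_pow₀ (by norm_num)
  · exact (((iP.mul_const _).add (iQ.const_mul _)).const_mul _).div_const _

lemma nco (x : ℝ) : ‖(x : Ci)‖ ≤ |x| := by
  rw [UnitAddCircle.norm_eq]
  simpa using round_le x 0

lemma osc_lim {P : Ci → ℂ} (hP : Continuous P) (ε : ℝ) (hε : 0 < ε) (ρ : ℕ) :
    ∀ᶠ m in atTop, ∀ y y', dig (ρ+m) y = dig (ρ+m) y' → ‖P y - P y'‖ ≤ ε := by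
  have hu := CompactSpace.uniformContinuous_of_continuous hP
  obtain ⟨δ, hδ, h⟩ := Metric.uniformContinuous_iff.1 hu ε hε
  have hl : Tendsto (fun m : ℕ => (1/2 : ℝ)^m) atTop (𝓝 0) :=
    tendsto_pow_atTop_nhds_zero_of_lt_one (by norm_num) (by norm_num)
  filter_upwards [hl.eventually_lt_const hδ] with m hm y y' hyy
  rw [← dist_eq_norm]
  refine (h ?_).le
  obtain ⟨x, hx, h0, h1, -⟩ := dig_spec (ρ+m) y
  obtain ⟨x', hx', h0', h1', -⟩ := dig_spec (ρ+m) y'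
  rw [hyy] at h0 h1
  have h3 : |2^(ρ+m) * (x - x')| < 1 := by rw [abs_lt, mul_sub]; constructor <;> linarith
  rw [abs_mul, abs_of_pos (by positivity)] at h3
  have h4 : (2:ℝ)^m * |x - x'| < 1 := by
    refine lt_of_le_of_lt ?_ h3
    gcongr
    · norm_num
    · omega
  have h5 : |x - x'| < (1/2)^m := by
    rw [one_div, inv_pow, ← one_div, lt_div_iff₀ (by positivity)]; linarith
  rw [← hx, ← hx', dist_eq_norm, ← AddCircle.coe_sub]
  calc ‖((x - x' : ℝ) : Ci)‖ ≤ ‖x - x'‖ := nco _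
    _ < δ := h5.trans hm

lemma phi_exists (ρ : ℕ) : ∃ φ : ℕ → PD, (∀ j, Fix0 (φ j)) ∧
    Tendsto (fun j => volume {z : Torus2 | dig ρ ((φ j).t z).2 ≠ dig ρ z.2}) atTop (𝓝 0) ∧
    ∀ t < 2^ρ, ∀ P Q : Ci → ℂ, Continuous P → Continuous Q →
      Tendsto (fun j => ∫ z in St ρ t, P ((φ j).t (z + qq)).2 * Q ((φ j).t z).2) atTop
        (𝓝 (2^ρ * (∫ y in JJ ρ t, P y) * ∫ y in JJ ρ t, Q y)) := by
  have h := fun j : ℕ => Ap_Phi ρ j 0 ((j:ℝ≥0∞)+1)⁻¹ (by simp)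
  choose φ hφ hD using h
  choose S mS vS eS using hD
  have hlim : Tendsto (fun j : ℕ => ((j:ℝ≥0∞)+1)⁻¹) atTop (𝓝 0) := by
    have := ENNReal.tendsto_inv_nat_nhds_zero.comp (tendsto_add_atTop_nat 1)
    refine this.congr fun j => by simp
  have vlim : Tendsto (fun j => volume (S j)) atTop (𝓝 0) :=
    tendsto_of_tendsto_of_tendsto_of_le_of_le tendsto_const_nhds hlim (fun _ => zero_le) vS
  refine ⟨φ, hφ, ?_, ?_⟩
  · refine tendsto_of_tendsto_of_tendsto_of_le_of_le tendsto_const_nhds vlim (fun _ => zero_le) ?_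
    intro j
    refine measure_mono fun z hz => ?_
    by_contra hS
    rw [Set.mem_ofPred_eq, eS j z hS] at hz
    exact hz (dig_Phi _ _ _ _)
  · intro t ht P Q hP hQ
    obtain ⟨CP, hCP⟩ : ∃ C, ∀ y, ‖P y‖ ≤ C := by
      obtain ⟨C, hC⟩ := isCompact_univ.exists_bound_of_continuousOn hP.continuousOn
      exact ⟨C, fun y => hC y (Set.mem_univ _)⟩
    obtain ⟨CQ, hCQ⟩ : ∃ C, ∀ y, ‖Q y‖ ≤ C := by
      obtain ⟨C, hC⟩ := isCompact_univ.exists_bound_of_continuousOn hQ.continuousOn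
      exact ⟨C, fun y => hC y (Set.mem_univ _)⟩
    set C := max (max CP CQ) 1
    have hC1 : 1 ≤ C := le_max_right _ _
    have hP1 : ∀ y, ‖P y‖ ≤ C := fun y => (hCP y).trans ((le_max_left _ _).trans (le_max_left _ _))
    have hQ1 : ∀ y, ‖Q y‖ ≤ C := fun y => (hCQ y).trans ((le_max_right _ _).trans (le_max_left _ _))
    rw [Metric.tendsto_nhds]
    intro ε hε
    have hv : Tendsto (fun j => (volume (S j)).toReal) atTop (𝓝 0) := by
      have := (ENNReal.tendsto_toReal (show (0:ℝ≥0∞) ≠ ⊤ by simp)).comp vlim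
      rw [ENNReal.toReal_zero] at this; exact this
    filter_upwards [osc_lim hP (ε/4/C) (by positivity) ρ, osc_lim hQ (ε/4/C) (by positivity) ρ,
      hv.eventually_lt_const (show 0 < ε/(8*C*C) by positivity)] with j o1 o2 hj
    have h1 := Phi_corr ρ j t ht P Q hP.measurable hQ.measurable C (ε/4/C) hP1 hQ1 o1 o2
    -- difference between smooth and step versions
    let f : Torus2 → ℂ := fun z => P ((φ j).t (z + qq)).2 * Q ((φ j).t z).2
    let g : Torus2 → ℂ := fun z => P (Phi ρ j 0 (z + qq)).2 * Q (Phi ρ j 0 z).2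
    let U : Set Torus2 := S j ∪ (fun z => z + qq) ⁻¹' S j
    have mU : MeasurableSet U := (mS j).union ((measurable_add_const qq) (mS j))
    have vU : volume.real U ≤ 2 * (volume (S j)).toReal := by
      have hm := measurePreserving_add_right (volume : Measure Torus2) qq
      refine (measureReal_union_le _ _).trans ?_
      rw [Measure.real, Measure.real, hm.measure_preimage (mS j).nullMeasurableSet, two_mul]
    have efg : ∀ z ∉ U, f z = g z := by
      intro z hz
      simp only [f, g]
      rw [eS j _ (fun h => hz (Or.inl h)), eS j _ (fun h => hz (Or.inr h))]
    have fb : ∀ z, ‖f z‖ ≤ C * C := fun z => by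
      simp only [f]; rw [norm_mul]; gcongr <;> first | exact hP1 _ | exact hQ1 _
    have gb : ∀ z, ‖g z‖ ≤ C * C := fun z => by
      simp only [g]; rw [norm_mul]; gcongr <;> first | exact hP1 _ | exact hQ1 _
    have mPhi2 : Measurable (fun z : Torus2 => (Phi ρ j 0 z).2) := by
      simp only [(Phi_eq ρ j 0 _).2]
      have m2 : Measurable (fun z : Torus2 => NN ρ j (2^(0+2) • z.1) z.2) :=
        (NN_meas ρ j).comp (show Measurable (fun z : Torus2 => (2^(0+2) • z.1, z.2)) by fun_prop)
      have m3 : Measurable (fun z : Torus2 => 2 • z.1) := by fun_prop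
      exact Measurable.ite (m3 BB_meas) m2 measurable_snd
    have fm : Measurable f := by
      have h1 := (φ j).t_cont
      have h2 : Continuous fun z : Torus2 => ((φ j).t (z + qq)).2 :=
        continuous_snd.comp (h1.comp (continuous_add_const qq))
      exact ((hP.comp h2).mul (hQ.comp (continuous_snd.comp h1))).measurable
    have gm : Measurable g := by
      exact (hP.measurable.comp (mPhi2.comp (measurable_add_const qq))).mul (hQ.measurable.comp mPhi2)
    have fi : Integrable f volume := Integrable.of_bound fm.aestronglyMeasurable _ (ae_of_all _ fb)
    have gi : Integrable g volume := Integrable.of_bound gm.aestronglyMeasurable _ (ae_of_all _ gb)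
    have hd : ‖(∫ z in St ρ t, f z) - ∫ z in St ρ t, g z‖ ≤ 2 * C * C * volume.real U := by
      rw [← integral_sub fi.integrableOn gi.integrableOn]
      refine (norm_integral_le_integral_norm _).trans ?_
      calc (∫ z in St ρ t, ‖f z - g z‖) ≤ ∫ z, ‖f z - g z‖ :=
            setIntegral_le_integral (fi.sub gi).norm (ae_of_all _ fun _ => norm_nonneg _)
        _ ≤ ∫ z, U.indicator (fun _ => 2 * C * C) z := by
            refine integral_mono (fi.sub gi).norm ((integrable_const _).indicator mU) fun z => ?_
            by_cases hz : z ∈ U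
            · simp only [Set.indicator_of_mem hz]
              linarith [norm_sub_le (f z) (g z), fb z, gb z]
            · simp only [Set.indicator_of_notMem hz, efg z hz, sub_self, norm_zero, le_refl]
        _ = _ := by rw [integral_indicator_const _ mU, smul_eq_mul, mul_comm]
    rw [dist_eq_norm]
    have h8 : 2 * C * C * volume.real U ≤ ε/2 := by
      calc _ ≤ 2 * C * C * (2 * (ε/(8*C*C))) := by
            gcongr; linarith
        _ = ε/2 := by field_simp; ring
    have h9 : C * (ε/4/C) = ε/4 := by field_simp
    rw [h9] at h1
    calc _ = ‖((∫ z in St ρ t, f z) - ∫ z in St ρ t, g z) + ((∫ z in St ρ t, g z) -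
          2^ρ * (∫ y in JJ ρ t, P y) * ∫ y in JJ ρ t, Q y)‖ := by congr 1; ring
      _ ≤ _ := norm_add_le _ _
      _ ≤ ε/2 + ε/4 := by gcongr; exact hd.trans h8
      _ < ε := by linarith

end AK

namespace AK

attribute [local irreducible] PD.t
attribute [fun_prop] PD.t_cont
@[fun_prop] lemma t_cont' {X : Type*} [TopologicalSpace X] (H : PD) {f : X → Torus2} (hf : Continuous f) :
    Continuous fun x => H.t (f x) := H.t_cont.comp hf
@[fun_prop] lemma Mq_cont' {X : Type*} [TopologicalSpace X] (q : ℕ) {f : X → Torus2} (hf : Continuous f) :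
    Continuous fun x => Mq q (f x) := (Mq_cont q).comp hf
@[fun_prop] lemma fou_cont' {X : Type*} [TopologicalSpace X] (a : ℤ) {f : X → Ci} (hf : Continuous f) :
    Continuous fun x => (fourier a (f x) : ℂ) := (fourier (T := 1) a).continuous.comp hf

def MF (α : ℝ) (q : ℕ) : Filter ℕ := atTop ⊓ comap (fun m : ℕ => m • ((q * α : ℝ) : Ci)) (𝓝 ((1/4 : ℝ) : Ci))

lemma MF_neBot {α : ℝ} (hα : Irrational α) (q : ℕ) (hq : 1 ≤ q) : (MF α q).NeBot := by
  have h1 : DenseRange (fun n : ℤ => n • ((q * α : ℝ) : Ci)) := by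
    rw [AddCircle.denseRange_zsmul_coe_iff, div_one]
    exact hα.natCast_mul (by omega)
  have h2 : MapClusterPt ((1/4 : ℝ) : Ci) atTop (fun m : ℕ => m • ((q * α : ℝ) : Ci)) := by
    rw [mapClusterPt_atTop_nsmul_iff_mem_topologicalClosure_zmultiples]
    have := h1 ((1/4 : ℝ) : Ci)
    exact this
  rw [MF, inf_comm, Filter.neBot_inf_comap_iff_map'] 
  exact h2

lemma qclose (φ : PD) (δ : ℝ) (hδ : 0 < δ) : ∀ᶠ q in atTop, 1 ≤ q ∧ ∀ z, ‖((ql φ q).t z).1 - z.1‖ < δ := by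
  obtain ⟨C, hC, h⟩ := diff_bdd φ.cf φ.ef (1 : PD).cf (1 : PD).ef 0
  simp only [norm_iteratedFDeriv_zero] at h
  obtain ⟨N, hN⟩ := exists_nat_gt (C / δ)
  filter_upwards [eventually_ge_atTop (N+1)] with q hq
  have hq1 : 1 ≤ q := by omega
  refine ⟨hq1, fun z => ?_⟩
  obtain ⟨p, rfl⟩ := torusProj_surj z
  rw [PD.t_proj, ql_f _ _ hq1]
  have hq0 : (0:ℝ) < q := by exact_mod_cast hq1
  simp only [torusProj, qf]
  rw [← AddCircle.coe_sub]
  refine (nco _).trans_lt ?_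
  have h2 := h (q * p.1, p.2)
  have h3 := (norm_fst_le _).trans h2
  rw [PD.one_f] at h3
  simp only [id, Prod.fst_sub, Real.norm_eq_abs] at h3
  have e : (φ.f (q * p.1, p.2)).1 / q - p.1 = ((φ.f (q * p.1, p.2)).1 - q * p.1) / q := by
    field_simp
  rw [e, abs_div, abs_of_pos hq0, div_lt_iff₀ hq0]
  have h4 : C / δ < q := hN.trans (by exact_mod_cast hq)
  rw [div_lt_iff₀ hδ] at h4
  linarith

lemma qfou (φ : PD) (a : ℤ) (ε : ℝ) (hε : 0 < ε) :
    ∀ᶠ q in atTop, 1 ≤ q ∧ ∀ z, ‖(fourier a ((ql φ q).t z).1 : ℂ) - fourier a z.1‖ ≤ ε := by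
  have hu := CompactSpace.uniformContinuous_of_continuous (fourier (T := 1) a).continuous
  obtain ⟨δ, hδ, h⟩ := Metric.uniformContinuous_iff.1 hu ε hε
  filter_upwards [qclose φ δ hδ] with q hq
  refine ⟨hq.1, fun z => ?_⟩
  have := h (a := ((ql φ q).t z).1) (b := z.1) (by rw [dist_eq_norm]; exact hq.2 z)
  rw [dist_eq_norm] at this
  exact this.le

lemma set_close {S : Set Torus2} {F G : Torus2 → ℂ} (hF : Continuous F) (hG : Continuous G) {ε : ℝ}
    (hε : 0 ≤ ε) (h : ∀ z, ‖F z - G z‖ ≤ ε) : ‖(∫ z in S, F z) - ∫ z in S, G z‖ ≤ ε := by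
  rw [← integral_sub (cint hF).integrableOn (cint hG).integrableOn]
  refine (norm_setIntegral_le_of_norm_le_const (measure_lt_top _ _) (fun z _ => h z)).trans ?_
  exact mul_le_of_le_one_right hε measureReal_le_one

lemma set_bd {S : Set Torus2} {F : Torus2 → ℂ} {ε : ℝ}
    (hε : 0 ≤ ε) (h : ∀ z, ‖F z‖ ≤ ε) : ‖∫ z in S, F z‖ ≤ ε := by
  refine (norm_setIntegral_le_of_norm_le_const (measure_lt_top _ _) (fun z _ => h z)).trans ?_
  exact mul_le_of_le_one_right hε measureReal_le_one

lemma Mq_shift (q m : ℕ) (α : ℝ) (z : Torus2) :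
    Mq q ((rot (m * α)).t z) = Mq q z + (m • ((q * α : ℝ) : Ci), 0) := by
  rw [rot_t, Mq, Mq]
  ext1
  · simp only [smul_add, Prod.fst_add]
    rw [nsmul_coe, nsmul_coe]; congr 2; ring
  · simp

lemma ql_snd (φ : PD) (q : ℕ) (hq : 1 ≤ q) (z : Torus2) : ((ql φ q).t z).2 = (φ.t (Mq q z)).2 := by
  rw [← Mq_ql φ q hq z]; rfl

/-- strip integral of character times q-lift -/
lemma strip_AB (ρ : ℕ) (n : ℤ) {g : Torus2 → ℂ} (hg : Continuous g) :
    ∀ᶠ q in atTop, ∀ t, ∫ z in St ρ t, fourier n z.1 * g (Mq q z) = if n = 0 then ∫ z in St ρ t, g z else 0 := by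
  filter_upwards [eventually_ge_atTop (n.natAbs + 1)] with q hq t
  have hq1 : 1 ≤ q := by omega
  rw [← integral_indicator (St_meas ρ t)]
  split_ifs with hn
  · subst hn
    rw [← integral_indicator (St_meas ρ t), ← mp_int (Mq_mp q hq1)
      ((hg.aestronglyMeasurable).indicator (St_meas ρ t))]
    congr 1; ext z
    simp only [fourier_zero, one_mul]
    by_cases hz : z ∈ St ρ t
    · rw [Set.indicator_of_mem hz, Set.indicator_of_mem (show Mq q z ∈ St ρ t from hz)]
    · rw [Set.indicator_of_notMem hz, Set.indicator_of_notMem (show Mq q z ∉ St ρ t from hz)]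
  · have hc : (fourier n ((1/q : ℝ) : Ci) : ℂ) ≠ 1 := by
      rw [Ne, fou_eq_one]
      apply inv_smul_ne q hq1
      intro hd
      have := Int.natAbs_dvd_natAbs.2 hd
      have h3 := Nat.le_of_dvd (by omega) this
      simp at h3; omega
    refine int_zero_of_translate (((1/q : ℝ) : Ci), 0) _ hc fun z => ?_
    have e : Mq q (z + (((1/q : ℝ) : Ci), 0)) = Mq q z := by
      simp only [Mq, Prod.fst_add, Prod.snd_add, smul_add, add_zero]
      rw [q_inv_smul q hq1, add_zero]
    have e2 : (z + (((1/q : ℝ) : Ci), 0)) ∈ St ρ t ↔ z ∈ St ρ t := by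
      simp [St]
    simp only [Set.indicator]
    by_cases hz : z ∈ St ρ t
    · rw [if_pos (e2.2 hz), if_pos hz, e]
      simp only [Prod.fst_add]; rw [fou_add]; ring
    · rw [if_neg (fun h => hz (e2.1 h)), if_neg hz, mul_zero]

lemma shift_close (φ : PD) {P : Ci → ℂ} (hP : Continuous P) (α ε : ℝ) (hε : 0 < ε) (q : ℕ) :
    ∀ᶠ m in MF α q, ∀ z, ‖P (φ.t (z + (m • ((q * α : ℝ) : Ci), 0))).2 - P (φ.t (z + qq)).2‖ ≤ ε := by
  have hc : Continuous fun z => P (φ.t z).2 := hP.comp (continuous_snd.comp φ.t_cont)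
  have hu := CompactSpace.uniformContinuous_of_continuous hc
  obtain ⟨δ, hδ, h⟩ := Metric.uniformContinuous_iff.1 hu ε hε
  have h1 : ∀ᶠ m in MF α q, dist (m • ((q * α : ℝ) : Ci)) ((1/4 : ℝ) : Ci) < δ := by
    have := (tendsto_comap (f := fun m : ℕ => m • ((q * α : ℝ) : Ci)) (x := 𝓝 ((1/4 : ℝ) : Ci))).eventually
      (Metric.ball_mem_nhds _ hδ)
    exact (inf_le_right : MF α q ≤ _) this
  filter_upwards [h1] with m hm z
  rw [← dist_eq_norm]
  refine (h ?_).le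
  rw [dist_add_left, qq, Prod.dist_eq]
  exact max_lt hm (by rw [dist_self]; exact hδ)

lemma step1 (ρ : ℕ) (φ : PD) {P Q : Ci → ℂ} (hP : Continuous P) (hQ : Continuous Q)
    (nP : ∀ y, ‖P y‖ ≤ 1) (nQ : ∀ y, ‖Q y‖ ≤ 1) (a c : ℤ) (α ε : ℝ) (hε : 0 < ε) :
    ∀ᶠ q : ℕ in atTop, ∀ᶠ m : ℕ in MF α q, ∀ t,
      ‖(∫ z in St ρ t, (fourier a ((ql φ q).t ((rot (m * α)).t z)).1 * P ((ql φ q).t ((rot (m * α)).t z)).2) *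
        (fourier c ((ql φ q).t z).1 * Q ((ql φ q).t z).2)) -
        fourier a ((m * α : ℝ) : Ci) * (if a + c = 0 then ∫ z in St ρ t, P (φ.t (z + qq)).2 * Q (φ.t z).2 else 0)‖ ≤ ε := by
  have hg : Continuous fun z => P (φ.t (z + qq)).2 * Q (φ.t z).2 := by
    fun_prop
  filter_upwards [qfou φ a (ε/3) (by positivity), qfou φ c (ε/3) (by positivity), strip_AB ρ (a+c) hg] with q h1 h2 h3
  filter_upwards [shift_close φ hP α (ε/3) (by positivity) q] with m h4 t
  rw [← h3 t, ← integral_const_mul]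
  refine set_close (by fun_prop) (by fun_prop) hε.le fun z => ?_
  rw [ql_snd φ q h1.1, ql_snd φ q h1.1, Mq_shift]
  have e := h1.2 ((rot (m * α)).t z)
  have e2 := h2.2 z
  have e3 := h4 (Mq q z)
  have n4 := nQ (φ.t (Mq q z)).2
  have e5 : (fourier a ((rot (m * α)).t z).1 : ℂ) = fourier a z.1 * fourier a ((m * α : ℝ) : Ci) := by
    rw [rot_t]; simp only; rw [fou_add]
  have e6 : (fourier (a + c) z.1 : ℂ) = fourier a z.1 * fourier c z.1 := by rw [fourier_add]
  have n1 := fou_norm a ((rot (m * α)).t z).1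
  have n2 := fou_norm c ((ql φ q).t z).1
  have n3 := nP (φ.t (Mq q z + (m • ((q * α : ℝ) : Ci), 0))).2
  have n5 := nP (φ.t (Mq q z + qq)).2
  rw [e6, show (fourier a ((m * α : ℝ) : Ci) : ℂ) * (fourier a z.1 * fourier c z.1 * (P (φ.t (Mq q z + qq)).2 * Q (φ.t (Mq q z)).2)) =
    fourier a ((rot (m * α)).t z).1 * P (φ.t (Mq q z + qq)).2 * (fourier c z.1 * Q (φ.t (Mq q z)).2) by rw [e5]; ring]
  generalize (fourier a ((ql φ q).t ((rot (m * α)).t z)).1 : ℂ) = x1 at *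
  generalize (fourier a ((rot (m * α)).t z).1 : ℂ) = y1 at *
  generalize (fourier c ((ql φ q).t z).1 : ℂ) = x2 at *
  generalize (fourier c z.1 : ℂ) = y2 at *
  generalize P (φ.t (Mq q z + (m • ((q * α : ℝ) : Ci), 0))).2 = x3 at *
  generalize P (φ.t (Mq q z + qq)).2 = y3 at *
  generalize Q (φ.t (Mq q z)).2 = x4 at *
  rw [show x1 * x3 * (x2 * x4) - y1 * y3 * (y2 * x4) = (x1 - y1) * (x3 * x2 * x4) + (x3 - y3) * (y1 * x2 * x4) + (x2 - y2) * (y1 * y3 * x4) by ring]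
  have b1 : ‖x3 * x2 * x4‖ ≤ 1 := by rw [norm_mul, norm_mul, n2, mul_one]; exact mul_le_one₀ n3 (norm_nonneg _) n4
  have b2 : ‖y1 * x2 * x4‖ ≤ 1 := by rw [norm_mul, norm_mul, n2, n1]; simpa using n4
  have b3 : ‖y1 * y3 * x4‖ ≤ 1 := by rw [norm_mul, norm_mul, n1, one_mul]; exact mul_le_one₀ n5 (norm_nonneg _) n4
  refine (norm_add₃_le).trans ?_
  rw [norm_mul (x1 - y1), norm_mul (x3 - y3), norm_mul (x2 - y2)]
  have := mul_le_mul e b1 (norm_nonneg _) (by positivity)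
  have := mul_le_mul e3 b2 (norm_nonneg _) (by positivity)
  have := mul_le_mul e2 b3 (norm_nonneg _) (by positivity)
  linarith

lemma step2 (ρ : ℕ) (φ : PD) {P : Ci → ℂ} (hP : Continuous P)
    (nP : ∀ y, ‖P y‖ ≤ 1) (a : ℤ) (ε : ℝ) (hε : 0 < ε) :
    ∀ᶠ q in atTop, ∀ t,
      ‖(∫ z in St ρ t, fourier a ((ql φ q).t z).1 * P ((ql φ q).t z).2) -
        (if a = 0 then ∫ z in St ρ t, P (φ.t z).2 else 0)‖ ≤ ε := by
  have hg : Continuous fun z => P (φ.t z).2 := by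
    fun_prop
  filter_upwards [qfou φ a ε hε, strip_AB ρ a hg] with q h1 h3 t
  rw [← h3 t]
  refine set_close (by fun_prop) (by fun_prop) hε.le fun z => ?_
  rw [ql_snd φ q h1.1, ← sub_mul, norm_mul]
  calc _ ≤ ε * 1 := mul_le_mul (h1.2 z) (nP _) (norm_nonneg _) hε.le
    _ = ε := mul_one _

end AK

namespace AK

attribute [local irreducible] PD.t

def psi : SP := ⟨fun y => Real.sin (2 * Real.pi * y), by fun_prop, fun x => by
  rw [mul_add, mul_one, Real.sin_add_two_pi]⟩

lemma psi_zero : psi.F 0 = 0 := by simp [psi]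

/-- vertical profile -/
def Pk (a b : ℤ) (k : ℕ) (y : Ci) : ℂ := fourier a (((k : ℝ) * psi.c y : ℝ) : Ci) * fourier b y

lemma coe_cont : Continuous (fun x : ℝ => (x : Ci)) := AddCircle.continuous_mk' 1

lemma Pk_cont (a b : ℤ) (k : ℕ) : Continuous (Pk a b k) := by
  unfold Pk
  have := psi.c_cont
  have h : Continuous fun y => (((k : ℝ) * psi.c y : ℝ) : Ci) := coe_cont.comp (by fun_prop)
  fun_prop

lemma Pk_norm (a b : ℤ) (k : ℕ) (y : Ci) : ‖Pk a b k y‖ ≤ 1 := by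
  rw [Pk, norm_mul, fou_norm, fou_norm, one_mul]

lemma deriv_psi_ne : ∀ᵐ x : ℝ, deriv psi.F x ≠ 0 := by
  have hd : ∀ x, deriv psi.F x = 2 * Real.pi * Real.cos (2 * Real.pi * x) := by
    intro x
    have : HasDerivAt psi.F (Real.cos (2 * Real.pi * x) * (2 * Real.pi)) x := by
      have h1 : HasDerivAt (fun y : ℝ => 2 * Real.pi * y) (2 * Real.pi) x := by
        simpa using (hasDerivAt_id x).const_mul (2 * Real.pi)
      exact h1.sin
    rw [this.deriv]; ring
  have hc : Set.Countable {x : ℝ | deriv psi.F x = 0} := by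
    refine (Set.countable_range (fun k : ℤ => (2 * k + 1) / 4 : ℤ → ℝ)).mono ?_
    intro x hx
    rw [Set.mem_ofPred_eq, hd] at hx
    have h2 : Real.cos (2 * Real.pi * x) = 0 := by
      have : (2 * Real.pi) ≠ 0 := by positivity
      exact (mul_eq_zero.1 hx).resolve_left this
    obtain ⟨k, hk⟩ := Real.cos_eq_zero_iff.1 h2
    refine ⟨k, ?_⟩
    have hp := Real.pi_pos
    have h5 : Real.pi * (2 * x) = Real.pi * ((2 * k + 1) / 2) := by linarith
    have := mul_left_cancel₀ hp.ne' h5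
    simp only; linarith
  rw [ae_iff]
  simp only [not_not]
  exact hc.measure_zero _

lemma Pk_osc (a b : ℤ) (ha : a ≠ 0) (ρ t : ℕ) : Tendsto (fun k => ∫ y in JJ ρ t, Pk a b k y) atTop (𝓝 0) := by
  set g : ℝ → ℂ := fun x => open Classical in if x ∈ Set.Ico (0:ℝ) 1 ∧ ((x : ℝ) : Ci) ∈ JJ ρ t then ex (b * x) else 0 with hg
  have hm : MeasurableSet {x : ℝ | x ∈ Set.Ico (0:ℝ) 1 ∧ ((x : ℝ) : Ci) ∈ JJ ρ t} :=
    measurableSet_Ico.inter (coe_cont.measurable (JJ_meas ρ t))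
  have hgm : Measurable g := Measurable.ite hm (ex_cont.measurable.comp (by fun_prop)) measurable_const
  have hgi : Integrable g volume := by
    have : Integrable ((Set.Ico (0:ℝ) 1).indicator (fun _ => (1:ℝ))) volume :=
      (integrable_indicator_iff measurableSet_Ico).2 (integrableOn_const (by simp))
    refine this.mono' hgm.aestronglyMeasurable (ae_of_all _ fun x => ?_)
    rw [hg]; simp only
    split_ifs with h
    · rw [ex_norm, Set.indicator_of_mem h.1]
    · rw [norm_zero]; exact Set.indicator_nonneg (fun _ _ => zero_le_one) _
  have h := RL (f := psi.F) (psi.sm.of_le (by exact_mod_cast le_top)) hgi (deriv_psi_ne.mono fun x hx _ => hx)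
  have hl : Tendsto (fun k : ℕ => ((a : ℝ) * k : ℝ)) atTop (cocompact ℝ) := by
    rw [← Metric.cobounded_eq_cocompact, ← tendsto_norm_atTop_iff_cobounded]
    have : (fun k : ℕ => ‖((a : ℝ) * k : ℝ)‖) = fun k : ℕ => |(a:ℝ)| * k := by
      ext k; rw [norm_mul]; simp
    rw [this]
    exact (tendsto_natCast_atTop_atTop).const_mul_atTop (by positivity)
  refine (h.comp hl).congr fun k => ?_
  simp only [Function.comp]
  rw [← integral_indicator (JJ_meas ρ t)]
  have e1 : (JJ ρ t).indicator (Pk a b k) = fun y => (fun x => g x * ex (a * k * psi.F x)) (rep y) := by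
    ext y
    have hr : rep y ∈ Set.Ico (0:ℝ) 1 := ⟨rep_nonneg y, rep_lt y⟩
    simp only [hg]
    by_cases hy : y ∈ JJ ρ t
    · rw [Set.indicator_of_mem hy, if_pos ⟨hr, by rw [coe_rep]; exact hy⟩, Pk, fou_coe, psi.c_eq]
      conv_lhs => rw [← coe_rep y, fou_coe, rep_coe, Int.fract_eq_self.2 hr]
      rw [mul_comm]; congr 2; ring
    · rw [Set.indicator_of_notMem hy, if_neg (fun h => hy (by rw [← coe_rep y]; exact h.2)), zero_mul]
  rw [e1, mp_int mp_rep]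
  · rw [← integral_indicator measurableSet_Ico]
    congr 1; ext x
    by_cases hx : x ∈ Set.Ico (0:ℝ) 1
    · rw [Set.indicator_of_mem hx]
    · rw [Set.indicator_of_notMem hx, hg]; simp only; rw [if_neg (fun h => hx h.1), zero_mul]
  · refine (hgm.mul (ex_cont.measurable.comp ?_)).aestronglyMeasurable
    have := psi.sm.continuous.measurable
    fun_prop

def Am (φ : PD) (k q : ℕ) : PD := shX (psi.scale k) * ql φ q

lemma Am_ch (φ : PD) (k q : ℕ) (a b : ℤ) (z : Torus2) :
    ch a b ((Am φ k q).t z) = fourier a ((ql φ q).t z).1 * Pk a b k ((ql φ q).t z).2 := by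
  rw [Am, PD.mul_t_apply, ch_apply, shX_t, Pk]
  simp only
  rw [fou_add, SP.scale_c]; ring

def Cor (ρ t : ℕ) (A : PD) (s : ℝ) (F G : C(Torus2, ℂ)) : ℂ :=
  (∫ z in St ρ t, F (A.t ((rot s).t z)) * G (A.t z)) -
    2^ρ * (∫ z in St ρ t, F (A.t z)) * ∫ z in St ρ t, G (A.t z)

def Ev (α : ℝ) (P : ℕ → ℕ → ℕ → ℕ → Prop) : Prop :=
  ∀ᶠ k in atTop, ∀ᶠ j in atTop, ∀ᶠ q in LF α, ∀ᶠ m in MF α q, P k j q m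

lemma Ev.mono2 {α : ℝ} {P Q R : ℕ → ℕ → ℕ → ℕ → Prop} (h : Ev α P) (h' : Ev α Q)
    (H : ∀ k j q m, P k j q m → Q k j q m → R k j q m) : Ev α R := by
  filter_upwards [h, h'] with k h h'
  filter_upwards [h, h'] with k h h'
  filter_upwards [h, h'] with k h h'
  filter_upwards [h, h'] with k h h'
  exact H _ _ _ _ h h'

lemma Ev.mono {α : ℝ} {P R : ℕ → ℕ → ℕ → ℕ → Prop} (h : Ev α P)
    (H : ∀ k j q m, P k j q m → R k j q m) : Ev α R := h.mono2 h fun _ _ _ _ h _ => H _ _ _ _ h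

lemma Ev.all {α : ℝ} {P : ℕ → ℕ → ℕ → ℕ → Prop} (H : ∀ k j q m, P k j q m) : Ev α P :=
  Eventually.of_forall fun k => Eventually.of_forall fun j => Eventually.of_forall fun q =>
    Eventually.of_forall fun m => H k j q m

def MixP (ρ : ℕ) (φ : ℕ → PD) (α : ℝ) (F G : C(Torus2, ℂ)) : Prop :=
  ∀ ε > 0, Ev α fun k j q m => ∀ t < 2^ρ, ‖Cor ρ t (Am (φ j) k q) (m * α) F G‖ ≤ ε

lemma Cor_add_l (ρ t : ℕ) (A : PD) (s : ℝ) (F F' G : C(Torus2, ℂ)) :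
    Cor ρ t A s (F + F') G = Cor ρ t A s F G + Cor ρ t A s F' G := by
  unfold Cor
  simp only [ContinuousMap.add_apply, add_mul]
  rw [integral_add (cint (by fun_prop)).integrableOn (cint (by fun_prop)).integrableOn,
    integral_add (cint (by fun_prop)).integrableOn (cint (by fun_prop)).integrableOn]
  ring

lemma Cor_add_r (ρ t : ℕ) (A : PD) (s : ℝ) (F G G' : C(Torus2, ℂ)) :
    Cor ρ t A s F (G + G') = Cor ρ t A s F G + Cor ρ t A s F G' := by
  unfold Cor
  simp only [ContinuousMap.add_apply, mul_add]
  rw [integral_add (cint (by fun_prop)).integrableOn (cint (by fun_prop)).integrableOn,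
    integral_add (cint (by fun_prop)).integrableOn (cint (by fun_prop)).integrableOn]
  ring

lemma Cor_smul_l (ρ t : ℕ) (A : PD) (s : ℝ) (c : ℂ) (F G : C(Torus2, ℂ)) :
    Cor ρ t A s (c • F) G = c * Cor ρ t A s F G := by
  unfold Cor
  simp only [ContinuousMap.smul_apply, smul_eq_mul, mul_assoc]
  rw [integral_const_mul, integral_const_mul]
  ring

lemma Cor_smul_r (ρ t : ℕ) (A : PD) (s : ℝ) (c : ℂ) (F G : C(Torus2, ℂ)) :
    Cor ρ t A s F (c • G) = c * Cor ρ t A s F G := by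
  unfold Cor
  simp only [ContinuousMap.smul_apply, smul_eq_mul, mul_left_comm _ c]
  rw [integral_const_mul, integral_const_mul]
  ring

lemma Cor_bd (ρ t : ℕ) (A : PD) (s : ℝ) (F G : C(Torus2, ℂ)) {a b : ℝ} (ha : 0 ≤ a) (hb : 0 ≤ b)
    (hF : ∀ z, ‖F z‖ ≤ a) (hG : ∀ z, ‖G z‖ ≤ b) : ‖Cor ρ t A s F G‖ ≤ (1 + 2^ρ) * (a * b) := by
  unfold Cor
  refine (norm_sub_le _ _).trans ?_
  have h1 : ‖∫ z in St ρ t, F (A.t ((rot s).t z)) * G (A.t z)‖ ≤ a * b :=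
    set_bd (by positivity) fun z => by rw [norm_mul]; exact mul_le_mul (hF _) (hG _) (norm_nonneg _) ha
  have h2 : ‖∫ z in St ρ t, F (A.t z)‖ ≤ a := set_bd ha fun z => hF _
  have h3 : ‖∫ z in St ρ t, G (A.t z)‖ ≤ b := set_bd hb fun z => hG _
  rw [norm_mul, norm_mul, norm_pow, RCLike.norm_ofNat]
  have : 2^ρ * ‖∫ z in St ρ t, F (A.t z)‖ * ‖∫ z in St ρ t, G (A.t z)‖ ≤ 2^ρ * a * b := by gcongr
  linarith

lemma ctm_bd (F : C(Torus2, ℂ)) : ∃ a : ℝ, 0 < a ∧ ∀ z, ‖F z‖ ≤ a :=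
  ⟨‖F‖ + 1, by positivity, fun z => (F.norm_coe_le_norm z).trans (by linarith)⟩

lemma MixP_ch {ρ : ℕ} {φ : ℕ → PD}
    (hφ : ∀ t < 2^ρ, ∀ P Q : Ci → ℂ, Continuous P → Continuous Q →
      Tendsto (fun j => ∫ z in St ρ t, P ((φ j).t (z + qq)).2 * Q ((φ j).t z).2) atTop
        (𝓝 (2^ρ * (∫ y in JJ ρ t, P y) * ∫ y in JJ ρ t, Q y))) (α : ℝ) (a b c d : ℤ) :
    MixP ρ φ α (ch a b) (ch c d) := by
  intro ε hε
  set R : ℝ := 2^ρ with hR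
  have hR1 : 1 ≤ R := one_le_pow₀ (by norm_num)
  have hosc : ∀ᶠ k in atTop, ∀ t < 2^ρ, a ≠ 0 → ‖∫ y in JJ ρ t, Pk a b k y‖ ≤ ε / (4 * R) := by
    have : ∀ t ∈ Finset.range (2^ρ), ∀ᶠ k in atTop, a ≠ 0 → ‖∫ y in JJ ρ t, Pk a b k y‖ ≤ ε / (4 * R) := by
      intro t _
      by_cases ha : a = 0
      · exact Eventually.of_forall fun k h => absurd ha h
      · have := (Pk_osc a b ha ρ t).norm.eventually_le_const (v := ‖(0:ℂ)‖) (u := ε / (4*R)) (by rw [norm_zero]; positivity)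
        exact this.mono fun k h _ => h
    exact ((Finset.eventually_all _).2 this).mono fun k h t ht => h t (Finset.mem_range.2 ht)
  have h2 : ∀ t < 2^ρ, ∀ Q : Ci → ℂ, Continuous Q →
      Tendsto (fun j => ∫ z in St ρ t, Q ((φ j).t z).2) atTop (𝓝 (∫ y in JJ ρ t, Q y)) := by
    intro t ht Q hQ
    have := hφ t ht (fun _ => 1) Q continuous_const hQ
    simp only [one_mul] at this
    convert this using 2
    rw [setIntegral_const, Measure.real, JJ_vol ρ t ht, ENNReal.toReal_ofReal (by positivity)]
    simp
  filter_upwards [hosc] with k hk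
  have hP := Pk_cont a b k
  have hQ := Pk_cont c d k
  have hj : ∀ t ∈ Finset.range (2^ρ), ∀ᶠ j in atTop,
      ‖(∫ z in St ρ t, Pk a b k ((φ j).t (z + qq)).2 * Pk c d k ((φ j).t z).2) -
        2^ρ * (∫ y in JJ ρ t, Pk a b k y) * (∫ y in JJ ρ t, Pk c d k y)‖ ≤ ε / 8 ∧
      ‖(∫ z in St ρ t, Pk a b k ((φ j).t z).2) - ∫ y in JJ ρ t, Pk a b k y‖ ≤ ε / (8 * R) ∧
      ‖(∫ z in St ρ t, Pk c d k ((φ j).t z).2) - ∫ y in JJ ρ t, Pk c d k y‖ ≤ ε / (8 * R) := by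
    intro t ht
    have ht := Finset.mem_range.1 ht
    have l : ∀ {u : ℕ → ℂ} {v : ℂ} {δ : ℝ}, 0 < δ → Tendsto u atTop (𝓝 v) → ∀ᶠ j in atTop, ‖u j - v‖ ≤ δ := by
      intro u v δ hδ h
      have := (tendsto_iff_norm_sub_tendsto_zero.1 h).eventually_le_const hδ
      exact this
    filter_upwards [l (by positivity : 0 < ε/8) (hφ t ht _ _ hP hQ), l (by positivity : 0 < ε / (8*R)) (h2 t ht _ hP),
      l (by positivity : 0 < ε / (8*R)) (h2 t ht _ hQ)] with j h1 h2 h3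
    exact ⟨h1, h2, h3⟩
  filter_upwards [(Finset.eventually_all _).2 hj] with j hj
  have nP := Pk_norm a b k
  have nQ := Pk_norm c d k
  filter_upwards [LF_atTop α (step1 ρ (φ j) hP hQ nP nQ a c α (ε/8) (by positivity)),
    LF_atTop α (step2 ρ (φ j) hP nP a (ε/(8*R)) (by positivity)),
    LF_atTop α (step2 ρ (φ j) hQ nQ c (ε/(8*R)) (by positivity))] with q hq1 hq2 hq3
  filter_upwards [hq1] with m hm t ht
  obtain ⟨j1, j2, j3⟩ := hj t (Finset.mem_range.2 ht)
  have m1 := hm t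
  have m2 := hq2 t
  have m3 := hq3 t
  have hk := hk t ht
  have nX : ‖∫ y in JJ ρ t, Pk a b k y‖ ≤ 1 := by
    refine (norm_setIntegral_le_of_norm_le_const (measure_lt_top _ _) (fun z _ => nP z)).trans ?_
    simp
  have nY : ‖∫ y in JJ ρ t, Pk c d k y‖ ≤ 1 := by
    refine (norm_setIntegral_le_of_norm_le_const (measure_lt_top _ _) (fun z _ => nQ z)).trans ?_
    simp
  have n0 : ∀ (φ : PD) (q : ℕ) (a b : ℤ), ‖∫ z in St ρ t, fourier a ((ql φ q).t z).1 * Pk a b k ((ql φ q).t z).2‖ ≤ 1 :=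
    fun φ q a b => set_bd zero_le_one fun z => by rw [norm_mul, fou_norm, one_mul]; exact Pk_norm _ _ _ _
  have n2 := n0 (φ j) q a b
  have n3 := n0 (φ j) q c d
  have ne := fou_norm a ((m * α : ℝ) : Ci)
  have he0 : a = 0 → (fourier a ((m * α : ℝ) : Ci) : ℂ) = 1 := by rintro rfl; exact fourier_zero
  unfold Cor
  simp only [Am_ch]
  have hRn : ‖(2^ρ : ℂ)‖ = R := by rw [norm_pow, RCLike.norm_ofNat]
  generalize (∫ z in St ρ t, fourier a ((ql (φ j) q).t ((rot (m * α)).t z)).1 * Pk a b k ((ql (φ j) q).t ((rot (m * α)).t z)).2 *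
        (fourier c ((ql (φ j) q).t z).1 * Pk c d k ((ql (φ j) q).t z).2)) = I1 at *
  generalize (∫ z in St ρ t, fourier a ((ql (φ j) q).t z).1 * Pk a b k ((ql (φ j) q).t z).2) = I2 at *
  generalize (∫ z in St ρ t, fourier c ((ql (φ j) q).t z).1 * Pk c d k ((ql (φ j) q).t z).2) = I3 at *
  generalize (∫ z in St ρ t, Pk a b k ((φ j).t (z + qq)).2 * Pk c d k ((φ j).t z).2) = K1 at *
  generalize (∫ z in St ρ t, Pk a b k ((φ j).t z).2) = K2 at *
  generalize (∫ z in St ρ t, Pk c d k ((φ j).t z).2) = K3 at *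
  generalize (∫ y in JJ ρ t, Pk a b k y) = X at *
  generalize (∫ y in JJ ρ t, Pk c d k y) = Y at *
  generalize (fourier a ((m * α : ℝ) : Ci) : ℂ) = e at *
  generalize (2^ρ : ℂ) = r at *
  clear_value R
  clear hm hq1 hq2 hq3 hj h2 hosc hP hQ nP nQ hφ n0
  have hRp : 0 < R := by linarith
  by_cases ha : a = 0
  · rw [if_pos ha] at m2
    have he0 := he0 ha
    by_cases hc : c = 0
    · rw [if_pos hc] at m3
      rw [if_pos (by omega), he0, one_mul] at m1
      have d2 : ‖I2 - X‖ ≤ ε / (4 * R) := by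
        refine (norm_sub_le_norm_sub_add_norm_sub I2 K2 X).trans ((add_le_add m2 j2).trans ?_)
        apply le_of_eq; field_simp; norm_num
      have d3 : ‖I3 - Y‖ ≤ ε / (4 * R) := by
        refine (norm_sub_le_norm_sub_add_norm_sub I3 K3 Y).trans ((add_le_add m3 j3).trans ?_)
        apply le_of_eq; field_simp; norm_num
      rw [show I1 - r * I2 * I3 = (I1 - K1) + (K1 - r * X * Y) - (r * ((I2 - X) * I3) + r * (X * (I3 - Y))) by ring]
      refine (norm_sub_le _ _).trans ((add_le_add (norm_add_le _ _) (norm_add_le _ _)).trans ?_)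
      simp only [norm_mul r, hRn, norm_mul X, norm_mul (I2 - X)]
      have t1 : ‖I2 - X‖ * ‖I3‖ ≤ ε / (4 * R) * 1 := mul_le_mul d2 n3 (norm_nonneg _) (by positivity)
      have t2 : ‖X‖ * ‖I3 - Y‖ ≤ 1 * (ε / (4 * R)) := mul_le_mul nX d3 (norm_nonneg _) (by positivity)
      have t3 : R * (‖I2 - X‖ * ‖I3‖) ≤ R * (ε / (4 * R)) := by gcongr; linarith
      have t4 : R * (‖X‖ * ‖I3 - Y‖) ≤ R * (ε / (4 * R)) := by gcongr; linarith
      have t5 : R * (ε / (4 * R)) = ε / 4 := by field_simp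
      linarith
    · rw [if_neg hc, sub_zero] at m3
      rw [if_neg (by omega), mul_zero, sub_zero] at m1
      refine (norm_sub_le _ _).trans ?_
      rw [norm_mul, norm_mul, hRn]
      have t1 : R * ‖I2‖ * ‖I3‖ ≤ R * 1 * (ε / (8 * R)) := by gcongr
      have t5 : R * 1 * (ε / (8 * R)) = ε / 8 := by field_simp
      linarith
  · rw [if_neg ha, sub_zero] at m2
    have t1 : R * ‖I2‖ * ‖I3‖ ≤ R * (ε / (8 * R)) * 1 := by gcongr
    have t5 : R * (ε / (8 * R)) * 1 = ε / 8 := by field_simp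
    have hk := hk ha
    have : ‖I1‖ ≤ ε / 2 := by
      by_cases hc : a + c = 0
      · rw [if_pos hc] at m1
        have s1 : ‖r * X * Y‖ ≤ R * (ε / (4 * R)) * 1 := by
          rw [norm_mul, norm_mul, hRn]; gcongr
        have s2 : R * (ε / (4 * R)) * 1 = ε / 4 := by field_simp
        have s3 : ‖K1‖ ≤ ε / 8 + ε / 4 := by
          calc ‖K1‖ = ‖(K1 - r * X * Y) + r * X * Y‖ := by congr 1; ring
            _ ≤ _ := (norm_add_le _ _).trans (by linarith)
        calc ‖I1‖ = ‖(I1 - e * K1) + e * K1‖ := by congr 1; ring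
          _ ≤ ‖I1 - e * K1‖ + ‖e * K1‖ := norm_add_le _ _
          _ ≤ _ := by rw [norm_mul, ne]; linarith
      · rw [if_neg hc, mul_zero, sub_zero] at m1
        linarith
    refine (norm_sub_le _ _).trans ?_
    rw [norm_mul, norm_mul, hRn]
    linarith

lemma MixP_all {ρ : ℕ} {φ : ℕ → PD}
    (hφ : ∀ t < 2^ρ, ∀ P Q : Ci → ℂ, Continuous P → Continuous Q →
      Tendsto (fun j => ∫ z in St ρ t, P ((φ j).t (z + qq)).2 * Q ((φ j).t z).2) atTop
        (𝓝 (2^ρ * (∫ y in JJ ρ t, P y) * ∫ y in JJ ρ t, Q y))) (α : ℝ) (F G : C(Torus2, ℂ)) :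
    MixP ρ φ α F G := by
  have hc1 : ∀ {c x y : ℝ}, 0 ≤ c → 0 < y → x ≤ y / (c + 1) → c * x ≤ y := by
    intro c x y hc hy hx
    rw [le_div_iff₀ (by positivity)] at hx
    by_cases h : 0 ≤ x
    · linarith
    · nlinarith
  induction F using torus_induction with
  | hch a b =>
    induction G using torus_induction with
    | hch c d => exact MixP_ch hφ α a b c d
    | hadd G G' h h' =>
      intro ε hε
      refine (h (ε/2) (by positivity)).mono2 (h' (ε/2) (by positivity)) fun k j q m h1 h2 t ht => ?_
      rw [Cor_add_r]
      exact (norm_add_le _ _).trans (by linarith [h1 t ht, h2 t ht])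
    | hsmul c G h =>
      intro ε hε
      refine (h (ε/(‖c‖+1)) (by positivity)).mono fun k j q m h1 t ht => ?_
      rw [Cor_smul_r, norm_mul]
      exact hc1 (norm_nonneg _) hε (h1 t ht)
    | hlim G h =>
      intro ε hε
      obtain ⟨A, hA, bA⟩ := ctm_bd (ch a b)
      obtain ⟨G', hG', bG⟩ := h (ε/2/((1+2^ρ)*A)) (by positivity)
      refine (hG' (ε/2) (by positivity)).mono fun k j q m h1 t ht => ?_
      rw [show G = G' + (G - G') by ring, Cor_add_r]
      refine (norm_add_le _ _).trans ?_
      have := Cor_bd ρ t (Am (φ j) k q) (m * α) (ch a b) (G - G') hA.le (by positivity) bA (fun z => (bG z).le)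
      have e : (1 + 2 ^ ρ) * (A * (ε / 2 / ((1 + 2 ^ ρ) * A))) = ε / 2 := by field_simp
      linarith [h1 t ht]
  | hadd F F' h h' =>
    intro ε hε
    refine (h (ε/2) (by positivity)).mono2 (h' (ε/2) (by positivity)) fun k j q m h1 h2 t ht => ?_
    rw [Cor_add_l]
    exact (norm_add_le _ _).trans (by linarith [h1 t ht, h2 t ht])
  | hsmul c F h =>
    intro ε hε
    refine (h (ε/(‖c‖+1)) (by positivity)).mono fun k j q m h1 t ht => ?_
    rw [Cor_smul_l, norm_mul]
    exact hc1 (norm_nonneg _) hε (h1 t ht)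
  | hlim F h =>
    intro ε hε
    obtain ⟨A, hA, bA⟩ := ctm_bd G
    obtain ⟨F', hF', bF⟩ := h (ε/2/((1+2^ρ)*A)) (by positivity)
    refine (hF' (ε/2) (by positivity)).mono fun k j q m h1 t ht => ?_
    rw [show F = F' + (F - F') by ring, Cor_add_l]
    refine (norm_add_le _ _).trans ?_
    have := Cor_bd ρ t (Am (φ j) k q) (m * α) (F - F') G (by positivity) hA.le (fun z => (bF z).le) bA
    have e : (1 + 2 ^ ρ) * ((ε / 2 / ((1 + 2 ^ ρ) * A)) * A) = ε / 2 := by field_simp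
    linarith [h1 t ht]

end AK

namespace AK

attribute [local irreducible] PD.t

/-- C^n closeness of conjugates -/
def Cl (α : ℝ) (n : ℕ) (ε : ℝ) (H H' : PD) : Prop :=
  (∀ k ≤ n, ∀ x, ‖iteratedFDeriv ℝ k (fun p => (Tc H' α).f p - (Tc H α).f p) x‖ ≤ ε) ∧
  (∀ k ≤ n, ∀ x, ‖iteratedFDeriv ℝ k (fun p => (Tc H' α).g p - (Tc H α).g p) x‖ ≤ ε)

lemma dtri {F G K : E2 → E2} (hF : ContDiff ℝ (⊤ : ℕ∞) F) (hG : ContDiff ℝ (⊤ : ℕ∞) G)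
    (hK : ContDiff ℝ (⊤ : ℕ∞) K) (k : ℕ) (x : E2) :
    ‖iteratedFDeriv ℝ k (fun p => K p - F p) x‖ ≤ ‖iteratedFDeriv ℝ k (fun p => G p - F p) x‖ +
      ‖iteratedFDeriv ℝ k (fun p => K p - G p) x‖ := by
  have e : (fun p => K p - F p) = (fun p => G p - F p) + fun p => K p - G p := by
    ext p <;> simp
  rw [e, iteratedFDeriv_add_apply ((hG.sub hF).of_le (le_top' k)).contDiffAt
    ((hK.sub hG).of_le (le_top' k)).contDiffAt]
  exact norm_add_le _ _

lemma Cl.trans {α : ℝ} {n : ℕ} {ε ε' : ℝ} {H H' H'' : PD} (h : Cl α n ε H H') (h' : Cl α n ε' H' H'') :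
    Cl α n (ε + ε') H H'' :=
  ⟨fun k hk x => (dtri (Tc H α).cf (Tc H' α).cf (Tc H'' α).cf k x).trans (add_le_add (h.1 k hk x) (h'.1 k hk x)),
   fun k hk x => (dtri (Tc H α).cg (Tc H' α).cg (Tc H'' α).cg k x).trans (add_le_add (h.2 k hk x) (h'.2 k hk x))⟩

/-- strip error -/
def se (ρ : ℕ) (B : PD) : ℝ≥0∞ := volume {z : Torus2 | dig ρ (B.t z).2 ≠ dig ρ z.2}

lemma se_meas (ρ : ℕ) (B : PD) : MeasurableSet {z : Torus2 | dig ρ (B.t z).2 ≠ dig ρ z.2} := by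
  have h1 : Measurable fun z : Torus2 => dig ρ (B.t z).2 := (dig_meas ρ).comp (measurable_snd.comp B.t_cont.measurable)
  have h2 : Measurable fun z : Torus2 => dig ρ z.2 := (dig_meas ρ).comp measurable_snd
  exact (measurableSet_eq_fun h1 h2).compl

lemma se_mul (ρ : ℕ) (A B : PD) : se ρ (A * B) ≤ se ρ A + se ρ B := by
  unfold se
  rw [← B.t_mp.measure_preimage (se_meas ρ A).nullMeasurableSet]
  refine (measure_mono ?_).trans (measure_union_le _ _)
  intro z hz
  by_contra h
  simp only [Set.mem_union, Set.mem_preimage, Set.mem_ofPred_eq, not_or, not_not] at h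
  apply hz
  rw [PD.mul_t_apply, h.1, h.2]

lemma se_ql (ρ : ℕ) (A : PD) (q : ℕ) (hq : 1 ≤ q) : se ρ (ql A q) = se ρ A := by
  unfold se
  rw [← (Mq_mp q hq).measure_preimage (se_meas ρ A).nullMeasurableSet]
  congr 1; ext z
  simp only [Set.mem_preimage, Set.mem_ofPred_eq]
  rw [ql_snd A q hq]; rfl

lemma se_shX (ρ : ℕ) (a : SP) : se ρ (shX a) = 0 := by
  unfold se
  have : {z : Torus2 | dig ρ ((shX a).t z).2 ≠ dig ρ z.2} = ∅ := by
    ext z; simp [shX_t]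
  rw [this, measure_empty]

def EE (ρ t : ℕ) (H : PD) : Set Torus2 := (H⁻¹).t ⁻¹' St ρ t

lemma EE_meas (ρ t : ℕ) (H : PD) : MeasurableSet (EE ρ t H) := (H⁻¹).t_cont.measurable (St_meas ρ t)

lemma EE_diff (ρ t : ℕ) (H B : PD) : volume (symmDiff (EE ρ t H) (EE ρ t (H * B))) ≤ se ρ B := by
  unfold se
  rw [← ((H * B)⁻¹).t_mp.measure_preimage (se_meas ρ B).nullMeasurableSet]
  refine measure_mono ?_
  intro z hz hc
  have e : B.t (((H * B)⁻¹).t z) = (H⁻¹).t z := by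
    rw [← PD.mul_t_apply]; congr 1; group
  rw [e] at hc
  have : z ∈ EE ρ t H ↔ z ∈ EE ρ t (H * B) := by
    simp only [EE, St, JJ, Set.mem_preimage, Set.mem_ofPred_eq]
    rw [hc]
  rcases hz with h | h
  · exact h.2 (this.1 h.1)
  · exact h.2 (this.2 h.1)

lemma Cor_comp (ρ t : ℕ) (H A : PD) (s : ℝ) (F G : C(Torus2, ℂ)) :
    Cor ρ t A s (F.comp ⟨H.t, H.t_cont⟩) (G.comp ⟨H.t, H.t_cont⟩) = Cor ρ t (H * A) s F G := by
  unfold Cor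
  simp [PD.mul_t_apply]

lemma Tc_shX (H : PD) (a : SP) (α : ℝ) : Tc (H * shX a) α = Tc H α := by
  unfold Tc
  rw [mul_assoc H, ← rot_shX]; group

lemma Fix0_ql {φ : PD} (h : Fix0 φ) (q : ℕ) (hq : 1 ≤ q) : Fix0 (ql φ q) := by
  intro x
  rw [ql_f _ _ hq]
  have hq0 : (q:ℝ) ≠ 0 := by positivity
  have h1 := h (q * x)
  simp only [qf]
  rw [h1]
  ext
  · simp only; field_simp
  · rfl

lemma Fix0_psi (k : ℕ) : Fix0 (shX (psi.scale k)) := fun x => by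
  simp [shX, SP.scale, psi_zero]

theorem mix_step {α : ℝ} (hα : Liouville α) (ρ : ℕ) (H : PD) (fs : ℕ → C(Torus2, ℂ)) (n : ℕ) (ε : ℝ)
    (hε : 0 < ε) : ∃ B : PD, Fix0 B ∧ Cl α n ε H (H * B) ∧ se ρ B ≤ ENNReal.ofReal ε ∧
      ∃ m ≥ n, ∀ i < n, ∀ j < n, ∀ t < 2^ρ, ‖Cor ρ t (H * B) (m * α) (fs i) (fs j)‖ ≤ ε := by
  obtain ⟨φ, h0, hse, hφ⟩ := phi_exists ρ
  have hmix : Ev α fun k j q m => ∀ p ∈ Finset.range n ×ˢ Finset.range n, ∀ t < 2^ρ,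
      ‖Cor ρ t (H * Am (φ j) k q) (m * α) (fs p.1) (fs p.2)‖ ≤ ε := by
    unfold Ev
    simp only [Finset.eventually_all]
    rintro ⟨i, i'⟩ -
    have := MixP_all hφ α ((fs i).comp ⟨H.t, H.t_cont⟩) ((fs i').comp ⟨H.t, H.t_cont⟩) ε hε
    simp only [Cor_comp] at this
    exact this
  have := LF_neBot hα
  obtain ⟨k, hk⟩ := hmix.exists
  have hse' : ∀ᶠ j in atTop, se ρ (φ j) ≤ ENNReal.ofReal ε :=
    hse.eventually_le_const (by simpa using hε)
  obtain ⟨j, hj, hj'⟩ := (hk.and hse').exists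
  obtain ⟨q, hq, hc, hq1⟩ := (hj.and ((close3 α (H * shX (psi.scale k)) (φ j) n ε hε).and
    (LF_atTop α (eventually_ge_atTop 1)))).exists
  have := MF_neBot hα.irrational q hq1
  obtain ⟨m, hm, hm'⟩ := (hq.and ((inf_le_left : MF α q ≤ atTop) (eventually_ge_atTop n))).exists
  refine ⟨Am (φ j) k q, (Fix0_psi k).mul (Fix0_ql (h0 j) q hq1), ?_, ?_, m, hm', ?_⟩
  · rw [Am, ← mul_assoc]
    rw [Tc_shX] at hc
    exact hc
  · refine (se_mul _ _ _).trans ?_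
    rw [se_shX, zero_add, se_ql _ _ _ hq1]
    exact hj'
  · intro i hi i' hi' t ht
    exact hm (i, i') (by simp [hi, hi']) t ht

end AK

namespace AK

attribute [local irreducible] PD.t

@[fun_prop] lemma SP_cont' {X : Type*} [TopologicalSpace X] (b : SP) {f : X → ℝ} (hf : Continuous f) :
    Continuous fun x => b.F (f x) := b.sm.continuous.comp hf

def sawf (x : ℝ) : ℝ := x - Real.smoothTransition (2 * x - 1/2)

lemma sawf_lo {x : ℝ} (h : x ≤ 1/4) : sawf x = x := by
  rw [sawf, Real.smoothTransition.zero_of_nonpos (by linarith), sub_zero]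
lemma sawf_hi {x : ℝ} (h : 3/4 ≤ x) : sawf x = x - 1 := by
  rw [sawf, Real.smoothTransition.one_of_one_le (by linarith)]

lemma sawf_smooth : ContDiff ℝ (⊤ : ℕ∞) sawf := by
  unfold sawf
  exact contDiff_id.sub (Real.smoothTransition.contDiff.comp
    ((contDiff_const.mul contDiff_id).sub contDiff_const))

def saw : SP := pz sawf sawf_smooth (1/4) (by norm_num) (fun x h1 h2 => by
  rw [sawf_hi (by linarith), sawf_lo (by linarith)])

lemma saw_F (x : ℝ) : saw.F x = sawf (Int.fract x) := rfl

lemma saw_bd (x : ℝ) : |saw.F x| ≤ 1 := by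
  rw [saw_F, sawf, abs_le]
  have h1 := Int.fract_nonneg x
  have h2 := Int.fract_lt_one x
  have h3 := Real.smoothTransition.nonneg (2 * Int.fract x - 1/2)
  have h4 := Real.smoothTransition.le_one (2 * Int.fract x - 1/2)
  constructor <;> linarith

lemma saw_id {v : ℝ} (h : |v| ≤ 1/4) : saw.F v = v := by
  rw [abs_le] at h
  rw [saw_F]
  rcases le_or_gt 0 v with h0 | h0
  · rw [Int.fract_eq_self.2 ⟨h0, by linarith⟩, sawf_lo h.2]
  · have : Int.fract v = v + 1 := by
      rw [Int.fract_eq_iff]; exact ⟨by linarith, by linarith, -1, by push_cast; ring⟩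
    rw [this, sawf_hi (by linarith)]; ring

def wf (v : ℝ) : ℝ := expNegInvGlue ((1/16)^2 - (v - 1/8)^2)

lemma wf_smooth : ContDiff ℝ (⊤ : ℕ∞) wf := by
  unfold wf
  exact expNegInvGlue.contDiff.comp (contDiff_const.sub ((contDiff_id.sub contDiff_const).pow 2))

lemma wf_lo {v : ℝ} (h : v ≤ 1/16) : wf v = 0 := expNegInvGlue.zero_of_nonpos (by nlinarith)
lemma wf_hi {v : ℝ} (h : 3/16 ≤ v) : wf v = 0 := expNegInvGlue.zero_of_nonpos (by nlinarith)
lemma wf_pos {v : ℝ} (h : 1/16 < v) (h' : v < 3/16) : 0 < wf v := expNegInvGlue.pos_of_pos (by nlinarith)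

def wt : SP := pz wf wf_smooth (1/2) (by norm_num) (fun x h1 h2 => by
  rw [wf_hi (by linarith), wf_lo (by linarith)])

lemma wt_F (x : ℝ) : wt.F x = wf (Int.fract x) := rfl

def We (η : ℝ) (h0 : 0 < η) (h1 : η ≤ 1) : SP := pz (fun x => wf (x / η))
  (wf_smooth.comp (contDiff_id.div_const η)) (1/2) (by norm_num) (fun x h2 h3 => by
  have : 1 ≤ 1 / η := by rw [le_div_iff₀ h0]; linarith
  rw [wf_hi, wf_lo]
  · rw [div_le_iff₀ h0]; linarith
  · rw [le_div_iff₀ h0]; linarith)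

variable {η : ℝ} (h0 : 0 < η) (h1 : η ≤ 1)

lemma We_F (x : ℝ) : (We η h0 h1).F x = wf (Int.fract x / η) := rfl

/-- the genericity building block -/
def Ag (K : ℝ) (M : ℕ) : PD := shY ((We η h0 h1).scale K) * shX ((saw.sc M).scale (-(4 * (1 - η)))) *
  shY (saw.scale (1 / (4 * M)))

lemma We_conj (u : ℝ) : (We η h0 h1).F (u - (1 - η) * saw.F u) = wt.F u := by
  set x := Int.fract u with hx
  have hx0 : 0 ≤ x := Int.fract_nonneg u
  have hx1 : x < 1 := Int.fract_lt_one u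
  have e1 : Int.fract (u - (1 - η) * saw.F u) = x - (1 - η) * sawf x := by
    have hS0 := Real.smoothTransition.nonneg (2 * x - 1/2)
    have hS1 := Real.smoothTransition.le_one (2 * x - 1/2)
    rw [Int.fract_eq_iff, saw_F]
    refine ⟨?_, ?_, ⌊u⌋, ?_⟩
    · rw [sawf]; nlinarith
    · rw [sawf]; nlinarith
    · rw [hx, Int.fract]; ring
  rw [We_F, wt_F, e1, ← hx]
  rcases le_or_gt x (1/4) with h | h
  · rw [sawf_lo h]; congr 1; field_simp; ring
  · rw [wf_hi (v := x) (by linarith), wf_hi]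
    have hS0 := Real.smoothTransition.nonneg (2 * x - 1/2)
    rw [le_div_iff₀ h0, sawf]; nlinarith

lemma Ag_f (K : ℝ) (M : ℕ) (p : ℝ × ℝ) : (Ag h0 h1 K M).f p =
    (p.1 - 4 * (1 - η) * saw.F (M * (p.2 + 1 / (4 * M) * saw.F p.1)), p.2 + 1 / (4 * M) * saw.F p.1 +
      K * (We η h0 h1).F (p.1 - 4 * (1 - η) * saw.F (M * (p.2 + 1 / (4 * M) * saw.F p.1)))) := by
  simp [Ag, PD.mul_f, shY, shX, SP.scale, SP.sc, sub_eq_add_neg]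

lemma Ag_zero (K : ℝ) (M : ℕ) (hM : 1 ≤ M) (u : ℝ) : (Ag h0 h1 K M).f (u, 0) =
    (u - (1 - η) * saw.F u, 1 / (4 * M) * saw.F u + K * wt.F u) := by
  have hM0 : (M:ℝ) ≠ 0 := by positivity
  rw [Ag_f]
  have e : (M:ℝ) * (0 + 1 / (4 * M) * saw.F u) = saw.F u / 4 := by field_simp; ring
  have e2 : saw.F (saw.F u / 4) = saw.F u / 4 := saw_id (by
    rw [abs_div]; norm_num; linarith [saw_bd u])
  have e3 : u - 4 * (1 - η) * (saw.F u / 4) = u - (1 - η) * saw.F u := by ring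
  simp only
  rw [e, e2, e3, We_conj, zero_add]

lemma Ag_snd (K : ℝ) (M : ℕ) (hM : 1 ≤ M) (u : ℝ) : ((Ag h0 h1 K M).t ((u : Ci), 0)).2 =
    ((1 / (4 * M) * saw.F u + K * wt.F u : ℝ) : Ci) := by
  have := PD.t_proj (Ag h0 h1 K M) (u, 0)
  rw [Ag_zero _ _ _ _ hM] at this
  simp only [torusProj, AddCircle.coe_zero] at this
  rw [this]

lemma Ag_00 (K : ℝ) (M : ℕ) (hM : 1 ≤ M) : (Ag h0 h1 K M).f (0, 0) = (0, 0) := by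
  rw [Ag_zero _ _ _ _ hM, saw_id (by norm_num), wt_F, wf_lo] <;> simp

/-- horizontal circles have full vertical projection -/
def Hit (A : PD) : Prop := ∀ y ζ : Ci, ∃ u : Ci, (A.t (u, y)).2 = ζ

lemma Ag_hit (K : ℝ) (M : ℕ) (hM : 1 ≤ M) (hK : 2 ≤ K * wf (1/8)) : Hit (Ag h0 h1 K M) := by
  intro y ζ
  obtain ⟨y0, rfl⟩ : ∃ y0 : ℝ, (y0 : Ci) = y := ⟨_, coe_rep y⟩
  obtain ⟨z0, rfl⟩ : ∃ z0 : ℝ, (z0 : Ci) = ζ := ⟨_, coe_rep ζ⟩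
  have hM1 : (1:ℝ) ≤ M := by exact_mod_cast hM
  set g : ℝ → ℝ := fun u => u - 4 * (1 - η) * saw.F (M * (y0 + 1 / (4 * M) * saw.F u)) with hg
  have hgc : Continuous g := by
    have h : ∀ s : SP, Continuous fun u => u - 4 * (1 - η) * s.F (M * (y0 + 1 / (4 * M) * s.F u)) := by
      intro s; fun_prop
    exact h saw
  have hb : ∀ u, |g u - u| ≤ 4 := fun u => by
    have := saw_bd (M * (y0 + 1 / (4 * M) * saw.F u))
    have e : g u - u = -(4 * (1 - η) * saw.F (M * (y0 + 1 / (4 * M) * saw.F u))) := by simp [hg]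
    rw [e, abs_neg, abs_mul, abs_of_nonneg (by linarith)]
    nlinarith [abs_nonneg (saw.F (M * (y0 + 1 / (4 * M) * saw.F u)))]
  have hgs : Function.Surjective g := by
    refine hgc.surjective ?_ ?_
    · refine tendsto_atTop_mono (fun u => ?_) (tendsto_atTop_add_const_right _ (-4) tendsto_id)
      have := (abs_le.1 (hb u)).1; simp only [id]; linarith
    · refine tendsto_atBot_mono (fun u => ?_) (tendsto_atBot_add_const_right _ 4 tendsto_id)
      have := (abs_le.1 (hb u)).2; simp only [id]; linarith
  obtain ⟨u1, hu1⟩ := hgs 0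
  obtain ⟨u2, hu2⟩ := hgs (η / 8)
  set Y : ℝ → ℝ := fun u => y0 + 1 / (4 * M) * saw.F u + K * (We η h0 h1).F (g u) with hY
  have hYc : Continuous Y := by
    have h : ∀ s s' : SP, Continuous fun u => y0 + 1 / (4 * M) * s.F u + K * s'.F (g u) := by
      intro s s'; fun_prop
    exact h _ _
  have hs : ∀ u, |1 / (4 * M) * saw.F u| ≤ 1/4 := fun u => by
    rw [abs_mul, abs_of_nonneg (by positivity), div_mul_eq_mul_div, one_mul, div_le_iff₀ (by positivity)]
    linarith [saw_bd u]
  have hd : Y u1 + 1 ≤ Y u2 := by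
    simp only [hY, hu1, hu2, We_F]
    rw [Int.fract_zero, Int.fract_eq_self.2 ⟨by linarith, by linarith⟩, zero_div, wf_lo (by norm_num)]
    have : η / 8 / η = 1 / 8 := by field_simp
    rw [this]
    have a1 := abs_le.1 (hs u1)
    have a2 := abs_le.1 (hs u2)
    linarith [a1.2, a2.1]
  -- integer translate of z0 in the range
  have hz : Y u1 ≤ z0 + ⌈Y u1 - z0⌉ ∧ z0 + ⌈Y u1 - z0⌉ ≤ Y u2 := by
    have c1 := Int.le_ceil (Y u1 - z0)
    have c2 := Int.ceil_lt_add_one (Y u1 - z0)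
    constructor <;> linarith
  obtain ⟨u, hu⟩ := mem_range_of_exists_le_of_exists_ge hYc ⟨u1, hz.1⟩ ⟨u2, hz.2⟩
  refine ⟨(u : Ci), ?_⟩
  have := PD.t_proj (Ag h0 h1 K M) (u, y0)
  rw [Ag_f] at this
  simp only [torusProj] at this
  rw [this]
  show ((Y u : ℝ) : Ci) = _
  rw [hu, AddCircle.coe_add, coe_int, add_zero]

lemma dense_q {A : PD} (hA : Hit A) (δ : ℝ) (hδ : 0 < δ) : ∀ᶠ q in atTop, ∀ (y : Ci) (ζ : Torus2),
    ∃ x : Ci, dist ((ql A q).t (x, y)) ζ < δ := by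
  obtain ⟨N, hN⟩ := exists_nat_gt (2 / δ)
  filter_upwards [qclose A (δ/2) (by linarith), eventually_ge_atTop N] with q hq hqN y ζ
  have hq0 : (0:ℝ) < q := by exact_mod_cast hq.1
  obtain ⟨u, hu⟩ := hA y ζ.2
  obtain ⟨a, ha⟩ : ∃ a : ℝ, (a : Ci) = u := ⟨_, coe_rep u⟩
  obtain ⟨b, hb⟩ : ∃ b : ℝ, (b : Ci) = ζ.1 := ⟨_, coe_rep _⟩
  set n : ℤ := ⌊q * b - a⌋
  have n1 := Int.floor_le (q * b - a)
  have n2 := Int.lt_floor_add_one (q * b - a)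
  refine ⟨(((a + n) / q : ℝ) : Ci), ?_⟩
  rw [Prod.dist_eq, max_lt_iff]
  constructor
  · have h1 := hq.2 ((((a + n) / q : ℝ) : Ci), y)
    have h2 : ‖(((a + n) / q : ℝ) : Ci) - ζ.1‖ < δ/2 := by
      rw [← hb, ← AddCircle.coe_sub]
      refine (nco _).trans_lt ?_
      have : (a + n) / q - b = -((q * b - a - n) / q) := by field_simp; ring
      rw [this, abs_neg, abs_of_nonneg (div_nonneg (by linarith) hq0.le), div_lt_iff₀ hq0]
      have h3 : 2 / δ < q := hN.trans_le (by exact_mod_cast hqN)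
      rw [div_lt_iff₀ hδ] at h3
      linarith
    rw [dist_eq_norm]
    calc _ = ‖(((ql A q).t ((((a + n) / q : ℝ) : Ci), y)).1 - (((a + n) / q : ℝ) : Ci)) +
        ((((a + n) / q : ℝ) : Ci) - ζ.1)‖ := by congr 1; abel
      _ < δ := (norm_add_le _ _).trans_lt (by linarith)
  · rw [ql_snd A q hq.1, Mq]
    simp only
    rw [nsmul_coe, mul_div_cancel₀ _ hq0.ne', AddCircle.coe_add, coe_int, add_zero, ha, hu, dist_self]
    exact hδ

lemma rot_dense {α : ℝ} (hα : Irrational α) (δ : ℝ) (hδ : 0 < δ) : ∃ N : ℕ, ∀ x y : Ci, ∃ i < N,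
    ‖x + ((i * α : ℝ) : Ci) - y‖ < δ := by
  have hc : ∀ x : Ci, ∃ i : ℕ, ‖((i * α : ℝ) : Ci) - x‖ < δ := by
    intro x
    have h1 : DenseRange (fun n : ℤ => n • ((α : ℝ) : Ci)) := by
      rw [AddCircle.denseRange_zsmul_coe_iff, div_one]; exact hα
    have h2 : MapClusterPt x atTop (fun m : ℕ => m • ((α : ℝ) : Ci)) := by
      rw [mapClusterPt_atTop_nsmul_iff_mem_topologicalClosure_zmultiples]
      exact h1 x
    obtain ⟨i, hi⟩ := (mapClusterPt_iff_frequently.1 h2 _ (Metric.ball_mem_nhds x hδ)).exists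
    refine ⟨i, ?_⟩
    rw [← nsmul_coe, ← dist_eq_norm]; exact hi
  obtain ⟨s, hs⟩ := isCompact_univ.elim_finite_subcover (fun i : ℕ => Metric.ball (((i * α : ℝ) : Ci)) δ)
    (fun i => Metric.isOpen_ball) (fun x _ => by
      obtain ⟨i, hi⟩ := hc x
      refine Set.mem_iUnion.2 ⟨i, ?_⟩
      rw [Metric.mem_ball, dist_comm, dist_eq_norm]; exact hi)
  refine ⟨s.sup id + 1, fun x y => ?_⟩
  have := hs (Set.mem_univ (y - x))
  simp only [Set.mem_iUnion, Metric.mem_ball] at this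
  obtain ⟨i, hi, h⟩ := this
  refine ⟨i, Nat.lt_succ_of_le (Finset.le_sup (f := id) hi), ?_⟩
  rw [dist_comm, dist_eq_norm] at h
  rwa [show x + ((i * α : ℝ) : Ci) - y = ((i * α : ℝ) : Ci) - (y - x) by abel]

lemma Tc_pow (H : PD) (s : ℝ) (n : ℕ) : (Tc H s) ^ n = Tc H (n * s) := by
  unfold Tc
  rw [← rot_pow]
  exact conj_pow

lemma Tc_iter (H : PD) (s : ℝ) (n : ℕ) (z : Torus2) : (Tc H s).t^[n] z = H.t ((rot (n * s)).t ((H⁻¹).t z)) := by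
  rw [← PD.pow_t, Tc_pow, Tc, PD.mul_t_apply, PD.mul_t_apply]

lemma dense_step {α : ℝ} (hα : Irrational α) (H : PD) {A : PD} (hA : Hit A) (ε : ℝ) (hε : 0 < ε) :
    ∀ᶠ q in atTop, ∃ N : ℕ, ∀ z ζ : Torus2, ∃ i < N, dist ((Tc (H * ql A q) α).t^[i] z) ζ < ε := by
  obtain ⟨δ1, hδ1, h1⟩ := Metric.uniformContinuous_iff.1
    (CompactSpace.uniformContinuous_of_continuous H.t_cont) ε hε
  filter_upwards [dense_q hA (δ1/2) (by linarith)] with q hq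
  obtain ⟨δ2, hδ2, h2⟩ := Metric.uniformContinuous_iff.1
    (CompactSpace.uniformContinuous_of_continuous (ql A q).t_cont) (δ1/2) (by linarith)
  obtain ⟨N, hN⟩ := rot_dense hα δ2 hδ2
  refine ⟨N, fun z ζ => ?_⟩
  set w := ((H * ql A q)⁻¹).t z
  obtain ⟨x, hx⟩ := hq w.2 ((H⁻¹).t ζ)
  obtain ⟨i, hi, hix⟩ := hN w.1 x
  refine ⟨i, hi, ?_⟩
  rw [Tc_iter, PD.mul_t_apply]
  have e : ζ = H.t ((H⁻¹).t ζ) := by rw [PD.t_inv_t]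
  rw [e]
  apply h1
  have h3 := h2 (a := (rot (i * α)).t w) (b := (x, w.2)) (by
    rw [rot_t, Prod.dist_eq]; simp [dist_eq_norm]
    simpa using hix)
  exact (dist_triangle _ _ _).trans_lt (by linarith)

end AK

namespace AK

attribute [local irreducible] PD.t

lemma dig_lt (ρ : ℕ) (y : Ci) : dig ρ y < 2^ρ := by
  unfold dig
  rw [Nat.floor_lt (by have := rep_nonneg y; positivity)]
  push_cast
  have := rep_lt y
  have h : (0:ℝ) < 2^ρ := by positivity
  nlinarith

lemma se_tendsto (ρ : ℕ) (B : ℕ → PD) (h : ∀ δ > 0, ∀ᶠ M in atTop, ∀ z, dist ((B M).t z) z < δ) :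
    Tendsto (fun M => se ρ (B M)) atTop (𝓝 0) := by
  have h1 : Tendsto (fun M => (⟨(B M).t, (B M).t_cont⟩ : C(Torus2, Torus2))) atTop (𝓝 (ContinuousMap.id _)) := by
    rw [ContinuousMap.tendsto_iff_tendstoUniformly, Metric.tendstoUniformly_iff]
    intro δ hδ
    filter_upwards [h δ hδ] with M hM z
    rw [dist_comm]; exact hM z
  have h2 : ∀ t, Tendsto (fun M => volume (symmDiff ((B M).t ⁻¹' St ρ t) (St ρ t))) atTop (𝓝 0) := by
    intro t
    have := tendsto_measure_symmDiff_preimage_nhds_zero (μ := volume) (ν := volume) h1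
      (Eventually.of_forall fun M => (B M).t_mp) (MeasurePreserving.id volume)
      (St_meas ρ t).nullMeasurableSet (measure_ne_top _ _)
    exact this
  have h3 : Tendsto (fun M => ∑ t ∈ Finset.range (2^ρ), volume (symmDiff ((B M).t ⁻¹' St ρ t) (St ρ t)))
      atTop (𝓝 0) := by
    have := tendsto_finsetSum (Finset.range (2^ρ)) (fun t _ => h2 t)
    simpa using this
  refine tendsto_of_tendsto_of_tendsto_of_le_of_le tendsto_const_nhds h3 (fun _ => bot_le) ?_
  intro M
  refine (measure_mono ?_).trans (measure_biUnion_finset_le _ _)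
  intro z hz
  simp only [Set.mem_iUnion]
  refine ⟨dig ρ z.2, by simp [dig_lt], Or.inr ⟨?_, ?_⟩⟩
  · simp [St, JJ]
  · simpa [St, JJ] using hz

lemma se_Ag (ρ : ℕ) {η : ℝ} (h0 : 0 < η) (h1 : η ≤ 1) (K : ℝ) : ∀ᶠ M in atTop,
    1 ≤ M ∧ se ρ (Ag h0 h1 K M) ≤ ENNReal.ofReal (2 * η) := by
  have hS : Tendsto (fun M : ℕ => se ρ (shY (saw.scale (1 / (4 * M))))) atTop (𝓝 0) := by
    apply se_tendsto
    intro δ hδ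
    obtain ⟨N, hN⟩ := exists_nat_gt (1 / δ)
    filter_upwards [eventually_ge_atTop (N+1)] with M hM z
    have hM0 : (0:ℝ) < M := by
      have : 0 < M := by omega
      exact_mod_cast this
    have hM2 : 1 / δ < M := hN.trans_le (by exact_mod_cast (by omega))
    rw [div_lt_iff₀ hδ] at hM2
    rw [shY_t, Prod.dist_eq]
    simp only [dist_self, dist_eq_norm, add_sub_cancel_left]
    rw [max_eq_right (norm_nonneg _)]
    refine (nco _).trans_lt ?_
    rw [SP.scale_c, SP.c_eq, abs_mul, abs_of_nonneg (by positivity), div_mul_eq_mul_div, one_mul,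
      div_lt_iff₀ (by positivity)]
    linarith [saw_bd (rep z.1)]
  have hW : se ρ (shY ((We η h0 h1).scale K)) ≤ ENNReal.ofReal η := by
    have : {z : Torus2 | dig ρ ((shY ((We η h0 h1).scale K)).t z).2 ≠ dig ρ z.2} ⊆
        Prod.fst ⁻¹' (rep ⁻¹' Set.Ioo 0 η) := by
      intro z hz
      by_contra hc
      apply hz
      have : (We η h0 h1).F (rep z.1) = 0 := by
        rw [We_F, Int.fract_eq_self.2 ⟨rep_nonneg _, rep_lt _⟩]
        by_cases h : rep z.1 / η ≤ 1/16
        · exact wf_lo h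
        · apply wf_hi
          by_contra h'
          apply hc
          push Not at h h'
          rw [lt_div_iff₀ h0] at h
          rw [div_lt_iff₀ h0] at h'
          exact ⟨by linarith, by linarith⟩
      rw [shY_t, SP.scale_c, SP.c_eq, this]; simp
    refine (measure_mono this).trans ?_
    rw [vol_fst, mp_rep.measure_preimage measurableSet_Ioo.nullMeasurableSet]
    refine (Measure.restrict_apply_le _ _).trans ?_
    rw [Real.volume_Ioo, sub_zero]
  have := hS.eventually_le_const (show (0:ℝ≥0∞) < ENNReal.ofReal η by simpa using h0)
  filter_upwards [this, eventually_ge_atTop 1] with M hM hM1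
  refine ⟨hM1, ?_⟩
  calc _ ≤ se ρ (shY ((We η h0 h1).scale K)) + 0 + se ρ (shY (saw.scale (1 / (4 * M)))) := by
        refine (se_mul _ _ _).trans ?_
        gcongr
        refine (se_mul _ _ _).trans ?_
        rw [se_shX]
    _ ≤ ENNReal.ofReal η + 0 + ENNReal.ofReal η := by gcongr
    _ = _ := by rw [add_zero, ← ENNReal.ofReal_add h0.le h0.le]; congr 1; ring

end AK

namespace AK

attribute [local irreducible] PD.t

lemma wf_deriv {x : ℝ} (h : 1/16 < x) (h' : x < 3/16) (hx : x ≠ 1/8) : deriv wf x ≠ 0 := by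
  set y := (1/16)^2 - (x - 1/8)^2 with hy
  have hy0 : 0 < y := by rw [hy]; nlinarith
  have h1 := expNegInvGlue.hasDerivAt_polynomial_eval_inv_mul 1 y
  simp only [Polynomial.eval_one, one_mul] at h1
  have h2 : HasDerivAt (fun x : ℝ => (1/16)^2 - (x - 1/8)^2) (-(2 * (x - 1/8))) x := by
    have := (((hasDerivAt_id x).sub_const (1/8)).pow 2).const_sub ((1/16 : ℝ)^2)
    simpa using this
  have h3 : HasDerivAt wf _ x := HasDerivAt.comp x h1 h2
  rw [h3.deriv]
  have := expNegInvGlue.pos_of_pos hy0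
  have hx' : x - 1/8 ≠ 0 := sub_ne_zero.2 hx
  simp
  exact ⟨⟨hy0.ne', hy0⟩, fun h => hx (by linarith)⟩

open Classical in
def gk (l : ℝ) (u : ℝ) : ℂ := if wt.F u = 0 then 0 else ex (l * wt.F u)
open Classical in
def zi (u : ℝ) : ℝ := if wt.F u = 0 then 1 else 0

lemma gk_norm (l u : ℝ) : ‖gk l u‖ ≤ 1 := by
  unfold gk; split_ifs <;> simp [ex_norm]

lemma wz_meas : MeasurableSet {u | wt.F u = 0} := by
  exact (isClosed_singleton.preimage wt.sm.continuous).measurableSet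

lemma gk_meas (l : ℝ) : Measurable (gk l) := by
  unfold gk
  refine Measurable.ite wz_meas measurable_const ?_
  exact (ex_cont.comp (continuous_const.mul wt.sm.continuous)).measurable

lemma zi_meas : Measurable zi := by
  unfold zi
  exact Measurable.ite wz_meas measurable_const measurable_const

lemma zi_01 (u : ℝ) : 0 ≤ zi u ∧ zi u ≤ 1 := by
  unfold zi; split_ifs <;> simp

lemma bdd_ii {f : ℝ → ℂ} (hf : Measurable f) {C : ℝ} (hb : ∀ u, ‖f u‖ ≤ C) (a b : ℝ) :
    IntervalIntegrable f volume a b := by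
  refine (intervalIntegrable_const (c := C)).mono_fun hf.aestronglyMeasurable
    (Eventually.of_forall fun u => ?_)
  simpa using (hb u).trans (le_abs_self C)

lemma bdd_ii' {f : ℝ → ℝ} (hf : Measurable f) {C : ℝ} (hb : ∀ u, ‖f u‖ ≤ C) (a b : ℝ) :
    IntervalIntegrable f volume a b := by
  refine (intervalIntegrable_const (c := C)).mono_fun hf.aestronglyMeasurable
    (Eventually.of_forall fun u => ?_)
  simpa using (hb u).trans (le_abs_self C)

lemma gk_ii (l a b : ℝ) : IntervalIntegrable (gk l) volume a b := bdd_ii (gk_meas l) (gk_norm l) a b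

lemma gk_per (l : ℝ) : Function.Periodic (gk l) 1 := fun u => by
  unfold gk; rw [wt.per]

lemma ex_gk (l u : ℝ) : ex (l * wt.F u) = (zi u : ℂ) + gk l u := by
  unfold gk zi
  split_ifs with h
  · rw [h]; simp [ex]
  · simp

lemma gk_pt (v : ℝ) (hv1 : v ≤ 1) (hv : 0 ≤ v) : Tendsto (fun l => ∫ u in (0:ℝ)..v, gk l u) (cocompact ℝ) (𝓝 0) := by
  classical
  set S : Set ℝ := Set.Ioc 0 v ∩ Set.Ioo (1/16) (3/16) with hS
  have hSm : MeasurableSet S := measurableSet_Ioc.inter measurableSet_Ioo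
  have hg : Integrable (S.indicator (fun _ => (1:ℂ))) volume := by
    rw [integrable_indicator_iff hSm]
    refine integrableOn_const ?_
    exact ((measure_mono Set.inter_subset_left).trans_lt (by simp)).ne
  have := RL (f := wf) (wf_smooth.of_le (by exact_mod_cast le_top)) hg (by
    have : ∀ᵐ x : ℝ, x ≠ 1/8 := by
      rw [ae_iff]; simp
    filter_upwards [this] with x hx h
    have hxS : x ∈ S := by
      by_contra hc; exact h (Set.indicator_of_notMem hc _)
    exact wf_deriv hxS.2.1 hxS.2.2 hx)
  refine this.congr (fun l => ?_)
  rw [intervalIntegral.integral_of_le hv, ← integral_indicator measurableSet_Ioc]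
  refine integral_congr_ae ?_
  have : ∀ᵐ x : ℝ, x ≠ 1 := by
    rw [ae_iff]; simp
  filter_upwards [this] with x hx1
  by_cases hx : x ∈ Set.Ioc 0 v
  · have hfr : Int.fract x = x := Int.fract_eq_self.2 ⟨hx.1.le, lt_of_le_of_ne (hx.2.trans hv1) hx1⟩
    rw [Set.indicator_of_mem hx]
    unfold gk
    rw [wt_F, hfr]
    by_cases hx2 : x ∈ Set.Ioo (1/16 : ℝ) (3/16)
    · rw [Set.indicator_of_mem (show x ∈ S from ⟨hx, hx2⟩), if_neg (wf_pos hx2.1 hx2.2).ne', one_mul]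
    · rw [Set.indicator_of_notMem (show x ∉ S from fun h => hx2 h.2), zero_mul, if_pos]
      by_cases h : x ≤ 1/16
      · exact wf_lo h
      · refine wf_hi ?_
        by_contra h'
        exact hx2 ⟨not_le.1 h, not_le.1 h'⟩
  · rw [Set.indicator_of_notMem hx, Set.indicator_of_notMem (fun h => hx h.1), zero_mul]

lemma gk_unif (ε : ℝ) (hε : 0 < ε) : ∀ᶠ l in cocompact ℝ, ∀ v, 0 ≤ v → v ≤ 1 → ‖∫ u in (0:ℝ)..v, gk l u‖ ≤ ε := by
  obtain ⟨n, hn⟩ := exists_nat_gt (2/ε)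
  have hn0 : (0:ℝ) < n := lt_trans (by positivity) hn
  have h1 : ∀ᶠ l in cocompact ℝ, ∀ j ∈ Finset.range (n+1), ‖∫ u in (0:ℝ)..(j/n : ℝ), gk l u‖ ≤ ε/2 := by
    rw [Finset.eventually_all]
    intro j hj
    have := gk_pt (j/n) (by rw [div_le_one hn0]; exact_mod_cast Nat.lt_succ_iff.1 (Finset.mem_range.1 hj)) (by positivity)
    have := (this.norm).eventually_le_const (show ‖(0:ℂ)‖ < ε/2 by simpa using hε)
    exact this
  filter_upwards [h1] with l hl v hv0 hv1
  set j := ⌊n * v⌋₊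
  have j1 : (j:ℝ) ≤ n * v := Nat.floor_le (by positivity)
  have j2 : n * v < j + 1 := Nat.lt_floor_add_one _
  have jn : j ≤ n := by
    have : (j:ℝ) ≤ n := j1.trans (by nlinarith)
    exact_mod_cast this
  have h2 := hl j (Finset.mem_range.2 (by omega))
  rw [← intervalIntegral.integral_add_adjacent_intervals (gk_ii l 0 (j/n)) (gk_ii l (j/n) v)]
  have h3 : ‖∫ u in (j/n:ℝ)..v, gk l u‖ ≤ 1 * |v - j/n| :=
    intervalIntegral.norm_integral_le_of_norm_le_const (fun x _ => gk_norm l x)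
  have h4 : |v - j/n| ≤ ε/2 := by
    have e : v - j/n = (n*v - j)/n := by field_simp
    rw [e, abs_of_nonneg (div_nonneg (by linarith) hn0.le), div_le_iff₀ hn0]
    rw [div_lt_iff₀ hε] at hn
    linarith
  refine (norm_add_le _ _).trans ?_
  linarith

lemma gk_main (ε : ℝ) (hε : 0 < ε) : ∀ᶠ l in cocompact ℝ, ∀ v, ‖∫ u in (0:ℝ)..v, gk l u‖ ≤ ε * |v| := by
  filter_upwards [gk_unif (ε/33) (by linarith)] with l hl v
  rcases le_or_gt |v| (1/16) with h | h
  · have : ∫ u in (0:ℝ)..v, gk l u = 0 := by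
      apply intervalIntegral.integral_zero_ae
      refine Eventually.of_forall fun u hu => ?_
      have hu' : |u| ≤ 1/16 := by
        rw [abs_le] at h ⊢
        rcases le_total 0 v with hv | hv
        · rw [Set.uIoc_of_le hv] at hu; constructor <;> linarith [hu.1, hu.2]
        · rw [Set.uIoc_of_ge hv] at hu; constructor <;> linarith [hu.1, hu.2]
      rw [abs_le] at hu'
      unfold gk
      rw [if_pos]
      rw [wt_F]
      rcases le_or_gt 0 u with h0 | h0
      · rw [Int.fract_eq_self.2 ⟨h0, by linarith⟩, wf_lo hu'.2]
      · have : Int.fract u = u + 1 := by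
          rw [Int.fract_eq_iff]; exact ⟨by linarith, by linarith, -1, by push_cast; ring⟩
        rw [this, wf_hi (by linarith)]
    rw [this, norm_zero]; positivity
  · set n := ⌊v⌋
    have e : v = n + Int.fract v := (Int.floor_add_fract v).symm
    have e1 : ∫ u in (0:ℝ)..v, gk l u = (n : ℂ) * (∫ u in (0:ℝ)..1, gk l u) + ∫ u in (0:ℝ)..Int.fract v, gk l u := by
      rw [← intervalIntegral.integral_add_adjacent_intervals (gk_ii l 0 n) (gk_ii l n v)]
      congr 1
      · have := (gk_per l).intervalIntegral_add_zsmul_eq n 0 (fun a b => gk_ii l a b)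
        simp at this
        exact this
      · have h2 : ∀ u, gk l (u + n) = gk l u := fun u => by
          have := (gk_per l).int_mul n u
          simpa using this
        have h3 := intervalIntegral.integral_comp_add_right (a := 0) (b := Int.fract v) (fun u => gk l u) (n:ℝ)
        simp only [h2] at h3
        rw [h3, zero_add]
        congr 1; linarith
    have hn : |(n:ℝ)| ≤ |v| + 1 := by
      have f0 := Int.fract_nonneg v
      have f1 := Int.fract_lt_one v
      have : (n:ℝ) = v - Int.fract v := by linarith
      rw [this]
      refine (abs_sub _ _).trans ?_
      rw [abs_of_nonneg f0]; linarith
    rw [e1]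
    refine (norm_add_le _ _).trans ?_
    rw [norm_mul]
    have h1 := hl 1 zero_le_one le_rfl
    have h2 := hl _ (Int.fract_nonneg v) (Int.fract_lt_one v).le
    have h3 : ‖(n:ℂ)‖ = |(n:ℝ)| := by rw [Complex.norm_intCast]
    rw [h3]
    calc _ ≤ (|v| + 1) * (ε/33) + ε/33 := by gcongr
      _ ≤ _ := by nlinarith

end AK

namespace AK

attribute [local irreducible] PD.t

lemma cintC {F : Ci → ℂ} (h : Continuous F) : Integrable F volume :=
  h.integrable_of_hasCompactSupport (HasCompactSupport.of_compactSpace F)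

/-- mean over the circle (`N = 0`) or along the rotation orbit of `0` up to time `N` -/
def mn (α : ℝ) (N : ℕ) (φ : Ci → ℂ) : ℂ :=
  if N = 0 then ∫ x, φ x else (N : ℂ)⁻¹ * ∑ i ∈ Finset.range N, φ ((i * α : ℝ) : Ci)

lemma mn_add (α : ℝ) (N : ℕ) {φ ψ : Ci → ℂ} (h : Continuous φ) (h' : Continuous ψ) :
    mn α N (fun x => φ x + ψ x) = mn α N φ + mn α N ψ := by
  unfold mn
  split_ifs
  · exact integral_add (cintC h) (cintC h')
  · rw [Finset.sum_add_distrib, mul_add]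

lemma mn_smul (α : ℝ) (N : ℕ) (c : ℂ) (φ : Ci → ℂ) :
    mn α N (fun x => c * φ x) = c * mn α N φ := by
  unfold mn
  split_ifs
  · exact integral_const_mul _ _
  · rw [← Finset.mul_sum]; ring

lemma avg_bd {E : Type*} [NormedAddCommGroup E] [NormedSpace ℂ E] (N : ℕ) (hN : N ≠ 0) (f : ℕ → E) (ε : ℝ)
    (h : ∀ i < N, ‖f i‖ ≤ ε) : ‖(N : ℂ)⁻¹ • ∑ i ∈ Finset.range N, f i‖ ≤ ε := by
  have hN' : (0:ℝ) < N := by positivity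
  rw [norm_smul, norm_inv, Complex.norm_natCast, inv_mul_le_iff₀ hN']
  refine (norm_sum_le_of_le _ (fun i hi => h i (Finset.mem_range.1 hi))).trans ?_
  simp

lemma mn_close (α : ℝ) (N : ℕ) {φ ψ : Ci → ℂ} (h : Continuous φ) (h' : Continuous ψ) {ε : ℝ}
    (hε : ∀ x, ‖φ x - ψ x‖ ≤ ε) : ‖mn α N φ - mn α N ψ‖ ≤ ε := by
  unfold mn
  split_ifs with hN
  · exact int_close (cintC h) (cintC h') hε
  · rw [← mul_sub, ← Finset.sum_sub_distrib]
    exact avg_bd N hN (fun i => φ ((i * α : ℝ) : Ci) - ψ ((i * α : ℝ) : Ci)) ε (fun i _ => hε _)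

def tg (κ : ℝ) (F : C(Torus2, ℂ)) : ℂ := κ * (∫ x : Ci, F (x, 0)) + (1 - κ) * ∫ z, F z

lemma z_cont (F : C(Torus2, ℂ)) : Continuous fun x : Ci => F (x, 0) := by fun_prop

lemma tg_add (κ : ℝ) (F G : C(Torus2, ℂ)) : tg κ (F + G) = tg κ F + tg κ G := by
  unfold tg
  simp only [ContinuousMap.add_apply]
  rw [integral_add (cintC (z_cont F)) (cintC (z_cont G)), integral_add (cint F.continuous) (cint G.continuous)]
  ring

lemma tg_smul (κ : ℝ) (c : ℂ) (F : C(Torus2, ℂ)) : tg κ (c • F) = c * tg κ F := by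
  unfold tg
  simp only [ContinuousMap.smul_apply, smul_eq_mul]
  rw [integral_const_mul, integral_const_mul]; ring

lemma conv_bd {κ : ℝ} (h0 : 0 ≤ κ) (h1 : κ ≤ 1) {a b : ℂ} {ε : ℝ} (ha : ‖a‖ ≤ ε) (hb : ‖b‖ ≤ ε) :
    ‖(κ:ℂ) * a + (1 - κ) * b‖ ≤ ε := by
  refine (norm_add_le _ _).trans ?_
  have e : (1 - (κ:ℂ)) = ((1 - κ : ℝ) : ℂ) := by push_cast; rfl
  rw [norm_mul, norm_mul, e, Complex.norm_real, Complex.norm_real, Real.norm_of_nonneg h0,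
    Real.norm_of_nonneg (by linarith)]
  calc _ ≤ κ * ε + (1 - κ) * ε := by
        have : 0 ≤ 1 - κ := by linarith
        gcongr
    _ = ε := by ring

lemma tg_close {κ : ℝ} (h0 : 0 ≤ κ) (h1 : κ ≤ 1) (F G : C(Torus2, ℂ)) {ε : ℝ} (h : ∀ z, ‖F z - G z‖ ≤ ε) :
    ‖tg κ F - tg κ G‖ ≤ ε := by
  have e : tg κ F - tg κ G = κ * ((∫ x : Ci, F (x, 0)) - ∫ x : Ci, G (x, 0)) +
      (1 - κ) * ((∫ z, F z) - ∫ z, G z) := by unfold tg; ring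
  rw [e]
  exact conv_bd h0 h1 (int_close (cintC (z_cont F)) (cintC (z_cont G)) (fun x => h _))
    (int_close (cint F.continuous) (cint G.continuous) h)

def kp (θ : ℝ) (N : ℕ) : ℝ := if N = 0 then ∫ u in (0:ℝ)..1, zi u else (N:ℝ)⁻¹ * ∫ s in (0:ℝ)..N, zi (θ * s)

lemma zi_ii (θ a b : ℝ) : IntervalIntegrable (fun s => zi (θ * s)) volume a b :=
  bdd_ii' (f := fun s => zi (θ * s)) (zi_meas.comp (measurable_const.mul measurable_id)) (C := 1)
    (fun u => by rw [Real.norm_of_nonneg (zi_01 _).1]; exact (zi_01 _).2) a b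
lemma zi_ii' (a b : ℝ) : IntervalIntegrable zi volume a b := by simpa using zi_ii 1 a b

lemma kp_01 (θ : ℝ) (N : ℕ) : 0 ≤ kp θ N ∧ kp θ N ≤ 1 := by
  unfold kp
  split_ifs with h
  · constructor
    · exact intervalIntegral.integral_nonneg zero_le_one (fun u _ => (zi_01 u).1)
    · have := intervalIntegral.integral_mono_on zero_le_one (zi_ii' 0 1) (intervalIntegrable_const (c := (1:ℝ)))
        (fun u _ => (zi_01 u).2)
      simpa using this
  · have hN : (0:ℝ) < N := by positivity
    constructor
    · exact mul_nonneg (by positivity) (intervalIntegral.integral_nonneg hN.le (fun u _ => (zi_01 _).1))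
    · rw [inv_mul_le_iff₀ hN]
      have := intervalIntegral.integral_mono_on hN.le (zi_ii θ 0 N) (intervalIntegrable_const (c := (1:ℝ)))
        (fun u _ => (zi_01 _).2)
      simpa using this

lemma kp_zero (θ : ℝ) : kp θ 0 ≤ 7/8 := by
  unfold kp
  rw [if_pos rfl]
  rw [← intervalIntegral.integral_add_adjacent_intervals (zi_ii' 0 (1/16)) (zi_ii' (1/16) 1),
    ← intervalIntegral.integral_add_adjacent_intervals (zi_ii' (1/16) (3/16)) (zi_ii' (3/16) 1)]
  have h1 := intervalIntegral.integral_mono_on (show (0:ℝ) ≤ 1/16 by norm_num) (zi_ii' 0 (1/16))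
    (intervalIntegrable_const (c := (1:ℝ))) (fun u _ => (zi_01 u).2)
  have h3 := intervalIntegral.integral_mono_on (show (3/16:ℝ) ≤ 1 by norm_num) (zi_ii' (3/16) 1)
    (intervalIntegrable_const (c := (1:ℝ))) (fun u _ => (zi_01 u).2)
  have h2 : ∫ u in (1/16:ℝ)..(3/16), zi u = 0 := by
    apply intervalIntegral.integral_zero_ae
    have : ∀ᵐ x : ℝ, x ≠ 3/16 := by
      rw [ae_iff]; simp
    filter_upwards [this] with x hx hxm
    rw [Set.uIoc_of_le (by norm_num)] at hxm
    have h4 := wf_pos hxm.1 (lt_of_le_of_ne hxm.2 hx)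
    unfold zi
    rw [if_neg]
    rw [wt_F, Int.fract_eq_self.2 ⟨by linarith [hxm.1], by linarith [hxm.2]⟩]
    exact h4.ne'
  rw [h2]
  simp only [intervalIntegral.integral_const, smul_eq_mul] at h1 h3
  linarith

variable {η : ℝ} (h0 : 0 < η) (h1 : η ≤ 1)

def Dv (α : ℝ) (K M q N : ℕ) (F : C(Torus2, ℂ)) : ℂ :=
  mn α N (fun x => F ((ql (Ag h0 h1 K M) q).t (x, 0))) - tg (kp (th α q) N) F

lemma Dv_add (α : ℝ) (K M q N : ℕ) (F G : C(Torus2, ℂ)) :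
    Dv h0 h1 α K M q N (F + G) = Dv h0 h1 α K M q N F + Dv h0 h1 α K M q N G := by
  unfold Dv
  simp only [ContinuousMap.add_apply]
  rw [tg_add, mn_add _ _ (by fun_prop) (by fun_prop)]; ring

lemma Dv_smul (α : ℝ) (K M q N : ℕ) (c : ℂ) (F : C(Torus2, ℂ)) :
    Dv h0 h1 α K M q N (c • F) = c * Dv h0 h1 α K M q N F := by
  unfold Dv
  simp only [ContinuousMap.smul_apply, smul_eq_mul]
  rw [tg_smul, mn_smul]; ring

lemma Dv_close (α : ℝ) (K M q N : ℕ) (F G : C(Torus2, ℂ)) (ε : ℝ) (h : ∀ z, ‖F z - G z‖ ≤ ε) :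
    ‖Dv h0 h1 α K M q N F - Dv h0 h1 α K M q N G‖ ≤ 2 * ε := by
  unfold Dv
  have e1 := mn_close α N (φ := fun x => F ((ql (Ag h0 h1 K M) q).t (x, 0)))
    (ψ := fun x => G ((ql (Ag h0 h1 K M) q).t (x, 0))) (by fun_prop) (by fun_prop) (ε := ε) (fun x => h _)
  have e2 := tg_close (kp_01 (th α q) N).1 (kp_01 (th α q) N).2 F G h
  rw [sub_sub_sub_comm]
  refine (norm_sub_le _ _).trans ?_
  linarith

def GenP (α : ℝ) (F : C(Torus2, ℂ)) : Prop := ∀ ε > 0, ∃ N0 : ℕ, ∀ᶠ K : ℕ in atTop, ∀ᶠ M : ℕ in atTop,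
  ∀ᶠ q : ℕ in LF α, ∀ N, (N = 0 ∨ N0 ≤ N) → ‖Dv h0 h1 α K M q N F‖ ≤ ε

theorem GenP_of_ch {α : ℝ} (hch : ∀ a b, GenP h0 h1 α (ch a b)) (F : C(Torus2, ℂ)) : GenP h0 h1 α F := by
  induction F using torus_induction with
  | hch a b => exact hch a b
  | hadd F G h h' =>
    intro ε hε
    obtain ⟨N1, e1⟩ := h (ε/2) (by linarith)
    obtain ⟨N2, e2⟩ := h' (ε/2) (by linarith)
    refine ⟨max N1 N2, ?_⟩
    filter_upwards [e1, e2] with K e1 e2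
    filter_upwards [e1, e2] with M e1 e2
    filter_upwards [e1, e2] with q e1 e2 N hN
    have f1 := e1 N (hN.imp id (fun h => (le_max_left _ _).trans h))
    have f2 := e2 N (hN.imp id (fun h => (le_max_right _ _).trans h))
    rw [Dv_add]
    refine (norm_add_le _ _).trans ?_
    linarith
  | hsmul c F h =>
    intro ε hε
    have hc : 0 < ‖c‖ + 1 := by positivity
    obtain ⟨N1, e1⟩ := h (ε/(‖c‖+1)) (by positivity)
    refine ⟨N1, ?_⟩
    filter_upwards [e1] with K e1
    filter_upwards [e1] with M e1
    filter_upwards [e1] with q e1 N hN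
    have := e1 N hN
    rw [le_div_iff₀ hc] at this
    rw [Dv_smul, norm_mul]
    nlinarith [norm_nonneg (Dv h0 h1 α K M q N F)]
  | hlim F h =>
    intro ε hε
    obtain ⟨G, hG, hd⟩ := h (ε/4) (by linarith)
    obtain ⟨N1, e1⟩ := hG (ε/2) (by linarith)
    refine ⟨N1, ?_⟩
    filter_upwards [e1] with K e1
    filter_upwards [e1] with M e1
    filter_upwards [e1] with q e1 N hN
    have f1 := e1 N hN
    have f2 := Dv_close h0 h1 α K M q N F G (ε/4) (fun z => (hd z).le)
    have : Dv h0 h1 α K M q N F = Dv h0 h1 α K M q N G + (Dv h0 h1 α K M q N F - Dv h0 h1 α K M q N G) := by ring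
    rw [this]
    refine (norm_add_le _ _).trans ?_
    linarith

end AK

namespace AK

attribute [local irreducible] PD.t

lemma int_zeroC {F : Ci → ℂ} (w : Ci) (c : ℂ) (hc : c ≠ 1)
    (h : ∀ z, F (z + w) = c * F z) : ∫ z, F z = 0 := by
  have h1 : ∫ z, F (z + w) = ∫ z, F z := integral_add_right_eq_self F w
  simp_rw [h] at h1
  rw [integral_const_mul] at h1
  by_contra hne
  exact hc (mul_right_cancel₀ hne (by rw [h1, one_mul]))

lemma q_th (α : ℝ) (q : ℕ) : q • ((α : ℝ) : Ci) = ((th α q : ℝ) : Ci) := by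
  rw [nsmul_coe, th, AddCircle.coe_sub, coe_int, sub_zero]

lemma q_th' (α : ℝ) (q i : ℕ) : q • ((i * α : ℝ) : Ci) = ((i * th α q : ℝ) : Ci) := by
  rw [← nsmul_coe i α, smul_comm, q_th, nsmul_coe]

lemma th_small (α δ : ℝ) (hδ : 0 < δ) : ∀ᶠ q in LF α, |th α q| < δ := by
  filter_upwards [LF_small α 1 0 δ hδ] with q hq
  simpa using hq

lemma abel_sum (g : ℂ) (h : ℕ → ℂ) (N : ℕ) : (g - 1) * ∑ i ∈ Finset.range N, g^i * h i =
    g^N * h N - h 0 - ∑ i ∈ Finset.range N, g^(i+1) * (h (i+1) - h i) := by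
  induction N with
  | zero => simp
  | succ n ih => rw [Finset.sum_range_succ, Finset.sum_range_succ, mul_add, ih]; ring

lemma fou_pow (a : ℤ) (α : ℝ) (i : ℕ) : (fourier a ((i * α : ℝ) : Ci) : ℂ) = fourier a ((α : ℝ) : Ci) ^ i := by
  induction i with
  | zero => simp
  | succ n ih =>
    rw [pow_succ, ← ih, ← fou_add, ← AddCircle.coe_add]
    congr 2; push_cast; ring

variable {η : ℝ} (h0 : 0 < η) (h1 : η ≤ 1)

lemma fou_irr {α : ℝ} (hα : Irrational α) {a : ℤ} (ha : a ≠ 0) : (fourier a ((α : ℝ) : Ci) : ℂ) ≠ 1 := by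
  rw [Ne, fou_eq_one, ← AddCircle.coe_zsmul, AddCircle.coe_eq_zero_iff]
  rintro ⟨n, hn⟩
  have h2 := hα.intCast_mul ha
  apply h2.ne_int n
  simpa using hn.symm

lemma GenP_ne {α : ℝ} (hα : Irrational α) {a : ℤ} (ha : a ≠ 0) (b : ℤ) : GenP h0 h1 α (ch a b) := by
  have hg1 := fou_irr hα ha
  set g : ℂ := fourier a ((α : ℝ) : Ci) with hg
  have hgn : ‖g‖ = 1 := fou_norm _ _
  have hd : 0 < ‖g - 1‖ := norm_pos_iff.2 (sub_ne_zero.2 hg1)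
  intro ε hε
  obtain ⟨N0, hN0⟩ := exists_nat_gt (2 / (ε/4 * ‖g - 1‖))
  refine ⟨N0 + 1, Eventually.of_forall fun K => Eventually.of_forall fun M => ?_⟩
  set A := Ag h0 h1 K M with hA
  set h : Ci → ℂ := fun x => fourier b (A.t (x, 0)).2 with hh
  have hc : Continuous h := by rw [hh]; fun_prop
  have hn : ∀ x, ‖h x‖ = 1 := fun x => fou_norm _ _
  obtain ⟨δ, hδ, hu⟩ := Metric.uniformContinuous_iff.1
    (CompactSpace.uniformContinuous_of_continuous hc) (ε/4 * ‖g - 1‖) (by positivity)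
  filter_upwards [th_small α δ hδ, LF_atTop α (qfou A a (ε/2) (by linarith)),
    LF_atTop α (eventually_ge_atTop (a.natAbs + 1))] with q hq1 hq2 hq3 N hN
  have hqa : ¬ (q : ℤ) ∣ a := by
    intro hdv
    have := Int.natAbs_dvd_natAbs.2 hdv
    have := Nat.le_of_dvd (Int.natAbs_pos.2 ha) this
    simp at this
    omega
  have t0 : ∀ κ : ℝ, tg κ (ch a b) = 0 := by
    intro κ
    have w1 : ∫ x : Ci, ch a b (x, 0) = 0 := by
      refine int_zeroC ((α : ℝ) : Ci) g hg1 (fun z => ?_)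
      rw [ch_apply, ch_apply]; simp only; rw [fou_add]; ring
    have w2 : ∫ z, ch a b z = 0 := by
      refine int_zero_of_translate (((α : ℝ) : Ci), 0) g hg1 (fun z => ?_)
      rw [ch_apply, ch_apply]; simp only [Prod.fst_add, Prod.snd_add, add_zero]; rw [fou_add]; ring
    unfold tg; rw [w1, w2]; simp
  unfold Dv
  rw [t0, sub_zero]
  have key : ‖mn α N (fun x => fourier a x * h (q • x))‖ ≤ ε/2 := by
    unfold mn
    split_ifs with hN'
    · rw [int_zeroC (((1 : ℝ) / q : ℝ) : Ci) (fourier a (((1 : ℝ) / q : ℝ) : Ci)) ?_ ?_]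
      · simp; linarith
      · rw [Ne, fou_eq_one]; exact inv_smul_ne q hq2.1 a hqa
      · intro z
        rw [smul_add, q_inv_smul q hq2.1, add_zero, fou_add]; ring
    · have hNN : N0 + 1 ≤ N := hN.resolve_left hN'
      have hNp : (0:ℝ) < N := by positivity
      have hs := abel_sum g (fun i => h (q • ((i * α : ℝ) : Ci))) N
      have e : ∀ i : ℕ, (fourier a ((i * α : ℝ) : Ci) : ℂ) * h (q • ((i * α : ℝ) : Ci)) =
          g^i * h (q • ((i * α : ℝ) : Ci)) := fun i => by rw [fou_pow]
      simp only [e]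
      set S := ∑ i ∈ Finset.range N, g^i * h (q • ((i * α : ℝ) : Ci)) with hS
      have hb : ‖(g - 1) * S‖ ≤ 2 + N * (ε/4 * ‖g-1‖) := by
        rw [hs]
        refine (norm_sub_le _ _).trans (add_le_add ?_ ?_)
        · refine (norm_sub_le _ _).trans ?_
          rw [norm_mul, norm_pow, hgn, hn, hn]; norm_num
        · refine (norm_sum_le_of_le _ (n := fun _ => ε/4 * ‖g-1‖) (fun i _ => ?_)).trans (by simp)
          rw [norm_mul, norm_pow, hgn, one_pow, one_mul, ← dist_eq_norm]
          refine (hu ?_).le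
          rw [dist_eq_norm, ← smul_sub, ← AddCircle.coe_sub]
          have : ((i + 1 : ℕ) * α - i * α : ℝ) = α := by push_cast; ring
          rw [this, q_th]
          exact (nco _).trans_lt hq1
      rw [norm_mul] at hb
      have h2 : 2 ≤ N * (ε/4 * ‖g-1‖) := by
        have : 2 / (ε/4 * ‖g - 1‖) < N := hN0.trans_le (by exact_mod_cast (by omega))
        rw [div_lt_iff₀ (by positivity)] at this
        exact this.le
      rw [norm_mul, norm_inv, Complex.norm_natCast, inv_mul_le_iff₀ hNp]
      have h3 : ‖g - 1‖ * ‖S‖ ≤ ‖g - 1‖ * (N * (ε/2)) := by nlinarith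
      exact le_of_mul_le_mul_left h3 hd
  have hcl := mn_close α N (φ := fun x => ch a b ((ql A q).t (x, 0)))
    (ψ := fun x => fourier a x * h (q • x)) (by fun_prop) (by
      have : Continuous fun x : Ci => q • x := continuous_const_smul q
      exact ((fourier (T := 1) a).continuous).mul (hc.comp this)) (ε := ε/2) (fun x => by
      rw [ch_apply, ql_snd A q hq2.1]
      show ‖fourier a ((ql A q).t (x, 0)).1 * h (q • x) - fourier a x * h (q • x)‖ ≤ _
      rw [← sub_mul, norm_mul]
      rw [hn, mul_one]
      exact hq2.2 (x, 0))
  have e3 := norm_le_norm_add_norm_sub' (mn α N (fun x => ch a b ((ql A q).t (x, 0)))) (mn α N (fun x => fourier a x * h (q • x)))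
  linarith

lemma GenP_00 (α : ℝ) : GenP h0 h1 α (ch 0 0) := by
  intro ε hε
  refine ⟨0, Eventually.of_forall fun K => Eventually.of_forall fun M => Eventually.of_forall fun q N _ => ?_⟩
  unfold Dv
  have e : ∀ z, ch 0 0 z = 1 := fun z => by rw [ch_apply]; simp
  simp only [tg, e]
  have : mn α N (fun _ => (1:ℂ)) = 1 := by
    unfold mn
    split_ifs with h
    · simp
    · have : (N:ℂ) ≠ 0 := by exact_mod_cast h
      simp [this]
  rw [this]
  simp; exact hε.le

lemma cmp_lem {h : ℝ → ℂ} (hc : Continuous h) {l e1 e2 : ℝ} (hb : ∀ u, ‖h u - ex (l * wt.F u)‖ ≤ e1)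
    (hg : ∀ v, ‖∫ u in (0:ℝ)..v, gk l u‖ ≤ e2 * |v|) (θ T : ℝ) (hT : 0 < T) :
    ‖(∫ s in (0:ℝ)..T, h (θ * s)) - ((∫ s in (0:ℝ)..T, zi (θ * s) : ℝ) : ℂ)‖ ≤ (e1 + e2) * T := by
  have hwc : Continuous fun s => ex (l * wt.F (θ * s)) :=
    ex_cont.comp (continuous_const.mul (wt.sm.continuous.comp (continuous_const.mul continuous_id)))
  have hhc : Continuous fun s => h (θ * s) := hc.comp (continuous_const.mul continuous_id)
  have i1 : IntervalIntegrable (fun s => ((zi (θ * s) : ℝ) : ℂ)) volume 0 T := by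
    refine bdd_ii (f := fun s => ((zi (θ * s) : ℝ) : ℂ)) (Complex.measurable_ofReal.comp
      (zi_meas.comp (measurable_const.mul measurable_id))) (C := 1) (fun u => ?_) _ _
    rw [Complex.norm_real, Real.norm_of_nonneg (zi_01 _).1]; exact (zi_01 _).2
  have i2 : IntervalIntegrable (fun s => gk l (θ * s)) volume 0 T :=
    bdd_ii (f := fun s => gk l (θ * s)) ((gk_meas l).comp (measurable_const.mul measurable_id)) (fun u => gk_norm l _) _ _
  have e3 : ∫ s in (0:ℝ)..T, ex (l * wt.F (θ * s)) = ((∫ s in (0:ℝ)..T, zi (θ * s) : ℝ) : ℂ) +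
      ∫ s in (0:ℝ)..T, gk l (θ * s) := by
    rw [← intervalIntegral.integral_ofReal, ← intervalIntegral.integral_add i1 i2]
    simp only [ex_gk]
  have e4 : ‖∫ s in (0:ℝ)..T, gk l (θ * s)‖ ≤ e2 * T := by
    by_cases hθ : θ = 0
    · have : gk l 0 = 0 := by
        unfold gk
        rw [if_pos]
        rw [wt_F, Int.fract_zero, wf_lo (by norm_num)]
      have h9 := (norm_nonneg _).trans (hg 1)
      rw [abs_one, mul_one] at h9
      simp only [hθ, zero_mul, this]; simp; positivity
    · rw [intervalIntegral.integral_comp_mul_left _ hθ, norm_smul, mul_zero]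
      have := hg (θ * T)
      rw [norm_inv, Real.norm_eq_abs, inv_mul_le_iff₀ (abs_pos.2 hθ)]
      rw [abs_mul, abs_of_pos hT] at this
      linarith
  have e5 : ‖(∫ s in (0:ℝ)..T, h (θ * s)) - ∫ s in (0:ℝ)..T, ex (l * wt.F (θ * s))‖ ≤ e1 * T := by
    rw [← intervalIntegral.integral_sub (hhc.intervalIntegrable _ _) (hwc.intervalIntegrable _ _)]
    refine (intervalIntegral.norm_integral_le_of_norm_le_const (C := e1) (fun s _ => hb _)).trans ?_
    rw [sub_zero, abs_of_pos hT]
  rw [e3] at e5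
  have : (∫ s in (0:ℝ)..T, h (θ * s)) - ((∫ s in (0:ℝ)..T, zi (θ * s) : ℝ) : ℂ) =
    ((∫ s in (0:ℝ)..T, h (θ * s)) - (((∫ s in (0:ℝ)..T, zi (θ * s) : ℝ) : ℂ) +
      ∫ s in (0:ℝ)..T, gk l (θ * s))) + ∫ s in (0:ℝ)..T, gk l (θ * s) := by ring
  rw [this]
  refine (norm_add_le _ _).trans ?_
  linarith

lemma cast_cocompact {b : ℤ} (hb : b ≠ 0) : Tendsto (fun K : ℕ => (b : ℝ) * K) atTop (cocompact ℝ) := by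
  rw [← Metric.cobounded_eq_cocompact, ← tendsto_norm_atTop_iff_cobounded]
  have hb' : 0 < |(b:ℝ)| := by positivity
  have : Tendsto (fun K : ℕ => |(b:ℝ)| * K) atTop atTop := tendsto_natCast_atTop_atTop.const_mul_atTop hb'
  refine this.congr (fun K => ?_)
  rw [norm_mul]; simp

lemma GenP_0b {α : ℝ} (hα : Irrational α) {b : ℤ} (hb : b ≠ 0) : GenP h0 h1 α (ch 0 b) := by
  intro ε hε
  refine ⟨0, ?_⟩
  filter_upwards [(cast_cocompact hb).eventually (gk_main (ε/4) (by linarith))] with K hK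
  -- continuity of ex at zero
  obtain ⟨d, hd, hde⟩ := Metric.continuousAt_iff.1 (ex_cont.continuousAt (x := 0)) (ε/4) (by linarith)
  have hex0 : ex 0 = 1 := by simp [ex]
  obtain ⟨M0, hM0⟩ := exists_nat_gt (|(b:ℝ)| / d)
  filter_upwards [eventually_ge_atTop (M0 + 1)] with M hM
  have hM1 : 1 ≤ M := by omega
  have hMp : (0:ℝ) < M := by exact_mod_cast hM1
  set A := Ag h0 h1 K M with hA
  set h : Ci → ℂ := fun x => fourier b (A.t (x, 0)).2 with hh
  have hc : Continuous h := by rw [hh]; fun_prop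
  have hu : ∀ u : ℝ, h (u : Ci) = ex (b * (1 / (4 * M) * saw.F u + K * wt.F u)) := fun u => by
    rw [hh]; simp only [hA]; rw [Ag_snd h0 h1 K M hM1, fou_coe]
  have hb1 : ∀ u : ℝ, ‖h (u : Ci) - ex (b * K * wt.F u)‖ ≤ ε/4 := fun u => by
    rw [hu]
    have : (b:ℝ) * (1 / (4 * M) * saw.F u + K * wt.F u) = b * (1 / (4 * M) * saw.F u) + b * K * wt.F u := by ring
    rw [this, ex_add, ← sub_one_mul, norm_mul, ex_norm, mul_one, ← hex0, ← dist_eq_norm]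
    refine (hde ?_).le
    rw [Real.dist_eq, sub_zero, abs_mul, abs_mul, abs_of_nonneg (show (0:ℝ) ≤ 1 / (4 * M) by positivity)]
    have h2 : |(b:ℝ)| / d < M := hM0.trans_le (by exact_mod_cast (by omega))
    rw [div_lt_iff₀ hd] at h2
    have h3 := saw_bd u
    calc |(b:ℝ)| * (1 / (4 * M) * |saw.F u|) ≤ |(b:ℝ)| * (1 / (4 * M) * 1) := by gcongr
      _ = |(b:ℝ)| / (4 * M) := by ring
      _ < d := by
        rw [div_lt_iff₀ (by positivity)]; nlinarith
  obtain ⟨δ, hδ, huc⟩ := Metric.uniformContinuous_iff.1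
    (CompactSpace.uniformContinuous_of_continuous hc) (ε/4) (by linarith)
  filter_upwards [th_small α δ hδ, LF_atTop α (eventually_ge_atTop 1)] with q hq1 hq2 N _
  have t0 : ∀ κ : ℝ, tg κ (ch 0 b) = κ := by
    intro κ
    have w1 : ∫ x : Ci, ch 0 b (x, 0) = 1 := by
      simp [ch_apply]
    have w2 : ∫ z, ch 0 b z = 0 := by
      refine int_zero_of_translate (0, ((α : ℝ) : Ci)) _ (fou_irr hα hb) (fun z => ?_)
      rw [ch_apply, ch_apply]; simp only [Prod.fst_add, Prod.snd_add, add_zero]; rw [fou_add]; ring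
    unfold tg; rw [w1, w2]; simp
  have hhc : Continuous fun u : ℝ => h (u : Ci) := hc.comp coe_cont
  have hcm := cmp_lem hhc (l := b * K) (e1 := ε/4) (e2 := ε/4) hb1 hK
  have hF : (fun x : Ci => ch 0 b ((ql A q).t (x, 0))) = fun x => h (q • x) := by
    funext x
    rw [ch_apply, ql_snd A q hq2]; simp [hh, Mq]
  unfold Dv
  rw [t0, ← hA, hF]
  unfold mn kp
  by_cases hN : N = 0
  · rw [if_pos hN, if_pos hN]
    have e1 : ∫ x : Ci, h (q • x) = ∫ x : Ci, h x := mp_int (mp_nsmul q hq2) hc.aestronglyMeasurable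
    have e2 := UnitAddCircle.intervalIntegral_preimage 0 h
    rw [zero_add] at e2
    rw [e1, ← e2]
    have := hcm 1 1 one_pos
    simp only [one_mul] at this
    linarith
  · rw [if_neg hN, if_neg hN]
    have hNp : (0:ℝ) < N := by positivity
    have hcm' := hcm (th α q) N hNp
    set θ := th α q with hθ
    have hθc : Continuous fun s : ℝ => h ((θ * s : ℝ) : Ci) := hhc.comp (continuous_const.mul continuous_id)
    have hs := intervalIntegral.sum_integral_adjacent_intervals (f := fun s : ℝ => h ((θ * s : ℝ) : Ci)) (μ := volume)
      (a := fun i : ℕ => (i:ℝ)) (n := N) (fun i _ => hθc.intervalIntegrable _ _)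
    simp only [Nat.cast_zero] at hs
    have e1 : ‖∑ i ∈ Finset.range N, h (q • ((i * α : ℝ) : Ci)) - ∫ s in (0:ℝ)..N, h ((θ * s : ℝ) : Ci)‖ ≤ ε/4 * N := by
      rw [← hs, ← Finset.sum_sub_distrib]
      refine (norm_sum_le_of_le _ (n := fun _ => ε/4) (fun i _ => ?_)).trans (by simp [mul_comm])
      have e2 : h (q • ((i * α : ℝ) : Ci)) = ∫ s in (i:ℝ)..((i+1 : ℕ) : ℝ), h (q • ((i * α : ℝ) : Ci)) := by
        simp
      rw [e2, ← intervalIntegral.integral_sub (by simp) (hθc.intervalIntegrable _ _)]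
      refine (intervalIntegral.norm_integral_le_of_norm_le_const (C := ε/4) (fun s hs => ?_)).trans ?_
      · rw [← dist_eq_norm]
        refine (huc ?_).le
        rw [dist_eq_norm, q_th', ← AddCircle.coe_sub]
        refine (nco _).trans_lt ?_
        rw [Set.uIoc_of_le (by simp)] at hs
        have e3 : i * θ - θ * s = - (θ * (s - i)) := by ring
        rw [← hθ, e3, abs_neg, abs_mul]
        have : |s - i| ≤ 1 := by
          have h5 := hs.2
          push_cast at h5
          rw [abs_le]; constructor <;> linarith [hs.1]
        nlinarith [abs_nonneg θ]
      · simp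
    have e5 : (N:ℂ)⁻¹ * ∑ i ∈ Finset.range N, h (q • ((i * α : ℝ) : Ci)) -
        (((N:ℝ)⁻¹ * ∫ s in (0:ℝ)..N, zi (θ * s) : ℝ) : ℂ) = (N:ℂ)⁻¹ *
        ((∑ i ∈ Finset.range N, h (q • ((i * α : ℝ) : Ci)) - ∫ s in (0:ℝ)..N, h ((θ * s : ℝ) : Ci)) +
        ((∫ s in (0:ℝ)..N, h ((θ * s : ℝ) : Ci)) - ((∫ s in (0:ℝ)..N, zi (θ * s) : ℝ) : ℂ))) := by
      push_cast; ring
    rw [e5, norm_mul, norm_inv, Complex.norm_natCast, inv_mul_le_iff₀ hNp]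
    refine (norm_add_le _ _).trans ?_
    nlinarith

theorem GenP_all {α : ℝ} (hα : Irrational α) (F : C(Torus2, ℂ)) : GenP h0 h1 α F := by
  refine GenP_of_ch h0 h1 (fun a b => ?_) F
  by_cases ha : a = 0
  · subst ha
    by_cases hb : b = 0
    · subst hb; exact GenP_00 h0 h1 α
    · exact GenP_0b h0 h1 hα hb
  · exact GenP_ne h0 h1 hα ha b

end AK

namespace AK

attribute [local irreducible] PD.t

def near (r : ℝ) (T T0 : PD) : Prop := ∀ z, dist (T.t z) (T0.t z) ≤ r

lemma dist_proj (p q : ℝ × ℝ) : dist (torusProj p) (torusProj q) ≤ ‖p - q‖ := by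
  rw [Prod.dist_eq, Prod.norm_def]
  simp only [torusProj, dist_eq_norm]
  rw [← AddCircle.coe_sub, ← AddCircle.coe_sub]
  exact max_le_max (nco _) (nco _)

lemma near_of_f {r : ℝ} {T T0 : PD} (h : ∀ p, ‖T.f p - T0.f p‖ ≤ r) : near r T T0 := by
  intro z
  obtain ⟨p, rfl⟩ := torusProj_surj z
  rw [PD.t_proj, PD.t_proj]
  exact (dist_proj _ _).trans (h p)

lemma Cl.near {α : ℝ} {n : ℕ} {ε : ℝ} {H H' : PD} (h : Cl α n ε H H') : near ε (Tc H' α) (Tc H α) := by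
  apply near_of_f
  intro p
  have := h.1 0 (Nat.zero_le _) p
  rwa [norm_iteratedFDeriv_zero] at this

lemma near.mono {r r' : ℝ} {T T0 : PD} (h : near r T T0) (hr : r ≤ r') : near r' T T0 := fun z => (h z).trans hr
lemma near.trans {r r' : ℝ} {T T1 T0 : PD} (h : near r T T1) (h' : near r' T1 T0) : near (r + r') T T0 :=
  fun z => (dist_triangle _ _ _).trans (add_le_add (h z) (h' z))

lemma ev_small {r0 : ℝ} (h : 0 < r0) : ∀ᶠ r in 𝓝[>] (0:ℝ), 0 < r ∧ r < r0 := Ioo_mem_nhdsGT h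

lemma iter_close (T0 : PD) (N : ℕ) : ∀ ε > 0, ∀ᶠ r in 𝓝[>] (0:ℝ), ∀ T, near r T T0 → ∀ i ≤ N, ∀ z,
    dist (T.t^[i] z) (T0.t^[i] z) < ε := by
  induction N with
  | zero =>
    intro ε hε
    refine Eventually.of_forall fun r T _ i hi z => ?_
    obtain rfl : i = 0 := by omega
    simpa using hε
  | succ N ih =>
    intro ε hε
    obtain ⟨δ, hδ, hu⟩ := Metric.uniformContinuous_iff.1
      (CompactSpace.uniformContinuous_of_continuous T0.t_cont) (ε/2) (by linarith)
    filter_upwards [ih δ hδ, ih ε hε, ev_small (show 0 < ε/2 by linarith)] with r h1 h2 h3 T hT i hi z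
    rcases Nat.lt_or_ge N i with h | h
    · obtain rfl : i = N + 1 := by omega
      rw [Function.iterate_succ_apply', Function.iterate_succ_apply']
      have e1 := hT (T.t^[N] z)
      have e2 := hu (h1 T hT N le_rfl z)
      exact (dist_triangle _ _ _).trans_lt (by linarith)
    · exact h2 T hT i h z

lemma dense_guard (T0 : PD) {ε : ℝ} (hε : 0 < ε) (N : ℕ) (h : ∀ z ζ : Torus2, ∃ i < N, dist (T0.t^[i] z) ζ < ε) :
    ∀ᶠ r in 𝓝[>] (0:ℝ), ∀ T, near r T T0 → ∀ z ζ : Torus2, ∃ i : ℕ, dist (T.t^[i] z) ζ < 2 * ε := by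
  filter_upwards [iter_close T0 N ε hε] with r hr T hT z ζ
  obtain ⟨i, hi, hd⟩ := h z ζ
  refine ⟨i, ?_⟩
  have := hr T hT i hi.le z
  exact (dist_triangle _ _ _).trans_lt (by linarith)

lemma gen_guard (T0 : PD) (N : ℕ) (F : C(Torus2, ℂ)) (x : Torus2) {ε : ℝ} (hε : 0 < ε) :
    ∀ᶠ r in 𝓝[>] (0:ℝ), ∀ T, near r T T0 → ∀ M ≤ N, M ≠ 0 →
      ‖(M:ℂ)⁻¹ * ∑ i ∈ Finset.range M, F (T.t^[i] x) - (M:ℂ)⁻¹ * ∑ i ∈ Finset.range M, F (T0.t^[i] x)‖ ≤ ε := by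
  obtain ⟨δ, hδ, hu⟩ := Metric.uniformContinuous_iff.1
      (CompactSpace.uniformContinuous_of_continuous F.continuous) ε hε
  filter_upwards [iter_close T0 N δ hδ] with r hr T hT M hM hM0
  rw [← mul_sub, ← Finset.sum_sub_distrib]
  refine avg_bd M hM0 (fun i => F (T.t^[i] x) - F (T0.t^[i] x)) ε (fun i hi => ?_)
  rw [← dist_eq_norm]
  exact (hu (hr T hT i (by omega) x)).le

lemma setdiff_bd {F : Torus2 → ℂ} (hF : Continuous F) {C : ℝ} (hC : ∀ z, ‖F z‖ ≤ C) {E E' : Set Torus2}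
    (hE : MeasurableSet E) (hE' : MeasurableSet E') :
    ‖(∫ z in E, F z) - ∫ z in E', F z‖ ≤ C * (volume (symmDiff E E')).toReal := by
  have hi := cint hF
  rw [← integral_inter_add_sdiff hE' hi.integrableOn, ← integral_inter_add_sdiff (s := E') hE hi.integrableOn,
    Set.inter_comm E' E]
  have e : ∀ a b c : ℂ, a + b - (a + c) = b - c := fun a b c => by ring
  rw [e]
  have b1 := norm_setIntegral_le_of_norm_le_const (μ := volume) (s := E \ E') (measure_lt_top _ _) (fun z _ => hC z)
  have b2 := norm_setIntegral_le_of_norm_le_const (μ := volume) (s := E' \ E) (measure_lt_top _ _) (fun z _ => hC z)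
  have : (volume (symmDiff E E')).toReal = volume.real (E \ E') + volume.real (E' \ E) := by
    rw [measureReal_def, measureReal_def, ← ENNReal.toReal_add (measure_ne_top _ _) (measure_ne_top _ _),
      ← measure_union _ (MeasurableSet.diff hE' hE)]
    · rfl
    · exact disjoint_sdiff_sdiff
  rw [this, mul_add]
  exact (norm_sub_le _ _).trans (add_le_add b1 b2)

def mixv (R : ℝ) (E : Set Torus2) (T : PD) (m : ℕ) (F G : C(Torus2, ℂ)) : ℂ :=
  (∫ z in E, F (T.t^[m] z) * G z) - R * (∫ z in E, F z) * ∫ z in E, G z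

lemma iter_cont (T : PD) (m : ℕ) : Continuous T.t^[m] := T.t_cont.iterate m

lemma mix_guard (R : ℝ) (hR : 0 ≤ R) (T0 : PD) (E0 : Set Torus2) (hE0 : MeasurableSet E0) (m : ℕ) (F G : C(Torus2, ℂ))
    {ε : ℝ} (hε : 0 < ε) (h : ‖mixv R E0 T0 m F G‖ ≤ ε) : ∀ᶠ r in 𝓝[>] (0:ℝ), ∀ T, near r T T0 → ∀ E, MeasurableSet E →
      volume (symmDiff E E0) ≤ ENNReal.ofReal r → ‖mixv R E T m F G‖ ≤ 2 * ε := by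
  obtain ⟨a, ha, hFa⟩ := ctm_bd F
  obtain ⟨b, hb, hGb⟩ := ctm_bd G
  obtain ⟨δ, hδ, hu⟩ := Metric.uniformContinuous_iff.1
      (CompactSpace.uniformContinuous_of_continuous F.continuous) (ε/(2*b)) (by positivity)
  have hr0 : 0 < ε / (2 * (a * b + 2 * R * a * b)) := by positivity
  filter_upwards [iter_close T0 m δ hδ, ev_small hr0] with r hr hr1 T hT E hE hv
  have hv' : (volume (symmDiff E E0)).toReal ≤ r := ENNReal.toReal_le_of_le_ofReal hr1.1.le hv
  have c1 : Continuous fun z => F (T.t^[m] z) * G z := by have := iter_cont T m; fun_prop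
  have c2 : Continuous fun z => F (T0.t^[m] z) * G z := by have := iter_cont T0 m; fun_prop
  have d1 : ‖(∫ z in E, F (T.t^[m] z) * G z) - ∫ z in E, F (T0.t^[m] z) * G z‖ ≤ ε/2 := by
    refine set_close c1 c2 (by linarith) (fun z => ?_)
    rw [← sub_mul, norm_mul]
    have e1 := (hu (hr T hT m le_rfl z)).le
    rw [dist_eq_norm] at e1
    calc _ ≤ ε/(2*b) * b := by gcongr; exact hGb z
      _ = ε/2 := by field_simp
  have d2 := setdiff_bd c2 (C := a * b) (fun z => by
    rw [norm_mul]; exact mul_le_mul (hFa _) (hGb _) (norm_nonneg _) ha.le) hE hE0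
  have d3 := setdiff_bd F.continuous hFa hE hE0
  have d4 := setdiff_bd G.continuous hGb hE hE0
  have f1 : ‖∫ z in E, G z‖ ≤ b := set_bd hb.le hGb
  have f2 : ‖∫ z in E0, F z‖ ≤ a := set_bd ha.le hFa
  have e : mixv R E T m F G = mixv R E0 T0 m F G +
      ((∫ z in E, F (T.t^[m] z) * G z) - ∫ z in E, F (T0.t^[m] z) * G z) +
      ((∫ z in E, F (T0.t^[m] z) * G z) - ∫ z in E0, F (T0.t^[m] z) * G z) -
      R * (((∫ z in E, F z) - ∫ z in E0, F z) * (∫ z in E, G z)) -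
      R * ((∫ z in E0, F z) * ((∫ z in E, G z) - ∫ z in E0, G z)) := by
    unfold mixv; ring
  rw [e]
  have nR : ‖(R:ℂ)‖ = R := by rw [Complex.norm_real, Real.norm_of_nonneg hR]
  have g1 : ‖(R:ℂ) * (((∫ z in E, F z) - ∫ z in E0, F z) * (∫ z in E, G z))‖ ≤ R * ((a * r) * b) := by
    have hr' := hr1.1
    rw [norm_mul, norm_mul, nR]
    exact mul_le_mul_of_nonneg_left (mul_le_mul (d3.trans (by gcongr)) f1 (norm_nonneg _) (by positivity)) hR
  have g2 : ‖(R:ℂ) * ((∫ z in E0, F z) * ((∫ z in E, G z) - ∫ z in E0, G z))‖ ≤ R * (a * (b * r)) := by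
    rw [norm_mul, norm_mul, nR]; gcongr
    exact d4.trans (by gcongr)
  have g3 : a * b * (volume (symmDiff E E0)).toReal ≤ a * b * r := by gcongr
  have hr2 := hr1.2
  rw [lt_div_iff₀ (by positivity)] at hr2
  refine (norm_sub_le _ _).trans ?_
  refine (add_le_add ((norm_sub_le _ _).trans (add_le_add ((norm_add_le _ _).trans (add_le_add (norm_add_le _ _) le_rfl)) le_rfl)) le_rfl).trans ?_
  nlinarith

lemma EE_int (ρ t : ℕ) (H : PD) {F : Torus2 → ℂ} : ∫ z in EE ρ t H, F z = ∫ w in St ρ t, F (H.t w) := by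
  have hinv : (H.t) ⁻¹' (EE ρ t H) = St ρ t := by
    ext w; simp [EE, PD.inv_t_t]
  have hem : MeasurableEmbedding H.t := by
    have : H.t = H.toEquiv := rfl
    exact (MeasurableEquiv.mk H.toEquiv H.t_cont.measurable (H⁻¹).t_cont.measurable).measurableEmbedding
  rw [← hinv]
  exact (H.t_mp.setIntegral_preimage_emb hem F _).symm

lemma mixv_Cor (ρ t m : ℕ) (α : ℝ) (H : PD) (F G : C(Torus2, ℂ)) :
    mixv (2^ρ) (EE ρ t H) (Tc H α) m F G = Cor ρ t H (m * α) F G := by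
  unfold mixv Cor
  rw [EE_int, EE_int, EE_int]
  simp only [Tc_iter, PD.inv_t_t]
  push_cast; rfl

end AK

namespace AK

attribute [local irreducible] PD.t

def ei (F : C(Torus2, ℂ)) (H : PD) : ℝ := ‖(∫ x : Ci, F (H.t (x, 0))) - ∫ z, F z‖

lemma gen_one {η : ℝ} (h0 : 0 < η) (h1 : η ≤ 1) {α : ℝ} (hα : Irrational α) (H : PD) (F : C(Torus2, ℂ)) {ε : ℝ} (hε : 0 < ε) :
    ∃ N0 : ℕ, ∀ᶠ K : ℕ in atTop, ∀ᶠ M : ℕ in atTop, ∀ᶠ q : ℕ in LF α,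
      (∀ N, N0 ≤ N → ‖mn α N (fun x => F ((H * ql (Ag h0 h1 K M) q).t (x, 0))) - ∫ z, F z‖ ≤ ei F H + ε) ∧
      ei F (H * ql (Ag h0 h1 K M) q) ≤ 7/8 * ei F H + ε := by
  obtain ⟨N0, h⟩ := GenP_all h0 h1 hα (F.comp ⟨H.t, H.t_cont⟩) ε hε
  refine ⟨N0, ?_⟩
  filter_upwards [h] with K hK
  filter_upwards [hK] with M hM
  filter_upwards [hM] with q hq
  have key : ∀ N, (N = 0 ∨ N0 ≤ N) → ‖mn α N (fun x => F ((H * ql (Ag h0 h1 K M) q).t (x, 0))) - ∫ z, F z‖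
      ≤ kp (th α q) N * ei F H + ε := by
    intro N hN
    have h2 := hq N hN
    have e : mn α N (fun x => F ((H * ql (Ag h0 h1 K M) q).t (x, 0))) - ∫ z, F z =
        kp (th α q) N * ((∫ x : Ci, F (H.t (x, 0))) - ∫ z, F z) + Dv h0 h1 α K M q N (F.comp ⟨H.t, H.t_cont⟩) := by
      have e1 : ∫ z, (F.comp ⟨H.t, H.t_cont⟩) z = ∫ z, F z := mp_int H.t_mp F.continuous.aestronglyMeasurable
      unfold Dv tg
      rw [e1]
      simp only [PD.mul_t_apply, ContinuousMap.comp_apply, ContinuousMap.coe_mk]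
      ring
    rw [e]
    refine (norm_add_le _ _).trans (add_le_add (le_of_eq ?_) h2)
    rw [norm_mul, Complex.norm_real, Real.norm_of_nonneg (kp_01 _ _).1]; rfl
  have hei : 0 ≤ ei F H := norm_nonneg _
  refine ⟨fun N hN => (key N (Or.inr hN)).trans ?_, ?_⟩
  · have := (kp_01 (th α q) N).2
    nlinarith
  · have k0 := key 0 (Or.inl rfl)
    have e : ei F (H * ql (Ag h0 h1 K M) q) = ‖mn α 0 (fun x => F ((H * ql (Ag h0 h1 K M) q).t (x, 0))) - ∫ z, F z‖ := by
      unfold ei mn; rw [if_pos rfl]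
    rw [e]
    refine k0.trans ?_
    have := kp_zero (th α q)
    nlinarith

theorem gen_step {α : ℝ} (hα : Liouville α) (ρ : ℕ) (H : PD) (fs : ℕ → C(Torus2, ℂ)) (n : ℕ) (ε : ℝ)
    (hε : 0 < ε) : ∃ N0 : ℕ, ∀ ε2 > 0, ∃ B : PD, B.f (0, 0) = (0, 0) ∧ Cl α n ε2 H (H * B) ∧ se ρ B ≤ ENNReal.ofReal ε ∧
      (∃ N, ∀ z ζ : Torus2, ∃ i < N, dist ((Tc (H * B) α).t^[i] z) ζ < ε) ∧
      (∀ i < n, ∀ N, N0 ≤ N → ‖mn α N (fun x => fs i ((H * B).t (x, 0))) - ∫ z, fs i z‖ ≤ ei (fs i) H + ε) ∧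
      (∀ i < n, ei (fs i) (H * B) ≤ 7/8 * ei (fs i) H + ε) := by
  have h0 : 0 < min (ε/2) 1 := by positivity
  have h1 : min (ε/2) 1 ≤ 1 := min_le_right _ _
  have hη : 2 * min (ε/2) 1 ≤ ε := by linarith [min_le_left (ε/2) 1]
  have hg := fun i => gen_one h0 h1 hα.irrational H (fs i) hε
  choose N0 hN0 using hg
  refine ⟨(Finset.range n).sup N0, fun ε2 hε2 => ?_⟩
  have hK : ∀ᶠ K : ℕ in atTop, ∀ i ∈ Finset.range n, ∀ᶠ M : ℕ in atTop, ∀ᶠ q : ℕ in LF α,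
      (∀ N, N0 i ≤ N → ‖mn α N (fun x => fs i ((H * ql (Ag h0 h1 K M) q).t (x, 0))) - ∫ z, fs i z‖ ≤ ei (fs i) H + ε) ∧
      ei (fs i) (H * ql (Ag h0 h1 K M) q) ≤ 7/8 * ei (fs i) H + ε :=
    (Finset.eventually_all _).2 fun i _ => hN0 i
  have hw : 0 < wf (1/8) := wf_pos (by norm_num) (by norm_num)
  obtain ⟨K, hK1, hK2⟩ := (hK.and (eventually_ge_atTop ⌈2 / wf (1/8)⌉₊)).exists
  have hK3 : 2 ≤ (K:ℝ) * wf (1/8) := by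
    rw [← div_le_iff₀ hw]; exact (Nat.le_ceil _).trans (by exact_mod_cast hK2)
  obtain ⟨M, hM1, hM2, hM3⟩ := (((Finset.eventually_all _).2 hK1).and (se_Ag ρ h0 h1 K)).exists
  have := LF_neBot hα
  obtain ⟨q, ⟨⟨hq1, hq2⟩, hq3⟩, hq4⟩ := (((((Finset.eventually_all _).2 hM1).and (close3 α H (Ag h0 h1 K M) n ε2 hε2)).and
    (LF_atTop α (dense_step hα.irrational H (Ag_hit h0 h1 K M hM2 hK3) ε hε))).and
    (LF_atTop α (eventually_ge_atTop 1))).exists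
  refine ⟨ql (Ag h0 h1 K M) q, ?_, hq2, ?_, hq3, ?_, ?_⟩
  · rw [ql_f _ _ hq4]
    simp [qf, Ag_00 h0 h1 K M hM2]
  · rw [se_ql _ _ _ hq4]
    exact hM3.trans (ENNReal.ofReal_le_ofReal hη)
  · intro i hi N hN
    exact (hq1 i (Finset.mem_range.2 hi)).1 N ((Finset.le_sup (Finset.mem_range.2 hi)).trans hN)
  · intro i hi
    exact (hq1 i (Finset.mem_range.2 hi)).2

end AK

namespace AK

attribute [local irreducible] PD.t

lemma Cl.mono {α : ℝ} {n : ℕ} {ε ε' : ℝ} {H H' : PD} (h : Cl α n ε H H') (he : ε ≤ ε') : Cl α n ε' H H' :=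
  ⟨fun k hk x => (h.1 k hk x).trans he, fun k hk x => (h.2 k hk x).trans he⟩

lemma Fix0.t {B : PD} (h : Fix0 B) (x : Ci) : B.t (x, 0) = (x, 0) := by
  have e : ((x, 0) : Torus2) = torusProj (rep x, 0) := by simp [torusProj, coe_rep]
  rw [e, PD.t_proj, h]

lemma t_zero {H : PD} (h : H.f (0, 0) = (0, 0)) : H.t (0, 0) = (0, 0) := by
  have e : ((0, 0) : Torus2) = torusProj (0, 0) := by simp [torusProj]
  rw [e, PD.t_proj, h]

lemma orb_zero {H : PD} (h : H.f (0, 0) = (0, 0)) (α : ℝ) (k : ℕ) :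
    (Tc H α).t^[k] (0, 0) = H.t (((k * α : ℝ) : Ci), 0) := by
  have e : (H⁻¹).t (0, 0) = (0, 0) := by
    have := PD.inv_t_t H (0, 0)
    rwa [t_zero h] at this
  rw [Tc_iter, e, rot_t]
  simp

structure Sg where
  H : PD
  N : ℕ
  r : ℝ
  h0 : H.f (0, 0) = (0, 0)
  hr : 0 < r

structure Rel (α : ℝ) (ρ : ℕ) (fs : ℕ → C(Torus2, ℂ)) (n : ℕ) (σ τ : Sg) : Prop where
  a : Cl α n (min ((1/2)^n) (σ.r/4)) σ.H τ.H
  b : ∀ t, volume (symmDiff (EE ρ t σ.H) (EE ρ t τ.H)) ≤ ENNReal.ofReal (min ((1/2)^n) (σ.r/4))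
  c : τ.r ≤ σ.r/2
  d : ∀ T, near τ.r T (Tc τ.H α) → ∀ z ζ : Torus2, ∃ i : ℕ, dist (T.t^[i] z) ζ < 2 * (1/2)^n
  e : ∃ m ≥ n, ∀ T, near τ.r T (Tc τ.H α) → ∀ t < 2^ρ, ∀ E, MeasurableSet E →
    volume (symmDiff E (EE ρ t τ.H)) ≤ ENNReal.ofReal τ.r → ∀ i < n, ∀ j < n,
    ‖mixv (2^ρ) E T m (fs i) (fs j)‖ ≤ 2 * (1/2)^n
  f : ∀ i < n, ei (fs i) τ.H ≤ 7/8 * ei (fs i) σ.H + (1/2)^n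
  g : ∀ i < n, ∀ N, τ.N ≤ N → ‖mn α N (fun x => fs i (τ.H.t (x, 0))) - ∫ z, fs i z‖ ≤ ei (fs i) σ.H + (1/2)^n
  h : σ.N < τ.N
  i : ∀ T, near τ.r T (Tc τ.H α) → ∀ N ≤ τ.N, N ≠ 0 → ∀ i < n,
    ‖(N:ℂ)⁻¹ * ∑ k ∈ Finset.range N, fs i (T.t^[k] (0, 0)) - mn α N (fun x => fs i (σ.H.t (x, 0)))‖ ≤ (1/2)^n

theorem step {α : ℝ} (hα : Liouville α) (ρ : ℕ) (fs : ℕ → C(Torus2, ℂ)) (n : ℕ) (σ : Sg) :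
    ∃ τ : Sg, Rel α ρ fs n σ τ := by
  have hσ := σ.hr
  obtain ⟨ε0, hε0⟩ : ∃ e, e = min ((1/2:ℝ)^n) (σ.r/4) := ⟨_, rfl⟩
  have p0 : 0 < ε0 := by rw [hε0]; positivity
  have p0n : ε0 ≤ (1/2)^n := by rw [hε0]; exact min_le_left _ _
  have pn : (0:ℝ) < (1/2)^n := by positivity
  obtain ⟨B1, F1, C1, S1, m, hm, M1⟩ := mix_step hα ρ σ.H fs n (ε0/2) (by linarith)
  have fixH : ∀ x : Ci, (σ.H * B1).t (x, 0) = σ.H.t (x, 0) := fun x => by rw [PD.mul_t_apply, F1.t]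
  have H10 : (σ.H * B1).f (0, 0) = (0, 0) := by
    rw [PD.mul_f]; simp only [Function.comp]; rw [F1, σ.h0]
  obtain ⟨H1, hH1⟩ : ∃ H1, H1 = σ.H * B1 := ⟨_, rfl⟩
  have D1 : ∀ t, volume (symmDiff (EE ρ t σ.H) (EE ρ t H1)) ≤ ENNReal.ofReal (ε0/2) := fun t => by
    rw [hH1]; exact (EE_diff ρ t σ.H B1).trans S1
  rw [← hH1] at fixH H10 C1 M1
  have eiH : ∀ F, ei F H1 = ei F σ.H := fun F => by unfold ei; simp only [fixH]
  have G1 : ∀ᶠ r in 𝓝[>] (0:ℝ), ∀ t ∈ Finset.range (2^ρ), ∀ i ∈ Finset.range n, ∀ j ∈ Finset.range n,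
      ∀ T, near r T (Tc H1 α) → ∀ E, MeasurableSet E →
      volume (symmDiff E (EE ρ t H1)) ≤ ENNReal.ofReal r → ‖mixv (2^ρ) E T m (fs i) (fs j)‖ ≤ 2 * (1/2)^n := by
    refine (Finset.eventually_all _).2 fun t ht => (Finset.eventually_all _).2 fun i hi =>
      (Finset.eventually_all _).2 fun j hj => ?_
    refine mix_guard (2^ρ) (by positivity) (Tc H1 α) (EE ρ t H1) (EE_meas _ _ _) m (fs i) (fs j) pn ?_
    rw [mixv_Cor]
    exact (M1 i (Finset.mem_range.1 hi) j (Finset.mem_range.1 hj) t (Finset.mem_range.1 ht)).trans (by linarith)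
  obtain ⟨r1, G1, r1p, -⟩ := (G1.and (ev_small one_pos)).exists
  have p3 : 0 < min (ε0/2) (r1/4) := by positivity
  obtain ⟨ε3, hε3⟩ : ∃ e, e = min (ε0/2) (r1/4) := ⟨_, rfl⟩
  have q3 : ε3 ≤ ε0/2 := by rw [hε3]; exact min_le_left _ _
  have q3' : ε3 ≤ r1/4 := by rw [hε3]; exact min_le_right _ _
  rw [← hε3] at p3
  obtain ⟨N0, hN0⟩ := gen_step hα ρ H1 fs n ε3 p3
  have G2 : ∀ᶠ r in 𝓝[>] (0:ℝ), ∀ i ∈ Finset.range n, ∀ T, near r T (Tc H1 α) → ∀ M ≤ max N0 (σ.N + 1), M ≠ 0 →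
      ‖(M:ℂ)⁻¹ * ∑ k ∈ Finset.range M, fs i (T.t^[k] (0,0)) -
        (M:ℂ)⁻¹ * ∑ k ∈ Finset.range M, fs i ((Tc H1 α).t^[k] (0,0))‖ ≤ (1/2)^n :=
    (Finset.eventually_all _).2 fun i _ => gen_guard _ _ _ _ pn
  obtain ⟨r2, G2, r2p, -⟩ := (G2.and (ev_small one_pos)).exists
  obtain ⟨B2, B20, C2, S2, ⟨N3, dn⟩, gg, ff⟩ := hN0 (min ε3 (r2/4)) (by positivity)
  obtain ⟨H2, hH2⟩ : ∃ H2, H2 = H1 * B2 := ⟨_, rfl⟩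
  have D2 : ∀ t, volume (symmDiff (EE ρ t H1) (EE ρ t H2)) ≤ ENNReal.ofReal ε3 := fun t => by
    rw [hH2]; exact (EE_diff ρ t H1 B2).trans S2
  have H20 : H2.f (0, 0) = (0, 0) := by
    rw [hH2, PD.mul_f]; simp only [Function.comp]; rw [B20, H10]
  rw [← hH2] at C2 dn gg ff
  obtain ⟨r3, G3, r3p, -⟩ := ((dense_guard _ p3 N3 dn).and (ev_small one_pos)).exists
  have hnear := C2.near
  have hr1 : min ε3 (r2/4) ≤ r1/4 := (min_le_left _ _).trans q3'
  have hr2 : min ε3 (r2/4) ≤ r2/4 := min_le_right _ _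
  obtain ⟨r4, hr4⟩ : ∃ r, r = min (min (r1/4) (r2/4)) (min r3 (σ.r/2)) := ⟨_, rfl⟩
  have r4p : 0 < r4 := by rw [hr4]; positivity
  have k1 : r4 ≤ r1/4 := by rw [hr4]; exact (min_le_left _ _).trans (min_le_left _ _)
  have k2 : r4 ≤ r2/4 := by rw [hr4]; exact (min_le_left _ _).trans (min_le_right _ _)
  have k3 : r4 ≤ r3 := by rw [hr4]; exact (min_le_right _ _).trans (min_le_left _ _)
  have k4 : r4 ≤ σ.r/2 := by rw [hr4]; exact (min_le_right _ _).trans (min_le_right _ _)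
  refine ⟨⟨H2, max N0 (σ.N + 1), r4, H20, r4p⟩, ?_, ?_, k4, ?_, ⟨m, hm, ?_⟩, ?_, ?_, ?_, ?_⟩
  · rw [← hε0]
    exact (C1.trans C2).mono (by linarith [min_le_left ε3 (r2/4)])
  · intro t
    rw [← hε0]
    refine (measure_symmDiff_le _ _ _).trans ((add_le_add (D1 t) (D2 t)).trans ?_)
    rw [← ENNReal.ofReal_add (by linarith) p3.le]
    exact ENNReal.ofReal_le_ofReal (by linarith)
  · intro T hT z ζ
    obtain ⟨i, hi⟩ := G3 T (hT.mono k3) z ζ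
    exact ⟨i, hi.trans_le (by linarith)⟩
  · intro T hT t ht E hE hv i hi j hj
    refine G1 t (Finset.mem_range.2 ht) i (Finset.mem_range.2 hi) j (Finset.mem_range.2 hj) T
      ((hT.trans hnear).mono (by simp only; linarith)) E hE ?_
    have D2' := D2 t
    rw [symmDiff_comm] at D2'
    refine (measure_symmDiff_le _ _ _).trans ((add_le_add hv D2').trans ?_)
    simp only
    rw [← ENNReal.ofReal_add (by linarith) p3.le]
    exact ENNReal.ofReal_le_ofReal (by linarith)
  · intro i hi
    have := ff i hi
    rw [eiH] at this
    simp only; linarith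
  · intro i hi N hN
    have := gg i hi N ((le_max_left _ _).trans hN)
    rw [eiH] at this
    simp only; linarith
  · exact lt_of_lt_of_le (Nat.lt_succ_self _) (le_max_right _ _)
  · intro T hT N hN hN0 i hi
    have := G2 i (Finset.mem_range.2 hi) T ((hT.trans hnear).mono (by simp only; linarith)) N hN hN0
    simp only [orb_zero H10, fixH] at this
    unfold mn; rw [if_neg hN0]
    exact this

theorem seq {α : ℝ} (hα : Liouville α) (ρ : ℕ) (fs : ℕ → C(Torus2, ℂ)) :
    ∃ σ : ℕ → Sg, ∀ n, Rel α ρ fs n (σ n) (σ (n+1)) := by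
  choose nx hnx using fun n σ => step hα ρ fs n σ
  have s0 : Sg := ⟨1, 0, 1, by rw [PD.one_f]; rfl, one_pos⟩
  exact ⟨fun n => Nat.rec (motive := fun _ => Sg) s0 (fun n σ => nx n σ) n, fun n => hnx n _⟩

end AK

namespace AK

lemma smooth_lim (F : ℕ → E2 → E2) (hF : ∀ n, ContDiff ℝ (⊤ : ℕ∞) (F n)) (he : ∀ n, IntEquivariant (F n))
    (h : ∀ n, ∀ k ≤ n, ∀ x, ‖iteratedFDeriv ℝ k (fun p => F (n+1) p - F n p) x‖ ≤ (1/2)^n) :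
    ∃ G : E2 → E2, ContDiff ℝ (⊤ : ℕ∞) G ∧ IntEquivariant G ∧ (∀ p, Tendsto (fun n => F n p) atTop (𝓝 (G p))) ∧
      TendstoUniformly F G atTop ∧
      ∀ j, TendstoUniformly (fun n => iteratedFDeriv ℝ j (F n)) (iteratedFDeriv ℝ j G) atTop := by
  choose C hC0 hC using fun k n => diff_bdd (hF (n+1)) (he (n+1)) (hF n) (he n) k
  let D : ℕ → E2 → E2 := fun n p => F (n+1) p - F n p
  have hD : ∀ n, ContDiff ℝ (⊤ : ℕ∞) (D n) := fun n => (hF (n+1)).sub (hF n)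
  let u : ℕ → ℕ → ℝ := fun k n => if k ≤ n then (1/2)^n else C k n
  have hu : ∀ k, Summable (u k) := by
    intro k
    refine (summable_nat_add_iff k).1 ?_
    have : (fun n => u k (n + k)) = fun n => (1/2:ℝ)^(n+k) := by
      ext n; simp [u]
    rw [this]
    exact (summable_nat_add_iff k).2 summable_geometric_two
  have hb : ∀ k n x, ‖iteratedFDeriv ℝ k (D n) x‖ ≤ u k n := by
    intro k n x
    simp only [u]
    split_ifs with hk
    · exact h n k hk x
    · exact hC k n x
  have hsum : ∀ n p, F n p = F 0 p + ∑ i ∈ Finset.range n, D i p := by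
    intro n p
    rw [Finset.sum_range_sub (fun i => F i p)]; abel
  have hb0 : ∀ n x, ‖D n x‖ ≤ u 0 n := fun n x => by
    have := hb 0 n x; rwa [norm_iteratedFDeriv_zero] at this
  have hT : ContDiff ℝ (⊤ : ℕ∞) fun p => ∑' n, D n p :=
    contDiff_tsum (N := ⊤) hD (fun k _ => hu k) (fun k n x _ => hb k n x)
  have hG : TendstoUniformly F (fun p => F 0 p + ∑' n, D n p) atTop := by
    have t1 := tendstoUniformly_tsum_nat (hu 0) hb0
    rw [Metric.tendstoUniformly_iff] at t1 ⊢
    intro ε hε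
    filter_upwards [t1 ε hε] with n hn x
    rw [hsum n x, dist_add_left]
    exact hn x
  refine ⟨fun p => F 0 p + ∑' n, D n p, (hF 0).add hT, ?_, fun p => hG.tendsto_at p, hG, ?_⟩
  · intro p m
    have : ∀ n, D n (p + ((m.1:ℝ), (m.2:ℝ))) = D n p := fun n => by
      simp only [D]; rw [he, he]; abel
    simp only [this]
    rw [he]; abel
  · intro j
    have t1 := tendstoUniformly_tsum_nat (hu j) (hb j)
    rw [Metric.tendstoUniformly_iff] at t1 ⊢
    intro ε hε
    filter_upwards [t1 ε hε] with n hn x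
    have e1 : iteratedFDeriv ℝ j (F n) x = iteratedFDeriv ℝ j (F 0) x + ∑ i ∈ Finset.range n, iteratedFDeriv ℝ j (D i) x := by
      have : F n = F 0 + fun p => ∑ i ∈ Finset.range n, D i p := by ext1 p; exact hsum n p
      rw [this, iteratedFDeriv_add ((hF 0).of_le (le_top' j)) ((ContDiff.sum fun i _ => hD i).of_le (le_top' j)),
        iteratedFDeriv_sum fun i _ => (hD i).of_le (le_top' j)]
      simp
    have e2 : iteratedFDeriv ℝ j (fun p => F 0 p + ∑' n, D n p) x =
        iteratedFDeriv ℝ j (F 0) x + ∑' i, iteratedFDeriv ℝ j (D i) x := by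
      have : (fun p => F 0 p + ∑' n, D n p) = F 0 + fun p => ∑' n, D n p := rfl
      rw [this, iteratedFDeriv_add ((hF 0).of_le (le_top' j)) (hT.of_le (le_top' j)),
        iteratedFDeriv_tsum (N := ⊤) hD (fun k _ => hu k) (fun k n x _ => hb k n x) le_top]
      rfl
    rw [e1, e2, dist_add_left]
    exact hn x

lemma PD_lim (T : ℕ → PD) (hf : ∀ n, ∀ k ≤ n, ∀ x, ‖iteratedFDeriv ℝ k (fun p => (T (n+1)).f p - (T n).f p) x‖ ≤ (1/2)^n)
    (hg : ∀ n, ∀ k ≤ n, ∀ x, ‖iteratedFDeriv ℝ k (fun p => (T (n+1)).g p - (T n).g p) x‖ ≤ (1/2)^n) :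
    ∃ S : PD, (∀ j, TendstoUniformly (fun n => iteratedFDeriv ℝ j (T n).f) (iteratedFDeriv ℝ j S.f) atTop) ∧
      (∀ j, TendstoUniformly (fun n => iteratedFDeriv ℝ j (T n).g) (iteratedFDeriv ℝ j S.g) atTop) ∧
      ∀ z, Tendsto (fun n => (T n).t z) atTop (𝓝 (S.t z)) := by
  obtain ⟨f, f1, f2, f3, f4, f5⟩ := smooth_lim (fun n => (T n).f) (fun n => (T n).cf) (fun n => (T n).ef) hf
  obtain ⟨g, g1, g2, g3, g4, g5⟩ := smooth_lim (fun n => (T n).g) (fun n => (T n).cg) (fun n => (T n).eg) hg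
  have ht : ∀ z, Tendsto (fun n => (T n).t z) atTop (𝓝 (tor f z)) := by
    intro z
    obtain ⟨p, rfl⟩ := torusProj_surj z
    rw [tor_proj f2]
    simp only [PD.t_proj]
    exact (torusProj_cont.tendsto _).comp (f3 p)
  refine ⟨⟨f, g, f1, g1, f2, g2, fun p => ?_, fun p => ?_, ?_⟩, f5, g5, ht⟩
  · have := f4.tendsto_comp (f1.continuous.continuousAt (x := g p)) (g3 p)
    simp only [PD.fg] at this
    exact tendsto_nhds_unique this tendsto_const_nhds
  · have := g4.tendsto_comp (g1.continuous.continuousAt (x := f p)) (f3 p)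
    simp only [PD.gf] at this
    exact tendsto_nhds_unique this tendsto_const_nhds
  · apply mp_of_char (tor_cont f2 f1.continuous)
    intro a b
    obtain ⟨M, hM, hb⟩ := ctm_bd (ch a b)
    have := tendsto_integral_of_dominated_convergence (μ := (volume : Measure Torus2)) (F := fun n z => ch a b ((T n).t z))
      (f := fun z => ch a b (tor f z)) (fun _ => M)
      (fun n => ((ch a b).continuous.comp (T n).t_cont).aestronglyMeasurable) (integrable_const _)
      (fun n => ae_of_all _ fun z => hb _) (ae_of_all _ fun z => ((ch a b).continuous.tendsto _).comp (ht z))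
    have e : ∀ n, ∫ z, ch a b ((T n).t z) = ∫ z, ch a b z := fun n =>
      mp_int (T n).t_mp (ch a b).continuous.aestronglyMeasurable
    simp only [e] at this
    exact tendsto_nhds_unique this tendsto_const_nhds

end AK

namespace AK

attribute [local irreducible] PD.t

variable {α : ℝ} {ρ : ℕ} {fs : ℕ → C(Torus2, ℂ)} {σ : ℕ → Sg} (hR : ∀ n, Rel α ρ fs n (σ n) (σ (n+1)))
  {S : PD} (hS : ∀ z, Tendsto (fun n => (Tc (σ n).H α).t z) atTop (𝓝 (S.t z)))

include hR in
lemma near_add (k : ℕ) : ∀ n, near (σ n).r (Tc (σ (n+k)).H α) (Tc (σ n).H α) := by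
  induction k with
  | zero => intro n z; simpa using (σ n).hr.le
  | succ k ih =>
    intro n
    have h1 := ih (n+1)
    have h2 := (hR n).a.near
    have e : n + 1 + k = n + (k + 1) := by ring
    rw [e] at h1
    refine (h1.trans h2).mono ?_
    have := (hR n).c
    have := (σ n).hr
    have := min_le_right ((1/2:ℝ)^n) ((σ n).r/4)
    linarith

include hR hS in
lemma near_S (n : ℕ) : near (σ n).r S (Tc (σ n).H α) := by
  intro z
  refine le_of_tendsto (((hS z).comp (tendsto_add_atTop_nat n)).dist tendsto_const_nhds) (Eventually.of_forall fun k => ?_)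
  have := near_add hR k n z
  rwa [add_comm n k] at this

include hR hS in
lemma S_min : IsMinimalMap S.t := by
  intro x
  rw [Metric.dense_iff]
  intro ζ ε hε
  obtain ⟨n, hn⟩ := exists_pow_lt_of_lt_one (show 0 < ε/2 by linarith) (show (1/2:ℝ) < 1 by norm_num)
  obtain ⟨i, hi⟩ := (hR n).d S (near_S hR hS (n+1)) x ζ
  exact ⟨S.t^[i] x, by rw [Metric.mem_ball]; linarith, i, rfl⟩

lemma contr_zero {e : ℕ → ℝ} (h0 : ∀ n, 0 ≤ e n) (n0 : ℕ) (h : ∀ n ≥ n0, e (n+1) ≤ 7/8 * e n + (1/2)^n) :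
    Tendsto e atTop (𝓝 0) := by
  rw [← tendsto_add_atTop_iff_nat n0]
  have key : ∀ k, e (k + n0) + 8/3 * (1/2)^k ≤ (7/8)^k * (e n0 + 8/3) := by
    intro k
    induction k with
    | zero => simp
    | succ k ih =>
      have h1 := h (k + n0) (by omega)
      have h2 : (1/2:ℝ)^(k+n0) ≤ (1/2)^k := pow_le_pow_of_le_one (by norm_num) (by norm_num) (by omega)
      have e1 : k + 1 + n0 = k + n0 + 1 := by ring
      rw [e1, pow_succ, pow_succ]
      linarith
  have t1 : Tendsto (fun k : ℕ => (7/8:ℝ)^k * (e n0 + 8/3)) atTop (𝓝 0) := by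
    simpa using (tendsto_pow_atTop_nhds_zero_of_lt_one (show (0:ℝ) ≤ 7/8 by norm_num) (by norm_num)).mul_const (e n0 + 8/3)
  refine squeeze_zero (fun k => h0 _) (fun k => ?_) t1
  have := key k
  have : (0:ℝ) < (1/2)^k := by positivity
  linarith

include hR hS in
lemma gen_fs (i : ℕ) {ε : ℝ} (hε : 0 < ε) : ∀ᶠ N : ℕ in atTop,
    ‖(N:ℂ)⁻¹ * ∑ k ∈ Finset.range N, fs i (S.t^[k] (0, 0)) - ∫ z, fs i z‖ ≤ ε := by
  have t1 : Tendsto (fun n => ei (fs i) (σ n).H) atTop (𝓝 0) :=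
    contr_zero (fun n => norm_nonneg _) (i+1) (fun n hn => (hR n).f i (by omega))
  have t2 : Tendsto (fun n : ℕ => (1/2:ℝ)^n) atTop (𝓝 0) :=
    tendsto_pow_atTop_nhds_zero_of_lt_one (by norm_num) (by norm_num)
  have t3 := (t2.add t1).add t2
  simp only [add_zero] at t3
  obtain ⟨n0, hn0⟩ := eventually_atTop.1 ((t3.eventually (gt_mem_nhds hε)).and (eventually_ge_atTop (i+1)))
  have mono : StrictMono fun n => (σ n).N := strictMono_nat_of_lt_succ fun n => (hR n).h
  filter_upwards [eventually_ge_atTop (max 1 (σ (n0+1)).N)] with N hN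
  have hN1 : N ≠ 0 := by have := le_max_left 1 (σ (n0+1)).N; omega
  have hN2 : (σ (n0+1)).N ≤ N := (le_max_right _ _).trans hN
  have hex : ∃ k, N < (σ k).N := ⟨N+1, lt_of_lt_of_le (Nat.lt_succ_self N) (mono.id_le (N+1))⟩
  classical
  obtain ⟨k, hk⟩ : ∃ k, k = Nat.find hex := ⟨_, rfl⟩
  have hk1 : N < (σ k).N := by rw [hk]; exact Nat.find_spec hex
  have hk2 : n0 + 1 < k := mono.lt_iff_lt.1 (lt_of_le_of_lt hN2 hk1)
  obtain ⟨n, rfl⟩ : ∃ n, k = n + 1 + 1 := ⟨k - 2, by omega⟩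
  have hk3 : (σ (n+1)).N ≤ N := by
    have := Nat.find_min hex (m := n+1) (by omega)
    omega
  obtain ⟨hn1, hn2⟩ := hn0 n (by omega)
  have a1 := (hR (n+1)).i S (near_S hR hS _) N hk1.le hN1 i (by omega)
  have a2 := (hR n).g i (by omega) N hk3
  have e : ∀ a b c : ℂ, a - c = (a - b) + (b - c) := fun a b c => by ring
  rw [e _ (mn α N (fun x => fs i ((σ (n+1)).H.t (x, 0))))]
  refine (norm_add_le _ _).trans ((add_le_add a1 a2).trans ?_)
  have : (1/2:ℝ)^(n+1) ≤ (1/2)^n := pow_le_pow_of_le_one (by norm_num) (by norm_num) (by omega)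
  linarith

include hR hS in
lemma S_gen (hd : DenseRange fs) : IsGenericPt S.t volume (0, 0) := by
  intro f
  let F : C(Torus2, ℂ) := ⟨fun z => (f z : ℂ), by fun_prop⟩
  rw [Metric.tendsto_nhds]
  intro ε hε
  obtain ⟨i, hi⟩ := Metric.denseRange_iff.1 hd F (ε/4) (by linarith)
  have hi' : ∀ z, ‖F z - fs i z‖ ≤ ε/4 := fun z => by
    rw [← dist_eq_norm]; exact (ContinuousMap.dist_apply_le_dist z).trans hi.le
  filter_upwards [gen_fs hR hS i (show 0 < ε/4 by linarith), eventually_ne_atTop 0] with N hN hN0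
  have a1 : ‖(N:ℂ)⁻¹ * ∑ k ∈ Finset.range N, F (S.t^[k] (0, 0)) - (N:ℂ)⁻¹ * ∑ k ∈ Finset.range N, fs i (S.t^[k] (0, 0))‖ ≤ ε/4 := by
    rw [← mul_sub, ← Finset.sum_sub_distrib]
    exact avg_bd N hN0 (fun k => F (S.t^[k] (0,0)) - fs i (S.t^[k] (0,0))) _ (fun k _ => hi' _)
  have a2 := int_close (cint F.continuous) (cint (fs i).continuous) hi'
  have e : ((((N : ℝ)⁻¹ * ∑ k ∈ Finset.range N, f (S.t^[k] (0,0)) - ∫ y, f y : ℝ)) : ℂ) =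
      (N:ℂ)⁻¹ * ∑ k ∈ Finset.range N, F (S.t^[k] (0, 0)) - ∫ z, F z := by
    have : ∫ z, F z = ((∫ z, f z : ℝ) : ℂ) := integral_ofReal
    rw [this]; push_cast; rfl
  rw [dist_eq_norm, ← Complex.norm_real, e]
  have e2 : ∀ a b c d : ℂ, a - d = (a - b) + (b - c) - (d - c) := fun a b c d => by ring
  rw [e2 _ ((N:ℂ)⁻¹ * ∑ k ∈ Finset.range N, fs i (S.t^[k] (0, 0))) (∫ z, fs i z)]
  refine lt_of_le_of_lt ((norm_sub_le _ _).trans (add_le_add (norm_add_le _ _) le_rfl)) ?_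
  linarith

lemma set_lim (A : ℕ → Set Torus2) {a : ℝ} (ha : 0 ≤ a)
    (h : ∀ k, volume (symmDiff (A k) (A (k+1))) ≤ ENNReal.ofReal (a * (1/2)^k)) :
    volume (symmDiff {z | ∀ᶠ k in atTop, z ∈ A k} (A 0)) ≤ ENNReal.ofReal (2 * a) := by
  have hsub : symmDiff {z | ∀ᶠ k in atTop, z ∈ A k} (A 0) ⊆ ⋃ k, symmDiff (A k) (A (k+1)) := by
    intro z hz
    by_contra hc
    simp only [Set.mem_iUnion, not_exists, Set.mem_symmDiff, not_or, not_and, not_not] at hc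
    have key : ∀ k, z ∈ A k ↔ z ∈ A 0 := by
      intro k
      induction k with
      | zero => rfl
      | succ k ih => rw [← ih]; exact ⟨(hc k).2, (hc k).1⟩
    have : (∀ᶠ k in atTop, z ∈ A k) ↔ z ∈ A 0 := by simp only [key, eventually_const]
    rw [Set.mem_symmDiff] at hz
    rcases hz with ⟨h1, h2⟩ | ⟨h1, h2⟩
    · exact h2 (this.1 h1)
    · exact h2 (this.2 h1)
  refine (measure_mono hsub).trans ((measure_iUnion_le _).trans ((ENNReal.tsum_le_tsum h).trans (le_of_eq ?_)))
  rw [← ENNReal.ofReal_tsum_of_nonneg (fun k => by positivity) (summable_geometric_two.mul_left a), tsum_mul_left,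
    tsum_geometric_two, mul_comm]

def Elim (ρ t : ℕ) (σ : ℕ → Sg) : Set Torus2 := {z | ∀ᶠ k in atTop, z ∈ EE ρ t (σ k).H}

lemma Elim_meas (t : ℕ) : MeasurableSet (Elim ρ t σ) := by
  have : Elim ρ t σ = ⋃ n, ⋂ k, EE ρ t (σ (k + n)).H := by
    ext z
    simp only [Elim, Set.mem_ofPred_eq, eventually_atTop, Set.mem_iUnion, Set.mem_iInter]
    constructor
    · rintro ⟨n, h⟩; exact ⟨n, fun k => h _ (by omega)⟩
    · rintro ⟨n, h⟩
      refine ⟨n, fun k hk => ?_⟩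
      have := h (k - n)
      rwa [Nat.sub_add_cancel hk] at this
  rw [this]
  exact MeasurableSet.iUnion fun n => MeasurableSet.iInter fun k => EE_meas _ _ _

include hR in
lemma r_decay (n k : ℕ) : (σ (n+k)).r ≤ (σ n).r * (1/2)^k := by
  induction k with
  | zero => simp
  | succ k ih =>
    have := (hR (n+k)).c
    rw [pow_succ, ← add_assoc]; linarith

include hR in
lemma Elim_close (t n : ℕ) : volume (symmDiff (Elim ρ t σ) (EE ρ t (σ n).H)) ≤ ENNReal.ofReal ((σ n).r / 2) := by
  have h := set_lim (fun k => EE ρ t (σ (n + k)).H) (a := (σ n).r / 4) (by have := (σ n).hr; linarith) (fun k => by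
    refine ((hR (n+k)).b t).trans (ENNReal.ofReal_le_ofReal ((min_le_right _ _).trans ?_))
    have := r_decay hR n k
    linarith)
  have e : {z | ∀ᶠ k in atTop, z ∈ EE ρ t (σ (n + k)).H} = Elim ρ t σ := by
    ext z
    simp only [Elim, Set.mem_ofPred_eq, add_comm n]
    exact ⟨fun h => by
      rw [eventually_atTop] at h ⊢
      obtain ⟨a, ha⟩ := h
      exact ⟨a + n, fun b hb => by
        have := ha (b - n) (by omega)
        rwa [Nat.sub_add_cancel (by omega)] at this⟩, fun h => (tendsto_add_atTop_nat n).eventually h⟩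
  rw [e] at h
  refine h.trans (ENNReal.ofReal_le_ofReal (by linarith))

end AK

namespace AK

def cov (ν : Measure Torus2) (T : Torus2 → Torus2) (a b : Torus2 → ℂ) : ℂ :=
  (∫ z, a (T z) * b z ∂ν) - (∫ z, a z ∂ν) * ∫ z, b z ∂ν

lemma bint {ν : Measure Torus2} [IsProbabilityMeasure ν] {a : Torus2 → ℂ} (ha : Measurable a) {C : ℝ} (h : ∀ z, ‖a z‖ ≤ C) :
    Integrable a ν := Integrable.of_bound ha.aestronglyMeasurable C (ae_of_all _ h)

lemma cov_close {ν : Measure Torus2} [IsProbabilityMeasure ν] {T : Torus2 → Torus2} (hT : MeasurePreserving T ν ν)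
    {a a' b b' : Torus2 → ℂ} (ha : Measurable a) (ha' : Measurable a') (hb : Measurable b) (hb' : Measurable b')
    {C D : ℝ} (na : ∀ z, ‖a z‖ ≤ 1) (nb : ∀ z, ‖b z‖ ≤ 1) (na' : ∀ z, ‖a' z‖ ≤ C) (nb' : ∀ z, ‖b' z‖ ≤ D) :
    ‖cov ν T a b - cov ν T a' b'‖ ≤ 2 * (∫ z, ‖a z - a' z‖ ∂ν) + 2 * C * ∫ z, ‖b z - b' z‖ ∂ν := by
  have mT := hT.measurable
  have hC : 0 ≤ C := (norm_nonneg _).trans (na' 0)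
  have ia := bint (ν := ν) ha na
  have ia' := bint (ν := ν) ha' na'
  have ib := bint (ν := ν) hb nb
  have ib' := bint (ν := ν) hb' nb'
  have i1 : Integrable (fun z => a (T z) * b z) ν := bint (C := 1) ((ha.comp mT).mul hb) (fun z => by
    rw [norm_mul]; exact mul_le_one₀ (na _) (norm_nonneg _) (nb _))
  have i2 : Integrable (fun z => a' (T z) * b' z) ν := bint (C := C * D) ((ha'.comp mT).mul hb') (fun z => by
    rw [norm_mul]; exact mul_le_mul (na' _) (nb' _) (norm_nonneg _) hC)
  have i3 : Integrable (fun z => ‖a z - a' z‖) ν := (ia.sub ia').norm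
  have i4 : Integrable (fun z => ‖b z - b' z‖) ν := (ib.sub ib').norm
  have i5 : Integrable (fun z => ‖a (T z) - a' (T z)‖) ν := hT.integrable_comp_of_integrable i3
  have e5 : ∫ z, ‖a (T z) - a' (T z)‖ ∂ν = ∫ z, ‖a z - a' z‖ ∂ν := mp_int hT i3.aestronglyMeasurable
  have n1 : ‖(∫ z, a (T z) * b z ∂ν) - ∫ z, a' (T z) * b' z ∂ν‖ ≤ (∫ z, ‖a z - a' z‖ ∂ν) + C * ∫ z, ‖b z - b' z‖ ∂ν := by
    rw [← integral_sub i1 i2, ← e5, ← integral_const_mul, ← integral_add i5 (i4.const_mul C)]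
    refine norm_integral_le_of_norm_le (i5.add (i4.const_mul C)) (ae_of_all _ fun z => ?_)
    have e : a (T z) * b z - a' (T z) * b' z = (a (T z) - a' (T z)) * b z + a' (T z) * (b z - b' z) := by ring
    rw [e]
    refine (norm_add_le _ _).trans ?_
    rw [norm_mul, norm_mul]
    exact add_le_add (mul_le_of_le_one_right (norm_nonneg _) (nb z)) (mul_le_mul_of_nonneg_right (na' _) (norm_nonneg _))
  have n2 : ‖(∫ z, a z ∂ν) - ∫ z, a' z ∂ν‖ ≤ ∫ z, ‖a z - a' z‖ ∂ν := by
    rw [← integral_sub ia ia']; exact norm_integral_le_integral_norm _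
  have n3 : ‖(∫ z, b z ∂ν) - ∫ z, b' z ∂ν‖ ≤ ∫ z, ‖b z - b' z‖ ∂ν := by
    rw [← integral_sub ib ib']; exact norm_integral_le_integral_norm _
  have n4 : ‖∫ z, b z ∂ν‖ ≤ 1 := by simpa using norm_integral_le_of_norm_le_const (μ := ν) (ae_of_all _ nb)
  have n5 : ‖∫ z, a' z ∂ν‖ ≤ C := by simpa using norm_integral_le_of_norm_le_const (μ := ν) (ae_of_all _ na')
  have e : cov ν T a b - cov ν T a' b' = ((∫ z, a (T z) * b z ∂ν) - ∫ z, a' (T z) * b' z ∂ν) -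
      (((∫ z, a z ∂ν) - ∫ z, a' z ∂ν) * (∫ z, b z ∂ν) + (∫ z, a' z ∂ν) * ((∫ z, b z ∂ν) - ∫ z, b' z ∂ν)) := by
    unfold cov; ring
  rw [e]
  refine (norm_sub_le _ _).trans ((add_le_add n1 (norm_add_le _ _)).trans ?_)
  rw [norm_mul, norm_mul]
  have m1 := mul_le_mul n2 n4 (norm_nonneg _) ((norm_nonneg _).trans n2)
  have m2 := mul_le_mul n5 n3 (norm_nonneg _) hC
  linarith

lemma fs_approx {ν : Measure Torus2} [IsProbabilityMeasure ν] {fs : ℕ → C(Torus2, ℂ)} (hd : DenseRange fs)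
    {a : Torus2 → ℂ} (ha : Integrable a ν) {δ : ℝ} (hδ : 0 < δ) : ∃ i, ∫ z, ‖a z - fs i z‖ ∂ν ≤ δ := by
  obtain ⟨g, h1, h2⟩ := ha.exists_boundedContinuous_integral_sub_le (ε := δ/2) (by linarith)
  obtain ⟨i, hi⟩ := Metric.denseRange_iff.1 hd ⟨g, g.continuous⟩ (δ/2) (by linarith)
  refine ⟨i, ?_⟩
  have hi' : ∀ z, ‖g z - fs i z‖ ≤ δ/2 := fun z => by
    rw [← dist_eq_norm]
    exact (ContinuousMap.dist_apply_le_dist (f := ⟨g, g.continuous⟩) (g := fs i) z).trans hi.le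
  have ii : Integrable (fs i) ν := by
    obtain ⟨C, -, hC⟩ := ctm_bd (fs i)
    exact bint (fs i).continuous.measurable hC
  calc ∫ z, ‖a z - fs i z‖ ∂ν ≤ ∫ z, (‖a z - g z‖ + δ/2) ∂ν := by
        refine integral_mono (ha.sub ii).norm ((ha.sub h2).norm.add (integrable_const _)) fun z => ?_
        have : a z - fs i z = (a z - g z) + (g z - fs i z) := by ring
        simp only [Pi.add_apply, Pi.sub_apply]
        rw [this]
        exact (norm_add_le _ _).trans (by linarith [hi' z])
    _ = (∫ z, ‖a z - g z‖ ∂ν) + δ/2 := by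
        have i6 : Integrable (fun z => ‖a z - g z‖) ν := (ha.sub h2).norm
        rw [integral_add i6 (integrable_const _)]; simp
    _ ≤ δ := by linarith

lemma wm_of {ν : Measure Torus2} [IsProbabilityMeasure ν] {T : Torus2 → Torus2} (hT : MeasurePreserving T ν ν)
    {fs : ℕ → C(Torus2, ℂ)} (hd : DenseRange fs) (m : ℕ → ℕ)
    (h : ∀ i j, Tendsto (fun n => cov ν (T^[m n]) (fs i) (fs j)) atTop (𝓝 0)) {A B : Set Torus2}
    (hA : MeasurableSet A) (hB : MeasurableSet B) :
    Tendsto (fun n => |(ν (B ∩ (T^[m n]) ⁻¹' A)).toReal - (ν A).toReal * (ν B).toReal|) atTop (𝓝 0) := by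
  let a : Torus2 → ℂ := A.indicator fun _ => 1
  let b : Torus2 → ℂ := B.indicator fun _ => 1
  have ma : Measurable a := measurable_const.indicator hA
  have mb : Measurable b := measurable_const.indicator hB
  have na : ∀ z, ‖a z‖ ≤ 1 := fun z => by
    refine (norm_indicator_le_norm_self _ _).trans ?_; simp
  have nb : ∀ z, ‖b z‖ ≤ 1 := fun z => by
    refine (norm_indicator_le_norm_self _ _).trans ?_; simp
  have ic : ∀ C : Set Torus2, MeasurableSet C → ∫ z, C.indicator (fun _ => (1:ℂ)) z ∂ν = ((ν C).toReal : ℂ) := by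
    intro C hC
    rw [integral_indicator hC]; simp [measureReal_def]
  have e : ∀ n, cov ν (T^[m n]) a b = (((ν (B ∩ (T^[m n]) ⁻¹' A)).toReal - (ν A).toReal * (ν B).toReal : ℝ) : ℂ) := by
    intro n
    unfold cov
    have e1 : ∀ z, a (T^[m n] z) * b z = (B ∩ (T^[m n]) ⁻¹' A).indicator (fun _ => (1:ℂ)) z := by
      intro z
      simp only [a, b, Set.indicator_apply, Set.mem_inter_iff, Set.mem_preimage]
      by_cases h1 : z ∈ B <;> by_cases h2 : T^[m n] z ∈ A <;> simp [h1, h2]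
    simp only [e1]
    rw [ic _ (hB.inter ((hT.measurable.iterate _) hA)), ic _ hA, ic _ hB]
    push_cast; rfl
  have goal : Tendsto (fun n => cov ν (T^[m n]) a b) atTop (𝓝 0) := by
    rw [Metric.tendsto_nhds]
    intro ε hε
    obtain ⟨i, hi⟩ := fs_approx hd (bint (ν := ν) ma na) (δ := ε/8) (by linarith)
    obtain ⟨C, hC, nC⟩ := ctm_bd (fs i)
    obtain ⟨j, hj⟩ := fs_approx hd (bint (ν := ν) mb nb) (δ := ε/(8*C)) (by positivity)
    obtain ⟨D, hD, nD⟩ := ctm_bd (fs j)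
    filter_upwards [Metric.tendsto_nhds.1 (h i j) (ε/4) (by linarith)] with n hn
    have hc := cov_close (hT.iterate (m n)) ma (fs i).continuous.measurable mb (fs j).continuous.measurable na nb nC nD
    rw [dist_zero_right] at hn ⊢
    have k1 : 2 * C * ∫ z, ‖b z - fs j z‖ ∂ν ≤ ε/4 := by
      calc _ ≤ 2 * C * (ε/(8*C)) := by gcongr
        _ = ε/4 := by field_simp; norm_num
    have := norm_le_norm_add_norm_sub' (cov ν (T^[m n]) a b) (cov ν (T^[m n]) (fs i) (fs j))
    linarith
  have := goal.norm
  simp only [e, Complex.norm_real, Real.norm_eq_abs, norm_zero] at this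
  exact this

end AK

namespace AK

attribute [local irreducible] PD.t

lemma EE_rot (ρ t : ℕ) (H : PD) (α : ℝ) : EE ρ t (H * rot α) = EE ρ t H := by
  ext z
  simp only [EE, St, Set.mem_preimage, mul_inv_rev, PD.mul_t_apply, rot_inv, rot_t]

lemma EE_inv (ρ t : ℕ) (H : PD) (α : ℝ) (F : Torus2 → ℂ) :
    ∫ z in EE ρ t H, F ((Tc H α).t z) = ∫ z in EE ρ t H, F z := by
  rw [EE_int ρ t H (F := fun z => F ((Tc H α).t z)), ← EE_rot ρ t H α, EE_int]
  simp only [Tc, PD.mul_t_apply, PD.inv_t_t]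

lemma EE_vol (ρ t : ℕ) (ht : t < 2^ρ) (H : PD) : volume (EE ρ t H) = ENNReal.ofReal (1/2^ρ) := by
  unfold EE
  rw [(H⁻¹).t_mp.measure_preimage (St_meas ρ t).nullMeasurableSet]
  unfold St
  rw [vol_snd, JJ_vol ρ t ht]

variable {α : ℝ} {ρ : ℕ} {fs : ℕ → C(Torus2, ℂ)} {σ : ℕ → Sg} (hR : ∀ n, Rel α ρ fs n (σ n) (σ (n+1)))
  {S : PD} (hS : ∀ z, Tendsto (fun n => (Tc (σ n).H α).t z) atTop (𝓝 (S.t z)))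

include hR in
lemma r_zero : Tendsto (fun n => (σ n).r) atTop (𝓝 0) := by
  have t2 : Tendsto (fun n : ℕ => (σ 0).r * (1/2:ℝ)^n) atTop (𝓝 0) := by
    simpa using (tendsto_pow_atTop_nhds_zero_of_lt_one (show (0:ℝ) ≤ 1/2 by norm_num) (by norm_num)).const_mul (σ 0).r
  refine squeeze_zero (fun n => (σ n).hr.le) (fun n => ?_) t2
  simpa using r_decay hR 0 n

include hR in
lemma Elim_close' (t n : ℕ) : (volume (symmDiff (Elim ρ t σ) (EE ρ t (σ n).H))).toReal ≤ (σ n).r :=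
  ENNReal.toReal_le_of_le_ofReal (σ n).hr.le ((Elim_close hR t n).trans
    (ENNReal.ofReal_le_ofReal (by have := (σ n).hr; linarith)))

include hR in
lemma Elim_int (t : ℕ) {F : Torus2 → ℂ} (hF : Continuous F) :
    Tendsto (fun n => ∫ z in EE ρ t (σ n).H, F z) atTop (𝓝 (∫ z in Elim ρ t σ, F z)) := by
  obtain ⟨C, hC, hb⟩ := ctm_bd ⟨F, hF⟩
  rw [tendsto_iff_norm_sub_tendsto_zero]
  have t1 : Tendsto (fun n => C * (σ n).r) atTop (𝓝 0) := by simpa using (r_zero hR).const_mul C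
  refine squeeze_zero (fun n => norm_nonneg _) (fun n => ?_) t1
  rw [norm_sub_rev]
  refine (setdiff_bd hF hb (Elim_meas t) (EE_meas _ _ _)).trans ?_
  exact mul_le_mul_of_nonneg_left (Elim_close' hR t n) hC.le

include hR in
lemma Elim_vol (t : ℕ) (ht : t < 2^ρ) : volume (Elim ρ t σ) = ENNReal.ofReal (1/2^ρ) := by
  have h := Elim_int hR t (F := fun _ => 1) continuous_const
  have e : ∀ E : Set Torus2, ∫ z in E, (1:ℂ) = ((volume E).toReal : ℂ) := fun E => by
    simp [measureReal_def]
  simp only [e, EE_vol ρ t ht] at h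
  have h2 := tendsto_nhds_unique tendsto_const_nhds h
  have h3 : (ENNReal.ofReal (1/2^ρ)).toReal = (volume (Elim ρ t σ)).toReal := by exact_mod_cast h2
  exact ((ENNReal.toReal_eq_toReal_iff' ENNReal.ofReal_ne_top (measure_ne_top _ _)).1 h3).symm

include hR hS in
lemma Elim_inv (t : ℕ) (F : C(Torus2, ℂ)) : ∫ z in Elim ρ t σ, F (S.t z) = ∫ z in Elim ρ t σ, F z := by
  have t1 := Elim_int hR t F.continuous
  have t2 := Elim_int hR t (F.continuous.comp S.t_cont)
  refine tendsto_nhds_unique t2 ?_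
  refine t1.congr_dist ?_
  rw [Metric.tendsto_nhds]
  intro ε hε
  obtain ⟨δ, hδ, hu⟩ := Metric.uniformContinuous_iff.1
      (CompactSpace.uniformContinuous_of_continuous F.continuous) (ε/2) (by linarith)
  filter_upwards [Metric.tendsto_nhds.1 (r_zero hR) δ hδ] with n hn
  rw [Real.dist_0_eq_abs, abs_of_pos (σ n).hr] at hn
  rw [← EE_inv ρ t (σ n).H α F, Real.dist_0_eq_abs, abs_of_nonneg dist_nonneg, dist_eq_norm]
  refine lt_of_le_of_lt (set_close (ε := ε/2) (F.continuous.comp (Tc (σ n).H α).t_cont) (F.continuous.comp S.t_cont)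
    (by linarith) fun z => ?_) (by linarith)
  rw [← dist_eq_norm]
  refine (hu ?_).le
  rw [dist_comm]
  exact (near_S hR hS n z).trans_lt hn

def nu (ρ t : ℕ) (σ : ℕ → Sg) : Measure Torus2 := (2^ρ : ℝ≥0∞) • volume.restrict (Elim ρ t σ)

lemma nu_int (t : ℕ) (F : Torus2 → ℂ) : ∫ z, F z ∂(nu ρ t σ) = (2^ρ:ℂ) * ∫ z in Elim ρ t σ, F z := by
  unfold nu
  rw [integral_smul_measure]
  simp [Algebra.smul_def]

lemma two_mul_inv : (2^ρ : ℝ≥0∞) * ENNReal.ofReal (1/2^ρ) = 1 := by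
  have : (2^ρ : ℝ≥0∞) = ENNReal.ofReal (2^ρ) := by
    rw [ENNReal.ofReal_pow (by norm_num)]; simp
  rw [this, ← ENNReal.ofReal_mul (by positivity)]
  have : (2:ℝ)^ρ * (1/2^ρ) = 1 := by field_simp
  rw [this]; simp

include hR in
lemma nu_prob (t : ℕ) (ht : t < 2^ρ) : IsProbabilityMeasure (nu ρ t σ) := ⟨by
  unfold nu
  rw [Measure.smul_apply, Measure.restrict_apply_univ, Elim_vol hR t ht, smul_eq_mul, two_mul_inv]⟩

lemma nu_ac (t : ℕ) : nu ρ t σ ≪ (volume : Measure Torus2) :=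
  Measure.smul_absolutelyContinuous.trans Measure.restrict_le_self.absolutelyContinuous

include hR in
lemma nu_inj {t t' : ℕ} (ht : t < 2^ρ) (h : nu ρ t σ = nu ρ t' σ) : t = t' := by
  by_contra hne
  have e1 : nu ρ t σ (Elim ρ t σ) = 1 := by
    unfold nu
    rw [Measure.smul_apply, Measure.restrict_apply_self, Elim_vol hR t ht, smul_eq_mul, two_mul_inv]
  have e2 : nu ρ t' σ (Elim ρ t σ) = 0 := by
    unfold nu
    rw [Measure.smul_apply, Measure.restrict_apply (Elim_meas t)]
    have : Elim ρ t σ ∩ Elim ρ t' σ = ∅ := by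
      ext z
      simp only [Set.mem_inter_iff, Set.mem_empty_iff_false, iff_false]
      rintro ⟨h1, h2⟩
      obtain ⟨k, hk1, hk2⟩ := (Filter.Eventually.and h1 h2).exists
      exact hne (Eq.trans (Eq.symm hk1) hk2)
    rw [this]; simp
  rw [h, e2] at e1
  exact zero_ne_one e1

include hR hS in
lemma nu_mp (t : ℕ) (ht : t < 2^ρ) : MeasurePreserving S.t (nu ρ t σ) (nu ρ t σ) := by
  have := nu_prob hR t ht
  refine ⟨S.t_cont.measurable, ?_⟩
  have : IsFiniteMeasure (Measure.map S.t (nu ρ t σ)) := inferInstance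
  apply ext_of_forall_integral_eq_of_IsFiniteMeasure
  intro f
  rw [integral_map S.t_cont.measurable.aemeasurable f.continuous.aestronglyMeasurable]
  have h := Elim_inv hR hS t ⟨fun z => (f z : ℂ), by fun_prop⟩
  simp only [ContinuousMap.coe_mk] at h
  have e1 := nu_int (ρ := ρ) (σ := σ) t (fun z => (f z : ℂ))
  have e2 := nu_int (ρ := ρ) (σ := σ) t (fun z => (f (S.t z) : ℂ))
  rw [h, ← e1] at e2
  have e3 : ∫ z, ((f (S.t z) : ℝ) : ℂ) ∂(nu ρ t σ) = ((∫ z, f (S.t z) ∂(nu ρ t σ) : ℝ) : ℂ) := integral_ofReal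
  have e4 : ∫ z, ((f z : ℝ) : ℂ) ∂(nu ρ t σ) = ((∫ z, f z ∂(nu ρ t σ) : ℝ) : ℂ) := integral_ofReal
  rw [e3, e4] at e2
  exact_mod_cast e2

include hR hS in
lemma nu_wm (hd : DenseRange fs) (t : ℕ) (ht : t < 2^ρ) : IsWeakMixingWrt S.t (nu ρ t σ) := by
  have := nu_prob hR t ht
  choose m hm hmix using fun n => (hR n).e
  have hm' : Tendsto m atTop atTop := tendsto_atTop_mono hm tendsto_id
  obtain ⟨φ, hφ, hmφ⟩ := strictMono_subseq_of_tendsto_atTop hm'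
  refine ⟨m ∘ φ, hmφ, fun A B hA hB => wm_of (nu_mp hR hS t ht) hd (m ∘ φ) (fun i j => ?_) hA hB⟩
  have key : Tendsto (fun n => cov (nu ρ t σ) (S.t^[m n]) (fs i) (fs j)) atTop (𝓝 0) := by
    have e : ∀ n, cov (nu ρ t σ) (S.t^[m n]) (fs i) (fs j) = 2^ρ * mixv (2^ρ) (Elim ρ t σ) S (m n) (fs i) (fs j) := by
      intro n
      unfold cov mixv
      rw [nu_int, nu_int, nu_int]
      push_cast; ring
    have t2 : Tendsto (fun n : ℕ => (2^ρ:ℝ) * (2 * (1/2:ℝ)^n)) atTop (𝓝 0) := by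
      simpa using ((tendsto_pow_atTop_nhds_zero_of_lt_one (show (0:ℝ) ≤ 1/2 by norm_num) (by norm_num)).const_mul
        (2:ℝ)).const_mul ((2:ℝ)^ρ)
    refine squeeze_zero_norm' ?_ t2
    filter_upwards [eventually_gt_atTop (max i j)] with n hn
    rw [e, norm_mul, norm_pow, Complex.norm_ofNat]
    refine mul_le_mul_of_nonneg_left ?_ (by positivity)
    exact hmix n S (near_S hR hS (n+1)) t ht _ (Elim_meas t) ((Elim_close hR t (n+1)).trans
      (ENNReal.ofReal_le_ofReal (by have := (σ (n+1)).hr; linarith))) i ((le_max_left _ _).trans_lt hn) j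
      ((le_max_right _ _).trans_lt hn)
  exact key.comp hφ.tendsto_atTop

end AK

/-- **Theorem A.** For any `r ≥ 1` and any Liouville number `α`, there is a minimal
`T ∈ 𝒜_α(𝕋²)` (a C^∞ limit of conjugates `Hₙ ∘ S_α ∘ Hₙ⁻¹` of the translation `S_α` by
μ-preserving C^∞ diffeomorphisms) such that Lebesgue measure is generic for `T` and there are
`r` pairwise distinct absolutely continuous invariant probability measures with respect to each
of which `T` is weakly mixing. -/
theorem anosov_katok_generic_weak_mixing (r : ℕ) (hr : 1 ≤ r) (α : ℝ) (hα : Liouville α) :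
    ∃ T : SmoothMPTorusDiffeo,
      -- (1) `T` lies in `𝒜_α(𝕋²)`: C^∞ convergence of `Hₙ ∘ S_α ∘ Hₙ⁻¹` to `T`
      (∃ H : ℕ → SmoothMPTorusDiffeo,
        (∀ j : ℕ, TendstoUniformly
          (fun n => iteratedFDeriv ℝ j ((H n).lift ∘ Slift α ∘ (H n).liftInv))
          (iteratedFDeriv ℝ j T.lift) atTop) ∧
        (∀ j : ℕ, TendstoUniformly
          (fun n => iteratedFDeriv ℝ j ((H n).lift ∘ Slift (-α) ∘ (H n).liftInv))
          (iteratedFDeriv ℝ j T.liftInv) atTop)) ∧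
      -- (2) minimality
      IsMinimalMap T.toEquiv ∧
      -- (3) Lebesgue measure is a generic measure for `T`
      (∃ x : Torus2, IsGenericPt T.toEquiv volume x) ∧
      -- (4) `r` distinct absolutely continuous invariant weak mixing measures
      (∃ μs : Fin r → Measure Torus2,
        (∀ t, IsProbabilityMeasure (μs t)) ∧
        Function.Injective μs ∧
        (∀ t, μs t ≪ (volume : Measure Torus2)) ∧
        (∀ t, MeasurePreserving T.toEquiv (μs t) (μs t)) ∧
        (∀ t, IsWeakMixingWrt T.toEquiv (μs t))) := by
  have _ := hr
  let fs := TopologicalSpace.denseSeq C(Torus2, ℂ)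
  have hd : DenseRange fs := TopologicalSpace.denseRange_denseSeq _
  obtain ⟨σ, hR⟩ := AK.seq hα r fs
  have hmin : ∀ n, min ((1/2:ℝ)^n) ((σ n).r/4) ≤ (1/2)^n := fun n => min_le_left _ _
  obtain ⟨S, S1, S2, hS⟩ := AK.PD_lim (fun n => AK.Tc (σ n).H α)
    (fun n k hk x => ((hR n).a.1 k hk x).trans (hmin n)) (fun n k hk x => ((hR n).a.2 k hk x).trans (hmin n))
  have ht : ∀ t : Fin r, (t : ℕ) < 2^r := fun t => t.2.trans Nat.lt_two_pow_self
  have c : ∀ (n : ℕ) (s : ℝ), (σ n).H.toS.lift ∘ Slift s ∘ (σ n).H.toS.liftInv = (AK.Tc (σ n).H s).f := by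
    intro n s
    simp only [AK.Tc, AK.PD.mul_f, AK.PD.inv_f, AK.rot_f]
    rfl
  refine ⟨S.toS, ⟨fun n => (σ n).H.toS, fun j => ?_, fun j => ?_⟩, AK.S_min hR hS, ⟨(0, 0), AK.S_gen hR hS hd⟩,
    fun t => AK.nu r t σ, fun t => AK.nu_prob hR t (ht t), fun t t' h => Fin.ext (AK.nu_inj hR (ht t) h),
    fun t => AK.nu_ac t, fun t => AK.nu_mp hR hS t (ht t), fun t => AK.nu_wm hR hS hd t (ht t)⟩
  · simp only [c]
    exact S1 j
  · simp only [c, ← AK.Tc_inv, AK.PD.inv_f]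
    exact S2 j
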